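/- Assume the Riemann Hypothesis. Then, as N → ∞, Σ_{n=N+1}^{N+H} r''_{2,2}(n) = (π/4) H + O( H²/N + H^{1/2} N^{1/4} (log N)^{3/2} ), uniformly for H in the range N^{1/2}(log N)³ = o(H) and H = o(N). -/

import Mathlib

open Finset Filter Asymptotics

/-- `r''_{2,2}(n) = ∑_{p₁² + p₂² = n} log p₁ log p₂`, the sum running over pairs of primes,
counting weighted representations of `n` as a sum of two prime squares. -/
noncomputable def r22 (n : ℕ) : ℝ :=
  ∑ p1 ∈ Finset.range (n + 1), ∑ p2 ∈ Finset.range (n + 1),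
    if p1.Prime ∧ p2.Prime ∧ p1 ^ 2 + p2 ^ 2 = n then Real.log p1 * Real.log p2 else 0

/-- A factorization with zeros in the closed disc of radius `r` has a bounded number of factors. -/
lemma card_zeros_mul_log_le {f g : ℂ → ℂ} {r R M : ℝ}
    (hr : 0 < r) (hrR : r < R) (hM : ∀ z : ℂ, ‖z‖ = R → ‖f z‖ ≤ M) {n : ℕ} {ρ : Fin n → ℂ}
    (hg : Differentiable ℂ g) (hρ : ∀ i, ‖ρ i‖ ≤ r) (hfg : ∀ z, f z = (∏ i, (z - ρ i)) * g z) :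
    (∀ z : ℂ, ‖z‖ ≤ R → ‖g z * ∏ i, ((R : ℂ) ^ 2 - (starRingEnd ℂ) (ρ i) * z) / R‖ ≤ M) ∧
    ‖f 0‖ * (R / r) ^ n ≤ ‖g 0 * ∏ i, ((R : ℂ) ^ 2 - (starRingEnd ℂ) (ρ i) * 0) / R‖ := by
  have hR : 0 < R := hr.trans hrR
  constructor
  · intro z hz
    have hd : DiffContOnCl ℂ (fun z => g z * ∏ i, ((R : ℂ) ^ 2 - (starRingEnd ℂ) (ρ i) * z) / R)
        (Metric.ball 0 R) := by
      apply Differentiable.diffContOnCl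
      fun_prop
    refine Complex.norm_le_of_forall_mem_frontier_norm_le (Metric.isBounded_ball) hd ?_
      (z := z) ?_
    · intro w hw
      rw [frontier_ball (0 : ℂ) hR.ne', mem_sphere_zero_iff_norm] at hw
      refine le_trans (le_of_eq ?_) (hM w hw)
      rw [hfg w, norm_mul, norm_mul, mul_comm, norm_prod, norm_prod]
      congr 1
      refine Finset.prod_congr rfl fun i _ => ?_
      have h1 : (R : ℂ) ^ 2 = (starRingEnd ℂ) w * w := by
        rw [mul_comm, Complex.mul_conj, Complex.normSq_eq_norm_sq, hw]; push_cast; rfl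
      rw [h1, ← sub_mul, ← map_sub, norm_div, norm_mul, RCLike.norm_conj, hw, Complex.norm_real,
        Real.norm_of_nonneg hR.le, mul_div_cancel_right₀ _ hR.ne']
    · rw [closure_ball (0 : ℂ) hR.ne', mem_closedBall_zero_iff]; exact hz
  · rw [hfg 0, norm_mul, norm_mul, norm_prod]
    have h1 : ∏ i, ‖(0 : ℂ) - ρ i‖ ≤ r ^ n := by
      calc ∏ i, ‖(0 : ℂ) - ρ i‖ ≤ ∏ _i : Fin n, r :=
            Finset.prod_le_prod (fun _ _ => norm_nonneg _) (fun i _ => by simpa using hρ i)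
        _ = r ^ n := by simp
    have h2 : ‖∏ i : Fin n, ((R : ℂ) ^ 2 - (starRingEnd ℂ) (ρ i) * 0) / R‖ = R ^ n := by
      rw [norm_prod]
      have : ∀ i : Fin n, ‖((R : ℂ) ^ 2 - (starRingEnd ℂ) (ρ i) * 0) / R‖ = R := by
        intro i
        rw [mul_zero, sub_zero, norm_div, norm_pow, Complex.norm_real, Real.norm_of_nonneg hR.le]
        field_simp
      simp_rw [this]; simp
    rw [h2, div_pow]
    calc (∏ i, ‖(0 : ℂ) - ρ i‖) * ‖g 0‖ * (R ^ n / r ^ n)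
        ≤ r ^ n * ‖g 0‖ * (R ^ n / r ^ n) := by gcongr
      _ = ‖g 0‖ * R ^ n := by field_simp

lemma exists_zero_factorization {f : ℂ → ℂ} (hf : Differentiable ℂ f) (h0 : f 0 ≠ 0) {r R M : ℝ}
    (hr : 0 < r) (hrR : r < R) (hM : ∀ z : ℂ, ‖z‖ = R → ‖f z‖ ≤ M) :
    ∃ (n : ℕ) (ρ : Fin n → ℂ) (g : ℂ → ℂ), Differentiable ℂ g ∧ (∀ i, ‖ρ i‖ ≤ r) ∧
      (∀ z, f z = (∏ i, (z - ρ i)) * g z) ∧ ∀ z : ℂ, ‖z‖ ≤ r → g z ≠ 0 := by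
  by_contra! hcon
  have hall : ∀ n : ℕ, ∃ (ρ : Fin n → ℂ) (g : ℂ → ℂ), Differentiable ℂ g ∧ (∀ i, ‖ρ i‖ ≤ r) ∧
      (∀ z, f z = (∏ i, (z - ρ i)) * g z) := by
    intro n
    induction n with
    | zero => exact ⟨fun _ => 0, f, hf, fun i => i.elim0, by simp⟩
    | succ n ih =>
      obtain ⟨ρ, g, hg, hρ, hfg⟩ := ih
      obtain ⟨a, ha, hga⟩ := hcon n ρ g hg hρ hfg
      refine ⟨Fin.cons a ρ, dslope g a, ?_, ?_, ?_⟩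
      · rw [← differentiableOn_univ, Complex.differentiableOn_dslope Filter.univ_mem]
        exact hg.differentiableOn
      · intro i
        refine Fin.cases ?_ (fun j => ?_) i
        · simpa using ha
        · simpa using hρ j
      · intro z
        have := sub_smul_dslope g a z
        rw [hga, sub_zero, smul_eq_mul] at this
        rw [Fin.prod_univ_succ, hfg z, ← this]
        simp only [Fin.cons_zero, Fin.cons_succ]
        ring
  have hM0 : ∀ n : ℕ, ‖f 0‖ * (R / r) ^ n ≤ M := by
    intro n
    obtain ⟨ρ, g, hg, hρ, hfg⟩ := hall n
    obtain ⟨h1, h2⟩ := card_zeros_mul_log_le hr hrR hM hg hρ hfg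
    exact h2.trans (h1 0 (by simpa using (hr.trans hrR).le))
  have h1 : 1 < R / r := (one_lt_div hr).2 hrR
  obtain ⟨n, hn⟩ := pow_unbounded_of_one_lt (M / ‖f 0‖) h1
  have := hM0 n
  rw [div_lt_iff₀ (norm_pos_iff.2 h0)] at hn
  linarith

/-- Local bound for the logarithmic derivative in terms of nearby zeros. -/
lemma exists_logDeriv_bound {r₀ r₁ r R : ℝ} (hr₀ : 0 < r₀) (h01 : r₀ < r₁) (h1r : r₁ < r)
    (hrR : r < R) :
    ∃ K : ℝ, 0 < K ∧ ∀ (f : ℂ → ℂ) (B : ℝ), Differentiable ℂ f → f 0 ≠ 0 → 0 < B →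
      (∀ z : ℂ, ‖z‖ = R → ‖f z‖ ≤ ‖f 0‖ * Real.exp B) →
      ∃ (n : ℕ) (ρ : Fin n → ℂ), (n : ℝ) ≤ K * B ∧ (∀ i, f (ρ i) = 0) ∧
        ∀ z : ℂ, ‖z‖ ≤ r₀ → f z ≠ 0 →
          ‖logDeriv f z - ∑ i, 1 / (z - ρ i)‖ ≤ K * B := by
  have hr1 : 0 < r₁ := hr₀.trans h01
  have hr : 0 < r := hr1.trans h1r
  have hR : 0 < R := hr.trans hrR
  have hlog : 0 < Real.log (R / r) := Real.log_pos ((one_lt_div hr).2 hrR)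
  have hden : 0 < R ^ 2 - r * r₀ := by nlinarith
  set K1 := 1 / Real.log (R / r) with hK1
  set K2 := 2 * r₁ / (r - r₁) / (r₁ - r₀) with hK2
  have hK1p : 0 < K1 := by positivity
  have hK2p : 0 < K2 := div_pos (div_pos (by linarith) (by linarith)) (by linarith)
  refine ⟨K1 + K2 + K1 * (r / (R ^ 2 - r * r₀)), by positivity, ?_⟩
  intro f B hf h0 hB hM
  obtain ⟨n, ρ, g, hg, hρ, hfg, hgne⟩ := exists_zero_factorization hf h0 hr hrR hM
  obtain ⟨hF1, hF2⟩ := card_zeros_mul_log_le hr hrR hM hg hρ hfg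
  set F : ℂ → ℂ := fun z => g z * ∏ i, ((R : ℂ) ^ 2 - (starRingEnd ℂ) (ρ i) * z) / R with hF
  have hf0 : 0 < ‖f 0‖ := norm_pos_iff.2 h0
  have hn : (n : ℝ) ≤ K1 * B := by
    have h1 : ‖f 0‖ * (R / r) ^ n ≤ ‖f 0‖ * Real.exp B :=
      hF2.trans (hF1 0 (by simpa using hR.le))
    have h2 := (mul_le_mul_iff_right₀ hf0).1 h1
    have h3 := Real.log_le_log (by positivity) h2
    rw [Real.log_exp, Real.log_pow] at h3
    rw [hK1, one_div, inv_mul_eq_div, le_div_iff₀ hlog]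
    exact h3
  have hFd : Differentiable ℂ F := by simp only [hF]; fun_prop
  have hfac : ∀ i, ∀ z : ℂ, ‖z‖ ≤ r → (R : ℂ) ^ 2 - (starRingEnd ℂ) (ρ i) * z ≠ 0 := by
    intro i z hz h
    have h1 : ‖(R : ℂ) ^ 2‖ = ‖(starRingEnd ℂ) (ρ i) * z‖ := by rw [sub_eq_zero.1 h]
    rw [norm_pow, norm_mul, RCLike.norm_conj, Complex.norm_real, Real.norm_of_nonneg hR.le] at h1
    nlinarith [hρ i, norm_nonneg z, norm_nonneg (ρ i), mul_le_mul (hρ i) hz (norm_nonneg z) hr.le]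
  have hRC : (R : ℂ) ≠ 0 := by exact_mod_cast hR.ne'
  have hFne : ∀ z : ℂ, ‖z‖ ≤ r → F z ≠ 0 := by
    intro z hz
    simp only [hF]
    refine mul_ne_zero (hgne z hz) (Finset.prod_ne_zero_iff.2 fun i _ => ?_)
    exact div_ne_zero (hfac i z hz) hRC
  have hF0 : F 0 ≠ 0 := hFne 0 (by simpa using hr.le)
  -- a branch of the logarithm of `F / F 0`
  have hLd : DifferentiableOn ℂ (logDeriv F) (Metric.ball 0 r) := by
    intro z hz
    have hz' : ‖z‖ ≤ r := by rw [mem_ball_zero_iff] at hz; exact hz.le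
    have : DifferentiableAt ℂ (deriv F) z :=
      (hFd.differentiableOn.analyticAt (s := Set.univ) Filter.univ_mem).deriv.differentiableAt
    exact (this.div (hFd z) (hFne z hz')).differentiableWithinAt
  obtain ⟨l, hl0, hl⟩ := hLd.isExactOn_ball.with_val_at 0 0
  have hexp : ∀ z ∈ Metric.ball (0 : ℂ) r, F z = F 0 * Complex.exp (l z) := by
    have hder : ∀ z ∈ Metric.ball (0 : ℂ) r,
        HasDerivAt (fun z => F z * Complex.exp (-l z)) 0 z := by
      intro z hz
      have hz' : ‖z‖ ≤ r := by rw [mem_ball_zero_iff] at hz; exact hz.le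
      have h := (hFd z).hasDerivAt.mul ((hl z hz).neg.cexp)
      have h2 : deriv F z * Complex.exp ((-l) z) + F z * (Complex.exp ((-l) z) * -logDeriv F z)
          = 0 := by
        have := hFne z hz'
        rw [logDeriv_apply]
        field_simp
        ring
      rw [h2] at h
      exact h
    intro z hz
    have hconst := (convex_ball (0 : ℂ) r).is_const_of_fderivWithin_eq_zero (𝕜 := ℂ)
      (f := fun z => F z * Complex.exp (-l z))
      (fun w hw => (hder w hw).differentiableAt.differentiableWithinAt)
      (fun w hw => by
        rw [fderivWithin_of_isOpen Metric.isOpen_ball hw]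
        ext; simp [(hder w hw).deriv]) hz (Metric.mem_ball_self hr)
    simp only [hl0, neg_zero, Complex.exp_zero, mul_one] at hconst
    rw [← hconst, mul_assoc, ← Complex.exp_add, neg_add_cancel, Complex.exp_zero, mul_one]
  have hre : Set.MapsTo l (Metric.ball 0 r) {z | z.re ≤ B} := by
    intro z hz
    have hz' : ‖z‖ ≤ r := by rw [mem_ball_zero_iff] at hz; exact hz.le
    have h1 : ‖F z‖ ≤ ‖f 0‖ * Real.exp B := hF1 z (hz'.trans hrR.le)
    rw [hexp z hz, norm_mul, Complex.norm_exp] at h1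
    have h2 : ‖f 0‖ ≤ ‖F 0‖ := by
      refine le_trans ?_ hF2
      exact le_mul_of_one_le_right hf0.le (one_le_pow₀ ((one_lt_div hr).2 hrR).le)
    have h3 : ‖f 0‖ * Real.exp (l z).re ≤ ‖f 0‖ * Real.exp B :=
      le_trans (by gcongr) h1
    exact Real.exp_le_exp.1 ((mul_le_mul_iff_right₀ hf0).1 h3)
  have hld : DifferentiableOn ℂ l (Metric.ball 0 r) :=
    fun z hz => (hl z hz).differentiableAt.differentiableWithinAt
  have hlb : ∀ z : ℂ, ‖z‖ ≤ r₁ → ‖l z‖ ≤ 2 * B * r₁ / (r - r₁) := by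
    intro z hz
    have h := Complex.borelCaratheodory_zero hB hld hre hr
      (z := z) (by rw [mem_ball_zero_iff]; linarith) hl0
    refine h.trans ?_
    have : 0 < r - r₁ := by linarith
    gcongr
  have hlogF : ∀ z : ℂ, ‖z‖ ≤ r₀ → ‖logDeriv F z‖ ≤ K2 * B := by
    intro z hz
    have hzr : z ∈ Metric.ball (0 : ℂ) r := by rw [mem_ball_zero_iff]; linarith
    rw [← (hl z hzr).deriv]
    have hs : 0 < r₁ - r₀ := by linarith
    have hsub : Metric.closedBall z (r₁ - r₀) ⊆ Metric.ball 0 r := by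
      intro w hw
      rw [mem_closedBall_iff_norm] at hw
      rw [mem_ball_zero_iff]
      have := norm_add_le (w - z) z
      rw [sub_add_cancel] at this
      linarith
    have h := Complex.norm_deriv_le_of_forall_mem_sphere_norm_le (f := l) hs
      (C := 2 * B * r₁ / (r - r₁))
      (((hld.mono hsub).mono (by
        rw [closure_ball z hs.ne'] )).diffContOnCl) (fun w hw => hlb w ?_)
    · refine h.trans (le_of_eq ?_)
      rw [hK2]; ring
    · have h3 : ‖w - z‖ = r₁ - r₀ := by simpa [mem_sphere_iff_norm] using hw
      have := norm_add_le (w - z) z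
      rw [sub_add_cancel] at this
      linarith
  refine ⟨n, ρ, hn.trans ?_, fun i => ?_, fun z hz hfz => ?_⟩
  · have : 0 ≤ K1 * (r / (R ^ 2 - r * r₀)) := by positivity
    nlinarith
  · rw [hfg, Finset.prod_eq_zero (Finset.mem_univ i) (sub_self _), zero_mul]
  have hzr : ‖z‖ ≤ r := by linarith
  have hρz : ∀ i, z - ρ i ≠ 0 := by
    intro i h
    apply hfz
    rw [hfg, Finset.prod_eq_zero (Finset.mem_univ i) h, zero_mul]
  have e1 : logDeriv f z = ∑ i, 1 / (z - ρ i) + logDeriv g z := by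
    have : f = fun z => (∏ i, (z - ρ i)) * g z := funext hfg
    rw [this, logDeriv_mul (f := fun z => ∏ i, (z - ρ i)) z
      (Finset.prod_ne_zero_iff.2 fun i _ => hρz i) (hgne z hzr) (by fun_prop) (hg z),
      logDeriv_prod (s := Finset.univ) (f := fun i z => z - ρ i) (x := z)
        (fun i _ => hρz i) (fun i _ => by fun_prop)]
    congr 1
    refine Finset.sum_congr rfl fun i _ => ?_
    rw [logDeriv_apply]
    simp
  have e2 : logDeriv F z = logDeriv g z +
      ∑ i, -(starRingEnd ℂ) (ρ i) / ((R : ℂ) ^ 2 - (starRingEnd ℂ) (ρ i) * z) := by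
    simp only [hF]
    rw [logDeriv_mul (f := g) (g := fun z => ∏ i, ((R : ℂ) ^ 2 - (starRingEnd ℂ) (ρ i) * z) / R) z
      (hgne z hzr) (Finset.prod_ne_zero_iff.2 fun i _ => div_ne_zero (hfac i z hzr) hRC)
      (hg z) (by fun_prop),
      logDeriv_prod (s := Finset.univ)
        (f := fun i z => ((R : ℂ) ^ 2 - (starRingEnd ℂ) (ρ i) * z) / R) (x := z)
        (fun i _ => div_ne_zero (hfac i z hzr) hRC) (fun i _ => by fun_prop)]
    congr 1
    refine Finset.sum_congr rfl fun i _ => ?_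
    rw [logDeriv_apply]
    have hd : HasDerivAt (fun z => ((R : ℂ) ^ 2 - (starRingEnd ℂ) (ρ i) * z) / R)
        ((-((starRingEnd ℂ) (ρ i) * 1)) / R) z :=
      (((hasDerivAt_id z).const_mul _).const_sub _).div_const _
    rw [hd.deriv, mul_one]
    have := hfac i z hzr
    field_simp
  have e3 : logDeriv f z - ∑ i, 1 / (z - ρ i) = logDeriv F z +
      ∑ i, (starRingEnd ℂ) (ρ i) / ((R : ℂ) ^ 2 - (starRingEnd ℂ) (ρ i) * z) := by
    rw [e1, e2]
    simp only [neg_div, Finset.sum_neg_distrib]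
    ring
  rw [e3]
  have h4 : ∀ i, ‖(starRingEnd ℂ) (ρ i) / ((R : ℂ) ^ 2 - (starRingEnd ℂ) (ρ i) * z)‖
      ≤ r / (R ^ 2 - r * r₀) := by
    intro i
    rw [norm_div, RCLike.norm_conj]
    have : R ^ 2 - r * r₀ ≤ ‖(R : ℂ) ^ 2 - (starRingEnd ℂ) (ρ i) * z‖ := by
      refine le_trans ?_ (norm_sub_norm_le _ _)
      rw [norm_pow, norm_mul, RCLike.norm_conj, Complex.norm_real, Real.norm_of_nonneg hR.le]
      nlinarith [mul_le_mul (hρ i) hz (norm_nonneg z) hr.le]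
    exact div_le_div₀ hr.le (hρ i) hden this
  calc _ ≤ ‖logDeriv F z‖ + ∑ i : Fin n, r / (R ^ 2 - r * r₀) :=
        (norm_add_le _ _).trans (add_le_add le_rfl
          ((norm_sum_le _ _).trans (Finset.sum_le_sum fun i _ => h4 i)))
    _ ≤ K2 * B + (K1 * B) * (r / (R ^ 2 - r * r₀)) := by
        rw [Finset.sum_const, Finset.card_univ, Fintype.card_fin, nsmul_eq_mul]
        have : 0 ≤ r / (R ^ 2 - r * r₀) := by positivity
        exact add_le_add (hlogF z hz) (mul_le_mul_of_nonneg_right hn this)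
    _ ≤ _ := by nlinarith [mul_pos hK1p hB]

/-- The fractional part function cut off below `1`. -/
noncomputable def fractTail (t : ℝ) : ℂ := (Set.Ioi (1 : ℝ)).indicator (fun t => ((Int.fract t : ℝ) : ℂ)) t

lemma norm_fractTail_le (t : ℝ) : ‖fractTail t‖ ≤ 1 := by
  unfold fractTail
  by_cases h : t ∈ Set.Ioi (1 : ℝ)
  · rw [Set.indicator_of_mem h, Complex.norm_real, Real.norm_of_nonneg (Int.fract_nonneg t)]
    exact (Int.fract_lt_one t).le
  · rw [Set.indicator_of_notMem h]; simp

lemma measurable_fractTail : Measurable fractTail := by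
  unfold fractTail
  exact Measurable.indicator (by fun_prop) measurableSet_Ioi

lemma fractTail_data : MeasureTheory.LocallyIntegrableOn fractTail (Set.Ioi 0) ∧
    fractTail =O[atTop] (fun t : ℝ => t ^ (-(0 : ℝ))) ∧
    ∀ b : ℝ, fractTail =O[nhdsWithin 0 (Set.Ioi 0)] (fun t : ℝ => t ^ (-b)) := by
  refine ⟨?_, ?_, fun b => ?_⟩
  · apply MeasureTheory.LocallyIntegrable.locallyIntegrableOn
    exact (MeasureTheory.locallyIntegrable_const (1 : ℝ)).mono
      measurable_fractTail.aestronglyMeasurable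
      (Eventually.of_forall fun t => by simpa using norm_fractTail_le t)
  · refine IsBigO.of_bound 1 (Eventually.of_forall fun t => ?_)
    simpa using norm_fractTail_le t
  · refine IsBigO.of_bound 1 ?_
    have : ∀ᶠ t : ℝ in nhdsWithin 0 (Set.Ioi 0), t < 1 :=
      (eventually_lt_nhds one_pos).filter_mono nhdsWithin_le_nhds
    filter_upwards [this] with t ht
    rw [fractTail, Set.indicator_of_notMem (by simpa using ht.le)]
    simp

lemma mellin_fractTail (s : ℂ) :
    mellin fractTail (-s) = ∫ t in Set.Ioi (1 : ℝ), (t : ℂ) ^ (-s - 1) * ((Int.fract t : ℝ) : ℂ) := by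
  rw [mellin, ← MeasureTheory.integral_indicator measurableSet_Ioi,
    ← MeasureTheory.integral_indicator measurableSet_Ioi]
  congr 1
  ext t
  simp only [fractTail, Set.indicator_apply, Set.mem_Ioi, smul_eq_mul]
  split_ifs <;> first | rfl | (exfalso; linarith) | simp

/-- Representation of the completed `(s - 1) ζ(s)` in the right half plane. -/
lemma riemannZeta₁_eq {s : ℂ} (hs : 0 < s.re) :
    riemannZeta₁ s = s - s * (s - 1) * mellin fractTail (-s) := by
  obtain ⟨hloc, htop, hbot⟩ := fractTail_data
  have hmd : ∀ w : ℂ, 0 < w.re → DifferentiableAt ℂ (mellin fractTail) (-w) := fun w hw =>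
    mellin_differentiableAt_of_isBigO_rpow hloc htop (by simpa using hw) (hbot ((-w).re - 1))
      (by linarith)
  have hU : IsOpen {w : ℂ | 0 < w.re} := isOpen_lt continuous_const Complex.continuous_re
  have hA : AnalyticOnNhd ℂ riemannZeta₁ {w : ℂ | 0 < w.re} :=
    differentiable_riemannZeta₁.differentiableOn.analyticOnNhd hU
  have hB : AnalyticOnNhd ℂ (fun s : ℂ => s - s * (s - 1) * mellin fractTail (-s))
      {w : ℂ | 0 < w.re} := by
    refine DifferentiableOn.analyticOnNhd (fun w hw => ?_) hU
    have h1 : DifferentiableAt ℂ (fun s : ℂ => mellin fractTail (-s)) w :=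
      (hmd w hw).comp w differentiableAt_id.neg
    exact ((by fun_prop : DifferentiableAt ℂ (fun s : ℂ => s) w).sub
      (((by fun_prop : DifferentiableAt ℂ (fun s : ℂ => s * (s - 1)) w)).mul
        h1)).differentiableWithinAt
  refine hA.eqOn_of_preconnected_of_eventuallyEq hB
    (convex_halfSpace_re_gt 0).isPreconnected (z₀ := 2) (by simp) ?_ hs
  have h1 : ∀ᶠ w : ℂ in nhds 2, 1 < w.re :=
    (isOpen_lt continuous_const Complex.continuous_re).mem_nhds (by simp)
  filter_upwards [h1] with w hw
  have hw1 : w ≠ 1 := by rintro rfl; simp at hw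
  have hz := LSeries_eq_mul_integral' (1 : ℕ → ℂ) (r := 1) zero_le_one hw (by
    simp only [Pi.one_apply, norm_one, Finset.sum_const, Nat.card_Icc, nsmul_eq_mul, mul_one,
      Nat.add_sub_cancel, Real.rpow_one]
    exact isBigO_refl _ _)
  rw [LSeries_one_eq_riemannZeta hw] at hz
  have hconv : MellinConvergent fractTail (-w) :=
    mellinConvergent_of_isBigO_rpow hloc htop (by simp; linarith) (hbot ((-w).re - 1))
      (by linarith)
  have hint : ∫ t in Set.Ioi (1 : ℝ), (∑ k ∈ Icc 1 ⌊t⌋₊, (1 : ℕ → ℂ) k) * (t : ℂ) ^ (-(w + 1))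
      = 1 / (w - 1) - mellin fractTail (-w) := by
    rw [mellin_fractTail]
    have h2 : ∫ t in Set.Ioi (1 : ℝ), (t : ℂ) ^ (-w) = 1 / (w - 1) := by
      rw [integral_Ioi_cpow_of_lt (by simpa using hw) one_pos, Complex.ofReal_one, Complex.one_cpow,
        show -w + 1 = -(w - 1) by ring, neg_div_neg_eq]
    rw [← h2, ← MeasureTheory.integral_sub]
    · refine MeasureTheory.setIntegral_congr_fun measurableSet_Ioi fun t ht => ?_
      have ht0 : (0 : ℝ) < t := one_pos.trans ht
      have ht' : (t : ℂ) ≠ 0 := by exact_mod_cast ht0.ne'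
      have hf : (⌊t⌋₊ : ℂ) = (t : ℂ) - ((Int.fract t : ℝ) : ℂ) := by
        have : (⌊t⌋₊ : ℝ) = t - Int.fract t := by
          rw [Int.self_sub_fract, natCast_floor_eq_intCast_floor ht0.le]
        rw [← Complex.ofReal_sub, ← this]; simp
      simp only [Pi.one_apply, Finset.sum_const, Nat.card_Icc, nsmul_eq_mul, mul_one,
        Nat.add_sub_cancel]
      rw [hf, show -(w + 1) = -w - 1 by ring, sub_mul, mul_comm ((Int.fract t : ℝ) : ℂ)]
      congr 1
      rw [Complex.cpow_sub _ _ ht', Complex.cpow_one]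
      field_simp
    · exact integrableOn_Ioi_cpow_of_lt (by simpa using hw) one_pos
    · have h3 : MeasureTheory.IntegrableOn (fun t : ℝ => (t : ℂ) ^ (-w - 1) • fractTail t)
          (Set.Ioi 1) := hconv.mono_set (Set.Ioi_subset_Ioi zero_le_one)
      refine h3.congr_fun (fun t ht => ?_) measurableSet_Ioi
      simp only [fractTail, Set.indicator_of_mem ht, smul_eq_mul]
  rw [hint] at hz
  have hw2 : w - 1 ≠ 0 := sub_ne_zero.2 hw1
  rw [riemannZeta_eq_inv_sub_mul hw1] at hz
  field_simp at hz
  linear_combination hz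

lemma norm_riemannZeta₁_le {s : ℂ} (hs : 1 / 10 ≤ s.re) (hs' : s.re ≤ 4) :
    ‖riemannZeta₁ s‖ ≤ 200 * (|s.im| + 2) ^ 2 := by
  rw [riemannZeta₁_eq (by linarith)]
  have hm : ‖mellin fractTail (-s)‖ ≤ 10 := by
    rw [mellin_fractTail]
    have hlt : -s.re - 1 < -1 := by linarith
    calc ‖∫ t in Set.Ioi (1 : ℝ), (t : ℂ) ^ (-s - 1) * ((Int.fract t : ℝ) : ℂ)‖
        ≤ ∫ t in Set.Ioi (1 : ℝ), t ^ (-s.re - 1) := by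
          refine MeasureTheory.norm_integral_le_of_norm_le
            (integrableOn_Ioi_rpow_of_lt hlt one_pos) ?_
          refine (MeasureTheory.ae_restrict_iff' measurableSet_Ioi).2
            (Eventually.of_forall fun t ht => ?_)
          have ht0 : (0 : ℝ) < t := one_pos.trans ht
          rw [norm_mul, Complex.norm_cpow_eq_rpow_re_of_pos ht0, Complex.norm_real,
            Real.norm_of_nonneg (Int.fract_nonneg t)]
          simp only [Complex.sub_re, Complex.neg_re, Complex.one_re]
          exact mul_le_of_le_one_right (by positivity) (Int.fract_lt_one t).le
      _ = 1 / s.re := by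
          rw [integral_Ioi_rpow_of_lt hlt one_pos]
          simp only [Real.one_rpow]
          rw [show -s.re - 1 + 1 = -s.re by ring, neg_div_neg_eq]
      _ ≤ 10 := by
          rw [div_le_iff₀ (by linarith)]; linarith
  have h1 : ‖s‖ ≤ |s.im| + 4 := by
    have := Complex.norm_le_abs_re_add_abs_im s
    rw [abs_of_pos (show 0 < s.re by linarith)] at this
    linarith
  have h2 : ‖s - 1‖ ≤ |s.im| + 3 := by
    have := Complex.norm_le_abs_re_add_abs_im (s - 1)
    have h3 : |(s - 1).re| ≤ 3 := by
      rw [abs_le]; constructor <;> simp <;> linarith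
    have h4 : (s - 1).im = s.im := by simp
    rw [h4] at this
    linarith
  have h5 : ‖s * (s - 1) * mellin fractTail (-s)‖ ≤ (|s.im| + 4) * (|s.im| + 3) * 10 := by
    rw [norm_mul, norm_mul]
    gcongr
  have := norm_sub_le s (s * (s - 1) * mellin fractTail (-s))
  nlinarith [abs_nonneg s.im]

lemma norm_riemannZeta₁_ge (t : ℝ) : 1 / 5 ≤ ‖riemannZeta₁ (2 + t * Complex.I)‖ := by
  set s : ℂ := 2 + t * Complex.I with hs
  have hre : s.re = 2 := by simp [hs]
  have hs1 : s ≠ 1 := by intro h; rw [h] at hre; norm_num at hre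
  have h1 : riemannZeta₁ s = (s - 1) * riemannZeta s := by
    rw [riemannZeta_eq_inv_sub_mul hs1, ← mul_assoc, mul_inv_cancel₀ (sub_ne_zero.2 hs1), one_mul]
  have h2 : 1 ≤ ‖s - 1‖ := by
    have := Complex.abs_re_le_norm (s - 1)
    rw [Complex.sub_re, hre] at this
    norm_num at this
    exact this
  have h3 : 1 / 5 ≤ ‖riemannZeta s‖ := by
    have hsum : Summable fun n : ℕ => 1 / (n : ℂ) ^ s := by
      rw [Complex.summable_one_div_nat_cpow, hre]; norm_num
    rw [zeta_eq_tsum_one_div_nat_cpow (by rw [hre]; norm_num)]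
    have hz2 := hasSum_zeta_two
    have hnorm : ∀ n : ℕ, 0 < n → ‖1 / (n : ℂ) ^ s‖ = 1 / (n : ℝ) ^ 2 := by
      intro n hn
      rw [norm_div, norm_one, Complex.norm_natCast_cpow_of_pos hn, hre]
      norm_num
    have h4 := hsum.sum_add_tsum_nat_add 2
    rw [← h4]
    have h5 : ∑ i ∈ Finset.range 2, 1 / (i : ℂ) ^ s = 1 := by
      have : s ≠ 0 := by intro h; rw [h] at hre; norm_num at hre
      simp [Finset.sum_range_succ, Complex.zero_cpow this]
    rw [h5]
    have h6 := hz2.summable.sum_add_tsum_nat_add 2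
    rw [hz2.tsum_eq] at h6
    have h7 : ∑ i ∈ Finset.range 2, 1 / (i : ℝ) ^ 2 = 1 := by simp [Finset.sum_range_succ]
    rw [h7] at h6
    have h8 : ‖∑' i : ℕ, 1 / ((i + 2 : ℕ) : ℂ) ^ s‖ ≤ ∑' i : ℕ, 1 / ((i + 2 : ℕ) : ℝ) ^ 2 := by
      refine tsum_of_norm_bounded ((summable_nat_add_iff 2).2 hz2.summable).hasSum fun i => ?_
      rw [hnorm _ (by omega)]
    have hpi : Real.pi ^ 2 / 6 ≤ 1 + 4 / 5 := by
      have := Real.pi_lt_d2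
      nlinarith [Real.pi_pos]
    have h9 := norm_sub_norm_le (1 : ℂ) (-∑' i : ℕ, 1 / ((i + 2 : ℕ) : ℂ) ^ s)
    rw [sub_neg_eq_add, norm_neg, norm_one] at h9
    linarith
  rw [h1, norm_mul]
  nlinarith [norm_nonneg (riemannZeta s)]

lemma exists_local_zeros : ∃ K : ℝ, 0 < K ∧ ∀ T : ℝ, ∃ (n : ℕ) (ρ : Fin n → ℂ),
    (n : ℝ) ≤ K * Real.log (|T| + 2) ∧ (∀ i, riemannZeta₁ (ρ i) = 0) ∧
    ∀ s : ℂ, ‖s - (2 + T * Complex.I)‖ ≤ 8 / 5 → riemannZeta₁ s ≠ 0 →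
      ‖logDeriv riemannZeta₁ s - ∑ i, 1 / (s - ρ i)‖ ≤ K * Real.log (|T| + 2) := by
  obtain ⟨K, hK, h⟩ := exists_logDeriv_bound (r₀ := 8 / 5) (r₁ := 33 / 20) (r := 17 / 10)
    (R := 19 / 10) (by norm_num) (by norm_num) (by norm_num) (by norm_num)
  refine ⟨K * 20, by positivity, fun T => ?_⟩
  set c : ℂ := 2 + T * Complex.I with hc
  set f : ℂ → ℂ := fun z => riemannZeta₁ (z + c) with hf
  have hfd : Differentiable ℂ f := differentiable_riemannZeta₁.comp (by fun_prop)
  have hf0' : 1 / 5 ≤ ‖f 0‖ := by simpa [hf] using norm_riemannZeta₁_ge T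
  have hf0 : f 0 ≠ 0 := norm_pos_iff.1 (by linarith)
  have ha : 2 ≤ |T| + 2 := by linarith [abs_nonneg T]
  have hlog : 0 < Real.log (|T| + 2) := Real.log_pos (by linarith)
  have hbd : ∀ z : ℂ, ‖z‖ = 19 / 10 → ‖f z‖ ≤ ‖f 0‖ * Real.exp (20 * Real.log (|T| + 2)) := by
    intro z hz
    have h1 := Complex.abs_re_le_norm z
    have h2 := Complex.abs_im_le_norm z
    rw [hz] at h1 h2
    have h1' := abs_le.1 h1
    have hre : (z + c).re = z.re + 2 := by simp [hc]
    have him : (z + c).im = z.im + T := by simp [hc]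
    have h3 := norm_riemannZeta₁_le (s := z + c) (by rw [hre]; linarith) (by rw [hre]; linarith)
    have h4 : |(z + c).im| ≤ |T| + 2 := by
      rw [him]
      refine (abs_add_le _ _).trans ?_
      linarith
    have h5 : Real.exp (20 * Real.log (|T| + 2)) = (|T| + 2) ^ 20 := by
      rw [mul_comm, Real.exp_mul, Real.exp_log (by linarith)]
      norm_cast
    rw [h5]
    set a := |T| + 2
    have h6 : (2 : ℝ) ^ 18 ≤ a ^ 18 := by gcongr
    have h7 : ‖f z‖ ≤ 200 * (a + 2) ^ 2 := h3.trans (by gcongr)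
    have h8 : 200 * (a + 2) ^ 2 ≤ 800 * a ^ 2 := by nlinarith
    have h9 : a ^ 20 = a ^ 18 * a ^ 2 := by ring
    have h10 : 1 / 5 * (2 ^ 18 * a ^ 2) ≤ ‖f 0‖ * (a ^ 18 * a ^ 2) := by gcongr
    rw [h9]
    nlinarith [sq_nonneg a]
  obtain ⟨n, ρ, hn, hρ, hs⟩ := h f (20 * Real.log (|T| + 2)) hfd hf0 (by positivity) hbd
  refine ⟨n, fun i => ρ i + c, by rw [mul_assoc]; exact hn, hρ, fun s hsc hs0 => ?_⟩
  have h1 := hs (s - c) hsc (by simpa [hf] using hs0)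
  have h2 : logDeriv f (s - c) = logDeriv riemannZeta₁ s := by
    rw [logDeriv_apply, logDeriv_apply]
    simp only [hf]
    rw [deriv_comp_add_const, sub_add_cancel]
  rw [h2] at h1
  have h3 : ∀ i, s - (ρ i + c) = s - c - ρ i := fun i => by ring
  simp_rw [h3]
  rw [mul_assoc]
  exact h1

lemma re_le_half_of_riemannZeta₁_eq_zero (hRH : RiemannHypothesis) {s : ℂ}
    (hs : riemannZeta₁ s = 0) : s.re ≤ 1 / 2 := by
  have h1 : s ≠ 1 := by rintro rfl; rw [riemannZeta₁_one] at hs; exact one_ne_zero hs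
  have hz : riemannZeta s = 0 := by rw [riemannZeta_eq_inv_sub_mul h1, hs, mul_zero]
  by_cases h2 : ∃ n : ℕ, s = -2 * (n + 1)
  · obtain ⟨n, rfl⟩ := h2
    have : (-2 * ((n : ℂ) + 1)).re = -2 * ((n : ℝ) + 1) := by simp
    rw [this]
    have : (0 : ℝ) ≤ n := n.cast_nonneg
    linarith
  · exact (hRH s hz h2 h1).le

/-- The negative of the logarithmic derivative of `(s - 1) ζ(s)`. -/
noncomputable def zetaG (s : ℂ) : ℂ := -logDeriv riemannZeta₁ s

lemma riemannZeta₁_ne_zero_of_half_lt (hRH : RiemannHypothesis) {s : ℂ} (hs : 1 / 2 < s.re) :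
    riemannZeta₁ s ≠ 0 := fun h => by
  linarith [re_le_half_of_riemannZeta₁_eq_zero hRH h]

lemma differentiableAt_zetaG (hRH : RiemannHypothesis) {s : ℂ} (hs : 1 / 2 < s.re) :
    DifferentiableAt ℂ zetaG s := by
  have : DifferentiableAt ℂ (deriv riemannZeta₁) s :=
    (differentiable_riemannZeta₁.differentiableOn.analyticAt
      (s := Set.univ) Filter.univ_mem).deriv.differentiableAt
  exact (this.div (differentiable_riemannZeta₁ s) (riemannZeta₁_ne_zero_of_half_lt hRH hs)).neg

lemma zetaG_eq_LSeries {s : ℂ} (hs : 1 < s.re) :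
    zetaG s = LSeries (fun n => (ArithmeticFunction.vonMangoldt n : ℂ)) s - 1 / (s - 1) := by
  have hs1 : s ≠ 1 := by rintro rfl; simp at hs
  have hs2 : s - 1 ≠ 0 := sub_ne_zero.2 hs1
  rw [ArithmeticFunction.LSeries_vonMangoldt_eq_deriv_riemannZeta_div hs, zetaG]
  have hz : riemannZeta s ≠ 0 := riemannZeta_ne_zero_of_one_le_re hs.le
  have hev : riemannZeta₁ =ᶠ[nhds s] fun w => (w - 1) * riemannZeta w := by
    filter_upwards [isOpen_ne.mem_nhds hs1] with w hw
    rw [riemannZeta_eq_inv_sub_mul hw, ← mul_assoc, mul_inv_cancel₀ (sub_ne_zero.2 hw), one_mul]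
  rw [(logDeriv_congr_nhds hev).eq_of_nhds, logDeriv_mul (f := fun w => w - 1) s hs2 hz
    (by fun_prop) (differentiableAt_riemannZeta hs1), logDeriv_apply, logDeriv_apply]
  simp
  ring

lemma riemannZeta₁_conj (s : ℂ) :
    riemannZeta₁ ((starRingEnd ℂ) s) = (starRingEnd ℂ) (riemannZeta₁ s) := by
  by_cases h : s = 1
  · subst h; simp [riemannZeta₁_one]
  · have h' : (starRingEnd ℂ) s ≠ 1 := by
      intro h2; apply h
      rw [← Complex.conj_conj s, h2, map_one]
    have e : ∀ w : ℂ, w ≠ 1 → riemannZeta₁ w = (w - 1) * riemannZeta w := fun w hw => by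
      rw [riemannZeta_eq_inv_sub_mul hw, ← mul_assoc, mul_inv_cancel₀ (sub_ne_zero.2 hw), one_mul]
    rw [e _ h', e _ h, riemannZeta_conj]
    simp

lemma zetaG_conj (s : ℂ) : zetaG ((starRingEnd ℂ) s) = (starRingEnd ℂ) (zetaG s) := by
  have h : (starRingEnd ℂ) ∘ riemannZeta₁ ∘ (starRingEnd ℂ) = riemannZeta₁ := by
    ext w
    simp [riemannZeta₁_conj]
  have h2 := ((differentiable_riemannZeta₁ s).hasDerivAt).conj_conj
  rw [h] at h2
  rw [zetaG, zetaG, logDeriv_apply, logDeriv_apply, h2.deriv, riemannZeta₁_conj]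
  simp

lemma log_abs_add_two_pos (t : ℝ) : 0 < Real.log (|t| + 2) :=
  Real.log_pos (by linarith [abs_nonneg t])

lemma log_abs_add_two_le {t u : ℝ} (h : |u - t| ≤ 1) :
    Real.log (|u| + 2) ≤ 2 * Real.log (|t| + 2) := by
  have h1 : |u| ≤ |t| + 1 := by
    have := abs_add_le (u - t) t
    rw [sub_add_cancel] at this
    linarith
  have h2 := abs_nonneg t
  rw [← Real.log_rpow (by linarith)]
  apply Real.log_le_log (by linarith [abs_nonneg u])
  norm_num
  nlinarith

lemma norm_sub_center_le {σ t T : ℝ} (h1 : 1 / 2 ≤ σ) (h2 : σ ≤ 2) (h3 : |t - T| ≤ 1 / 2) :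
    ‖((σ : ℂ) + t * Complex.I) - (2 + T * Complex.I)‖ ≤ 8 / 5 := by
  have : ((σ : ℂ) + t * Complex.I) - (2 + T * Complex.I)
      = ((σ - 2 : ℝ) : ℂ) + ((t - T : ℝ) : ℂ) * Complex.I := by push_cast; ring
  rw [this, Complex.norm_add_mul_I]
  apply Real.sqrt_le_iff.2
  refine ⟨by norm_num, ?_⟩
  have h4 := abs_le.1 h3
  nlinarith

lemma exists_norm_zetaG_le (hRH : RiemannHypothesis) : ∃ C : ℝ, 0 < C ∧
    ∀ σ : ℝ, 1 / 2 < σ → σ ≤ 2 → ∀ t : ℝ,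
      ‖zetaG (σ + t * Complex.I)‖ ≤ C / (σ - 1 / 2) * Real.log (|t| + 2) := by
  obtain ⟨K, hK, h⟩ := exists_local_zeros
  refine ⟨3 * K, by positivity, fun σ hσ hσ2 t => ?_⟩
  obtain ⟨n, ρ, hn, hρ, hs⟩ := h t
  have hδ : 0 < σ - 1 / 2 := by linarith
  have hl := log_abs_add_two_pos t
  have h1 := hs (σ + t * Complex.I) (norm_sub_center_le hσ.le hσ2 (by simp))
    (riemannZeta₁_ne_zero_of_half_lt hRH (by simpa using hσ))
  have h2 : ∀ i, ‖1 / ((σ : ℂ) + t * Complex.I - ρ i)‖ ≤ 1 / (σ - 1 / 2) := by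
    intro i
    rw [norm_div, norm_one]
    apply one_div_le_one_div_of_le hδ
    refine le_trans ?_ (Complex.re_le_norm _)
    have := re_le_half_of_riemannZeta₁_eq_zero hRH (hρ i)
    simp
    linarith
  have h3 : ‖∑ i, 1 / ((σ : ℂ) + t * Complex.I - ρ i)‖ ≤ n * (1 / (σ - 1 / 2)) := by
    refine (norm_sum_le_of_le _ fun i _ => h2 i).trans (by simp)
  rw [zetaG, norm_neg]
  have h4 := norm_add_le (logDeriv riemannZeta₁ (σ + t * Complex.I) -
    ∑ i, 1 / ((σ : ℂ) + t * Complex.I - ρ i)) (∑ i, 1 / ((σ : ℂ) + t * Complex.I - ρ i))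
  rw [sub_add_cancel] at h4
  have h5 : (n : ℝ) * (1 / (σ - 1 / 2)) ≤ K * Real.log (|t| + 2) * (1 / (σ - 1 / 2)) := by gcongr
  have h6 : 1 ≤ 3 / 2 * (1 / (σ - 1 / 2)) := by
    rw [mul_one_div, le_div_iff₀ hδ]; linarith
  have h7 : K * Real.log (|t| + 2) ≤ K * Real.log (|t| + 2) * (3 / 2 * (1 / (σ - 1 / 2))) :=
    le_mul_of_one_le_right (by positivity) h6
  have h8 : 0 < K * Real.log (|t| + 2) * (1 / (σ - 1 / 2)) := by positivity
  calc _ ≤ K * Real.log (|t| + 2) * (3 / 2 * (1 / (σ - 1 / 2)))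
        + K * Real.log (|t| + 2) * (1 / (σ - 1 / 2)) := by linarith
    _ ≤ 3 * (K * Real.log (|t| + 2) * (1 / (σ - 1 / 2))) := by linarith
    _ = _ := by ring

lemma integral_poisson_le {a : ℝ} (ha : 0 < a) (γ x y : ℝ) :
    ∫ t in x..y, a / (a ^ 2 + (t - γ) ^ 2) ≤ Real.pi := by
  have hd : ∀ t ∈ Set.uIcc x y,
      HasDerivAt (fun t => Real.arctan ((t - γ) / a)) (a / (a ^ 2 + (t - γ) ^ 2)) t := by
    intro t _
    have h : HasDerivAt (fun t => Real.arctan ((t - γ) / a))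
        (1 / (1 + ((t - γ) / a) ^ 2) * (1 / a)) t :=
      (((hasDerivAt_id t).sub_const γ).div_const a).arctan
    convert h using 1
    have : a ^ 2 + (t - γ) ^ 2 ≠ 0 := by positivity
    have : 1 + ((t - γ) / a) ^ 2 ≠ 0 := by positivity
    field_simp
  have hc : Continuous fun t => a / (a ^ 2 + (t - γ) ^ 2) := by
    refine continuous_const.div (by fun_prop) fun t => ?_
    positivity
  rw [intervalIntegral.integral_eq_sub_of_hasDerivAt hd (hc.intervalIntegrable _ _)]
  have h1 := Real.arctan_lt_pi_div_two ((y - γ) / a)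
  have h2 := Real.neg_pi_div_two_lt_arctan ((x - γ) / a)
  linarith

lemma continuous_zetaG_line (hRH : RiemannHypothesis) {σ : ℝ} (hσ : 1 / 2 < σ) :
    Continuous fun t : ℝ => zetaG (σ + t * Complex.I) := by
  rw [continuous_iff_continuousAt]
  intro t
  have h := (differentiableAt_zetaG hRH (s := σ + t * Complex.I) (by simpa using hσ)).continuousAt
  exact h.comp (f := fun t : ℝ => (σ : ℂ) + t * Complex.I)
    (by fun_prop : Continuous fun t : ℝ => (σ : ℂ) + t * Complex.I).continuousAt

lemma exists_integral_re_zetaG_le (hRH : RiemannHypothesis) : ∃ C : ℝ, 0 < C ∧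
    ∀ σ : ℝ, 1 / 2 < σ → σ ≤ 2 → ∀ T : ℝ,
      ∫ t in T..T + 1, |(zetaG (σ + t * Complex.I)).re| ≤ C * Real.log (|T| + 2) := by
  obtain ⟨K, hK, h⟩ := exists_local_zeros
  have hpi := Real.pi_pos
  refine ⟨2 * (K * Real.pi + K), by positivity, fun σ hσ hσ2 T => ?_⟩
  obtain ⟨n, ρ, hn, hρ, hs⟩ := h (T + 1 / 2)
  set L := Real.log (|T + 1 / 2| + 2) with hL
  have hlog : L ≤ 2 * Real.log (|T| + 2) :=
    log_abs_add_two_le (by rw [add_sub_cancel_left, abs_of_pos] <;> norm_num)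
  have ha : ∀ i, 0 < σ - (ρ i).re := fun i => by
    have := re_le_half_of_riemannZeta₁_eq_zero hRH (hρ i)
    linarith
  have hc : ∀ i, Continuous fun t : ℝ =>
      (σ - (ρ i).re) / ((σ - (ρ i).re) ^ 2 + (t - (ρ i).im) ^ 2) := by
    intro i
    refine continuous_const.div (by fun_prop) fun t => ?_
    have := ha i
    positivity
  have hpt : ∀ t ∈ Set.Icc T (T + 1), |(zetaG (σ + t * Complex.I)).re| ≤
      (∑ i, (σ - (ρ i).re) / ((σ - (ρ i).re) ^ 2 + (t - (ρ i).im) ^ 2)) + K * L := by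
    intro t ht
    have h1 := hs (σ + t * Complex.I) (norm_sub_center_le hσ.le hσ2
      (by rw [abs_le]; constructor <;> linarith [ht.1, ht.2]))
      (riemannZeta₁_ne_zero_of_half_lt hRH (by simpa using hσ))
    have h2 := (Complex.abs_re_le_norm _).trans h1
    have h3 : (∑ i, 1 / ((σ : ℂ) + t * Complex.I - ρ i)).re =
        ∑ i, (σ - (ρ i).re) / ((σ - (ρ i).re) ^ 2 + (t - (ρ i).im) ^ 2) := by
      rw [Complex.re_sum]
      refine Finset.sum_congr rfl fun i _ => ?_
      rw [one_div, Complex.inv_re, Complex.normSq_apply]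
      simp only [Complex.sub_re, Complex.add_re, Complex.ofReal_re, Complex.mul_re, Complex.I_re,
        mul_zero, Complex.ofReal_im, Complex.I_im, mul_one, sub_self, add_zero, Complex.sub_im,
        Complex.add_im, Complex.mul_im, zero_add]
      ring
    have h4 : 0 ≤ ∑ i, (σ - (ρ i).re) / ((σ - (ρ i).re) ^ 2 + (t - (ρ i).im) ^ 2) :=
      Finset.sum_nonneg fun i _ => by have := ha i; positivity
    rw [Complex.sub_re, h3] at h2
    rw [zetaG, Complex.neg_re, abs_neg]
    have h5 := abs_le.1 h2
    rw [abs_le]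
    constructor <;> linarith
  calc ∫ t in T..T + 1, |(zetaG (σ + t * Complex.I)).re|
      ≤ ∫ t in T..T + 1,
        ((∑ i, (σ - (ρ i).re) / ((σ - (ρ i).re) ^ 2 + (t - (ρ i).im) ^ 2)) + K * L) := by
        refine intervalIntegral.integral_mono_on (by linarith) ?_ ?_ hpt
        · exact ((Complex.continuous_re.comp (continuous_zetaG_line hRH hσ)).abs).intervalIntegrable
            _ _
        · exact ((continuous_finsetSum _ fun i _ => hc i).add
            continuous_const).intervalIntegrable _ _
    _ = (∑ i, ∫ t in T..T + 1, (σ - (ρ i).re) / ((σ - (ρ i).re) ^ 2 + (t - (ρ i).im) ^ 2))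
        + K * L := by
        rw [intervalIntegral.integral_add
          ((continuous_finsetSum _ fun i _ => hc i).intervalIntegrable _ _)
          (continuous_const.intervalIntegrable _ _),
          intervalIntegral.integral_finsetSum fun i _ => (hc i).intervalIntegrable _ _]
        simp
    _ ≤ n * Real.pi + K * L := by
        gcongr
        refine (Finset.sum_le_sum fun i _ => integral_poisson_le (ha i) _ _ _).trans ?_
        simp
    _ ≤ K * L * Real.pi + K * L := by gcongr
    _ = (K * Real.pi + K) * L := by ring
    _ ≤ (K * Real.pi + K) * (2 * Real.log (|T| + 2)) := by gcongr
    _ = _ := by ring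

lemma log_abs_add_two_le_rpow (t : ℝ) :
    Real.log (|t| + 2) ≤ 8 * (1 + t ^ 2) ^ ((1 : ℝ) / 4) := by
  have h0 := abs_nonneg t
  have h1 : |t| + 2 ≤ 16 * (1 + t ^ 2) := by
    rw [← sq_abs t]; nlinarith
  have h2 : Real.log (|t| + 2) ≤ Real.log (16 * (1 + t ^ 2)) :=
    Real.log_le_log (by linarith) h1
  have h3 := Real.log_le_rpow_div (x := 16 * (1 + t ^ 2)) (by positivity)
    (show (0 : ℝ) < 1 / 4 by norm_num)
  rw [Real.mul_rpow (by norm_num) (by positivity)] at h3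
  have h4 : (16 : ℝ) ^ ((1 : ℝ) / 4) = 2 := by
    rw [show (16 : ℝ) = 2 ^ (4 : ℝ) by norm_num, ← Real.rpow_mul (by norm_num)]
    norm_num
  rw [h4] at h3
  linarith

lemma integrable_log_div : MeasureTheory.Integrable
    fun t : ℝ => Real.log (|t| + 2) / (1 + t ^ 2) := by
  have h := (integrable_rpow_neg_one_add_norm_sq (E := ℝ) (μ := MeasureTheory.volume)
    (r := 3 / 2) (by simp; norm_num)).const_mul 8
  refine h.mono' ?_ (Eventually.of_forall fun t => ?_)
  · refine Continuous.aestronglyMeasurable (Continuous.div ?_ (by fun_prop) fun t => by positivity)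
    exact Continuous.log (by fun_prop) fun t => by have := abs_nonneg t; positivity
  · have hp : 0 < 1 + t ^ 2 := by positivity
    rw [Real.norm_of_nonneg (div_nonneg (log_abs_add_two_pos t).le hp.le), Real.norm_eq_abs,
      sq_abs, div_le_iff₀ hp, mul_assoc]
    refine (log_abs_add_two_le_rpow t).trans (le_of_eq ?_)
    nth_rewrite 3 [← Real.rpow_one (1 + t ^ 2)]
    rw [← Real.rpow_add hp]
    norm_num

/-- A locally uniform bound for `zetaG` on vertical lines. -/
lemma exists_norm_zetaG_near_le (hRH : RiemannHypothesis) {s : ℂ} (h1 : 1 / 2 < s.re)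
    (h2 : s.re < 2) : ∃ δ : ℝ, 0 < δ ∧ δ < s.re - 1 / 2 ∧ ∃ C : ℝ, 0 < C ∧
      ∀ z : ℂ, ‖z - s‖ ≤ δ → ∀ t : ℝ, ‖zetaG (z + t * Complex.I)‖ ≤ C * Real.log (|t| + 2) := by
  obtain ⟨C, hC, h⟩ := exists_norm_zetaG_le hRH
  set δ := min ((s.re - 1 / 2) / 2) (2 - s.re) with hδ
  have hδ0 : 0 < δ := lt_min (by linarith) (by linarith)
  have hδ1 : δ ≤ (s.re - 1 / 2) / 2 := min_le_left _ _
  have hδ2 : δ ≤ 2 - s.re := min_le_right _ _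
  set b := |s.im| + 2 with hb
  have hb2 : 2 ≤ b := by linarith [abs_nonneg s.im]
  have hlb : 0 < Real.log (b + 2) := Real.log_pos (by linarith)
  have hl2 : 0 < Real.log 2 := Real.log_pos (by norm_num)
  refine ⟨δ, hδ0, by linarith, C / ((s.re - 1 / 2) / 2) * (1 + Real.log (b + 2) / Real.log 2),
    by have : 0 < s.re - 1 / 2 := by linarith
       positivity, fun z hz t => ?_⟩
  have hre := (Complex.abs_re_le_norm (z - s)).trans hz
  have him := (Complex.abs_im_le_norm (z - s)).trans hz
  rw [Complex.sub_re, abs_le] at hre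
  rw [Complex.sub_im, abs_le] at him
  have hz1 : (s.re - 1 / 2) / 2 ≤ z.re - 1 / 2 := by linarith
  have h3 := h z.re (by linarith) (by linarith) (z.im + t)
  have e : (z.re : ℂ) + ((z.im + t : ℝ) : ℂ) * Complex.I = z + t * Complex.I := by
    nth_rewrite 3 [← Complex.re_add_im z]
    push_cast; ring
  rw [e] at h3
  refine h3.trans ?_
  have ht := abs_nonneg t
  have h4 : Real.log (|z.im + t| + 2) ≤ (1 + Real.log (b + 2) / Real.log 2) *
      Real.log (|t| + 2) := by
    have h5 : |z.im + t| ≤ b + |t| := by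
      refine (abs_add_le _ _).trans ?_
      have : |z.im| ≤ |s.im| + 2 := by
        have h6 := abs_add_le (z.im - s.im) s.im
        rw [sub_add_cancel] at h6
        have : |z.im - s.im| ≤ 2 := abs_le.2 ⟨by linarith, by linarith⟩
        linarith
      linarith
    calc Real.log (|z.im + t| + 2) ≤ Real.log ((b + 2) * (|t| + 2)) :=
          Real.log_le_log (by positivity) (by nlinarith)
      _ = Real.log (b + 2) + Real.log (|t| + 2) :=
          Real.log_mul (by linarith) (by linarith)
      _ = Real.log (|t| + 2) + Real.log (b + 2) / Real.log 2 * Real.log 2 := by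
          field_simp; ring
      _ ≤ Real.log (|t| + 2) + Real.log (b + 2) / Real.log 2 * Real.log (|t| + 2) := by
          gcongr
          linarith
      _ = _ := by ring
  have hs0 : 0 < (s.re - 1 / 2) / 2 := by linarith
  calc _ ≤ C / ((s.re - 1 / 2) / 2) * ((1 + Real.log (b + 2) / Real.log 2) *
      Real.log (|t| + 2)) := by
        gcongr
        exact (log_abs_add_two_pos _).le
    _ = _ := by ring

lemma integrable_mul_zetaG (hRH : RiemannHypothesis) {k : ℝ → ℂ} {C : ℝ} (hk : Continuous k)
    (hkb : ∀ t, ‖k t‖ ≤ C / (1 + t ^ 2)) {s : ℂ} (h1 : 1 / 2 < s.re) (h2 : s.re < 2) :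
    MeasureTheory.Integrable fun t : ℝ => k t * zetaG (s + t * Complex.I) := by
  obtain ⟨δ, hδ, _, D, hD, h⟩ := exists_norm_zetaG_near_le hRH h1 h2
  refine (integrable_log_div.const_mul (C * D)).mono' ?_ (Eventually.of_forall fun t => ?_)
  · refine (hk.mul ?_).aestronglyMeasurable
    rw [continuous_iff_continuousAt]
    intro t
    exact ((differentiableAt_zetaG hRH (s := s + t * Complex.I) (by simpa using h1)).continuousAt).comp
      (f := fun t : ℝ => s + t * Complex.I)
      (by fun_prop : Continuous fun t : ℝ => s + t * Complex.I).continuousAt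
  · rw [norm_mul]
    have h3 := h s (by simpa using hδ.le) t
    calc _ ≤ C / (1 + t ^ 2) * (D * Real.log (|t| + 2)) :=
          mul_le_mul (hkb t) h3 (norm_nonneg _) ((norm_nonneg _).trans (hkb t))
      _ = _ := by ring

lemma differentiableAt_integral_zetaG (hRH : RiemannHypothesis) {k : ℝ → ℂ} {C : ℝ}
    (hk : Continuous k)
    (hkb : ∀ t, ‖k t‖ ≤ C / (1 + t ^ 2)) {s : ℂ} (h1 : 1 / 2 < s.re) (h2 : s.re < 2) :
    DifferentiableAt ℂ (fun s : ℂ => ∫ t : ℝ, k t * zetaG (s + t * Complex.I)) s := by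
  obtain ⟨δ, hδ, hδs, D, hD, h⟩ := exists_norm_zetaG_near_le hRH h1 h2
  have hre : ∀ z : ℂ, ‖z - s‖ ≤ δ → ∀ t : ℝ, 1 / 2 < (z + t * Complex.I).re := by
    intro z hz t
    have := (Complex.abs_re_le_norm (z - s)).trans hz
    rw [Complex.sub_re, abs_le] at this
    simp
    linarith
  have hcont : ∀ z : ℂ, ‖z - s‖ ≤ δ → Continuous fun t : ℝ => zetaG (z + t * Complex.I) := by
    intro z hz
    rw [continuous_iff_continuousAt]
    intro t
    exact ((differentiableAt_zetaG hRH (hre z hz t)).continuousAt).comp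
      (f := fun t : ℝ => z + t * Complex.I)
      (by fun_prop : Continuous fun t : ℝ => z + t * Complex.I).continuousAt
  have hopen : IsOpen {w : ℂ | 1 / 2 < w.re} := isOpen_lt continuous_const Complex.continuous_re
  have hdo : DifferentiableOn ℂ zetaG {w : ℂ | 1 / 2 < w.re} := fun w hw =>
    (differentiableAt_zetaG hRH hw).differentiableWithinAt
  have hball : Metric.ball s (δ / 2) ∈ nhds s := Metric.ball_mem_nhds s (by linarith)
  refine (hasDerivAt_integral_of_dominated_loc_of_deriv_le (𝕜 := ℂ)
    (F := fun (s : ℂ) (t : ℝ) => k t * zetaG (s + t * Complex.I))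
    (F' := fun (s : ℂ) (t : ℝ) => k t * deriv zetaG (s + t * Complex.I))
    (bound := fun t => (C * (D / (δ / 2))) * (Real.log (|t| + 2) / (1 + t ^ 2)))
    hball ?_ (integrable_mul_zetaG hRH hk hkb h1 h2) ?_ ?_ (integrable_log_div.const_mul _)
    ?_).2.differentiableAt
  · filter_upwards [hball] with z hz
    exact (hk.mul (hcont z (by
      rw [mem_ball_iff_norm] at hz; linarith))).aestronglyMeasurable
  · refine (hk.mul ?_).aestronglyMeasurable
    rw [continuous_iff_continuousAt]
    intro t
    have hd : ContinuousAt (deriv zetaG) (s + t * Complex.I) :=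
      ((hdo.analyticAt (hopen.mem_nhds (hre s (by simpa using hδ.le) t))).deriv).continuousAt
    exact hd.comp (f := fun t : ℝ => s + t * Complex.I)
      (by fun_prop : Continuous fun t : ℝ => s + t * Complex.I).continuousAt
  · refine Eventually.of_forall fun t z hz => ?_
    rw [mem_ball_iff_norm] at hz
    have hb : ‖deriv zetaG (z + t * Complex.I)‖ ≤ D * Real.log (|t| + 2) / (δ / 2) := by
      have hsub : Metric.closedBall (z + t * Complex.I) (δ / 2) ⊆ {w : ℂ | 1 / 2 < w.re} := by
        intro w hw
        rw [mem_closedBall_iff_norm] at hw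
        have h3 := hre (w - t * Complex.I) (by
          have := norm_add_le (w - (z + t * Complex.I)) (z - s)
          have e : w - (z + t * Complex.I) + (z - s) = w - t * Complex.I - s := by ring
          rw [e] at this
          linarith) t
        rwa [sub_add_cancel] at h3
      refine Complex.norm_deriv_le_of_forall_mem_sphere_norm_le (by linarith)
        ((hdo.mono hsub).mono (by rw [closure_ball _ (by linarith)])).diffContOnCl (fun w hw => ?_)
      have hw' : ‖w - (z + t * Complex.I)‖ = δ / 2 := by simpa [mem_sphere_iff_norm] using hw
      have h3 := h (w - t * Complex.I) (by
          have := norm_add_le (w - (z + t * Complex.I)) (z - s)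
          have e : w - (z + t * Complex.I) + (z - s) = w - t * Complex.I - s := by ring
          rw [e] at this
          linarith) t
      rwa [sub_add_cancel] at h3
    rw [norm_mul]
    calc _ ≤ C / (1 + t ^ 2) * (D * Real.log (|t| + 2) / (δ / 2)) :=
          mul_le_mul (hkb t) hb (norm_nonneg _) ((norm_nonneg _).trans (hkb t))
      _ = _ := by ring
  · refine Eventually.of_forall fun t z hz => ?_
    rw [mem_ball_iff_norm] at hz
    exact ((differentiableAt_zetaG hRH (hre z (by linarith) t)).hasDerivAt.comp_add_const z
      (t * Complex.I)).const_mul _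

lemma integrable_of_le_div {k : ℝ → ℂ} {C : ℝ} (hk : Continuous k)
    (hkb : ∀ t, ‖k t‖ ≤ C / (1 + t ^ 2)) : MeasureTheory.Integrable k := by
  refine (integrable_inv_one_add_sq.const_mul C).mono' hk.aestronglyMeasurable
    (Eventually.of_forall fun t => ?_)
  simpa [div_eq_mul_inv] using hkb t

/-- The Fourier transform `y ↦ ∫ k(t) e^{-ity} dt`. -/
noncomputable def expIntegral (k : ℝ → ℂ) (y : ℝ) : ℂ :=
  ∫ t : ℝ, k t * Complex.exp (-(t * y : ℝ) * Complex.I)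

lemma norm_exp_neg_mul_I (x : ℝ) : ‖Complex.exp (-(x : ℂ) * Complex.I)‖ = 1 := by
  rw [← Complex.ofReal_neg]; exact Complex.norm_exp_ofReal_mul_I _

lemma continuous_expIntegral {k : ℝ → ℂ} (hk : MeasureTheory.Integrable k) :
    Continuous (expIntegral k) := by
  refine MeasureTheory.continuous_of_dominated (bound := fun t => ‖k t‖) (fun y => ?_)
    (fun y => Eventually.of_forall fun t => ?_) hk.norm (Eventually.of_forall fun t => ?_)
  · exact hk.aestronglyMeasurable.mul (by fun_prop : Continuous fun t : ℝ =>
      Complex.exp (-(t * y : ℝ) * Complex.I)).aestronglyMeasurable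
  · rw [norm_mul, norm_exp_neg_mul_I, mul_one]
  · fun_prop

lemma norm_term_add_mul_I (f : ℕ → ℂ) (s : ℂ) (n : ℕ) (t : ℝ) :
    ‖LSeries.term f (s + t * Complex.I) n‖ = ‖LSeries.term f s n‖ := by
  simp [LSeries.norm_term_eq]

lemma term_add_mul_I (f : ℕ → ℂ) (s : ℂ) (n : ℕ) (t : ℝ) :
    LSeries.term f (s + t * Complex.I) n =
      LSeries.term f s n * Complex.exp (-(t * Real.log n : ℝ) * Complex.I) := by
  rcases eq_or_ne n 0 with rfl | hn
  · simp
  have hn' : (n : ℂ) ≠ 0 := by exact_mod_cast hn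
  rw [LSeries.term_of_ne_zero hn, LSeries.term_of_ne_zero hn, Complex.cpow_add _ _ hn',
    div_mul_eq_div_div, div_eq_mul_inv (f n / _)]
  congr 1
  rw [Complex.cpow_def_of_ne_zero hn', ← Complex.exp_neg]
  congr 1
  push_cast
  ring

lemma hasSum_term_mul_expIntegral {k : ℝ → ℂ} (hk : MeasureTheory.Integrable k) {f : ℕ → ℂ} {s : ℂ}
    (hf : LSeriesSummable f s) :
    HasSum (fun n => LSeries.term f s n * expIntegral k (Real.log n))
      (∫ t : ℝ, k t * LSeries f (s + t * Complex.I)) := by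
  have hm : ∀ n, MeasureTheory.Integrable
      fun t : ℝ => k t * LSeries.term f (s + t * Complex.I) n := by
    intro n
    simp_rw [term_add_mul_I]
    refine (hk.norm.mul_const ‖LSeries.term f s n‖).mono' ?_ (Eventually.of_forall fun t => ?_)
    · exact hk.aestronglyMeasurable.mul (by fun_prop : Continuous fun t : ℝ =>
        LSeries.term f s n *
          Complex.exp (-(t * Real.log n : ℝ) * Complex.I)).aestronglyMeasurable
    · rw [norm_mul, norm_mul, norm_exp_neg_mul_I, mul_one]
  have h := MeasureTheory.hasSum_integral_of_summable_integral_norm hm (by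
    simp_rw [norm_mul, norm_term_add_mul_I, MeasureTheory.integral_mul_const]
    exact hf.norm.mul_left _)
  have e1 : ∀ n, ∫ t : ℝ, k t * LSeries.term f (s + t * Complex.I) n =
      LSeries.term f s n * expIntegral k (Real.log n) := by
    intro n
    rw [expIntegral, ← MeasureTheory.integral_const_mul]
    congr 1; ext t
    rw [term_add_mul_I]; ring
  have e2 : ∀ t : ℝ, ∑' n, k t * LSeries.term f (s + t * Complex.I) n =
      k t * LSeries f (s + t * Complex.I) := fun t => tsum_mul_left
  simpa only [e1, e2] using h

lemma integral_exp_mul_expIntegral {k : ℝ → ℂ} (hk : MeasureTheory.Integrable k) {s : ℂ}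
    (hs : 1 < s.re) : ∫ y in Set.Ioi (0 : ℝ), Complex.exp ((1 - s) * y) * expIntegral k y =
      ∫ t : ℝ, k t * (1 / (s + t * Complex.I - 1)) := by
  have h1 : MeasureTheory.Integrable (fun y : ℝ => Complex.exp ((1 - s) * y))
      (MeasureTheory.volume.restrict (Set.Ioi (0 : ℝ))) :=
    integrableOn_exp_mul_complex_Ioi (by simpa using hs) 0
  have h2 : MeasureTheory.Integrable (Function.uncurry fun (y t : ℝ) =>
      Complex.exp (-(t * y : ℝ) * Complex.I) * (Complex.exp ((1 - s) * y) * k t))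
      ((MeasureTheory.volume.restrict (Set.Ioi (0 : ℝ))).prod MeasureTheory.volume) := by
    refine (h1.mul_prod hk).bdd_mul (c := 1) ?_ (Eventually.of_forall fun z => ?_)
    · exact (by fun_prop : Continuous fun z : ℝ × ℝ =>
        Complex.exp (-(z.2 * z.1 : ℝ) * Complex.I)).aestronglyMeasurable
    · exact (norm_exp_neg_mul_I _).le
  have h3 := MeasureTheory.integral_integral_swap h2
  calc _ = ∫ y in Set.Ioi (0 : ℝ), ∫ t : ℝ,
        Complex.exp (-(t * y : ℝ) * Complex.I) * (Complex.exp ((1 - s) * y) * k t) := by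
        congr 1; ext y
        rw [expIntegral, ← MeasureTheory.integral_const_mul]
        congr 1; ext t; ring
    _ = _ := by
        rw [h3]
        congr 1; ext t
        have h4 : ∀ y : ℝ, Complex.exp (-(t * y : ℝ) * Complex.I) *
            (Complex.exp ((1 - s) * y) * k t) =
            k t * Complex.exp ((1 - (s + t * Complex.I)) * y) := by
          intro y
          rw [← mul_assoc, ← Complex.exp_add, mul_comm]
          congr 2; push_cast; ring
        simp_rw [h4]
        rw [MeasureTheory.integral_const_mul, integral_exp_mul_complex_Ioi (by simpa using hs)]
        congr 1
        rw [← neg_sub 1 (s + t * Complex.I), div_neg, neg_div]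
        simp

lemma sum_vonMangoldt_sub_integral_of_one_lt (hRH : RiemannHypothesis) {k : ℝ → ℂ} {C : ℝ}
    (hk : Continuous k) (hkb : ∀ t, ‖k t‖ ≤ C / (1 + t ^ 2)) {A : ℝ} (hA : 0 ≤ A)
    (hKA : ∀ y, A ≤ y → expIntegral k y = 0) {s : ℂ} (h1 : 1 < s.re) (h2 : s.re < 2) :
    ∑ n ∈ range (⌊Real.exp A⌋₊ + 1), (ArithmeticFunction.vonMangoldt n : ℂ) *
        (n : ℂ) ^ (-s) * expIntegral k (Real.log n) -
      ∫ y in (0 : ℝ)..A, Complex.exp ((1 - s) * y) * expIntegral k y =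
      ∫ t : ℝ, k t * zetaG (s + t * Complex.I) := by
  have hki := integrable_of_le_div hk hkb
  have hs1 : ∀ t : ℝ, s + t * Complex.I - 1 ≠ 0 := by
    intro t h
    have := congrArg Complex.re h
    simp at this
    linarith
  have e1 := (hasSum_term_mul_expIntegral hki
    (ArithmeticFunction.LSeriesSummable_vonMangoldt h1)).tsum_eq
  have e2 := integral_exp_mul_expIntegral hki h1
  have i1 : MeasureTheory.Integrable fun t : ℝ => k t * (1 / (s + t * Complex.I - 1)) := by
    refine (hki.norm.mul_const (1 / (s.re - 1))).mono' ?_ (Eventually.of_forall fun t => ?_)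
    · refine (hk.mul ?_).aestronglyMeasurable
      exact Continuous.div (by fun_prop) (by fun_prop) hs1
    · rw [norm_mul, norm_div, norm_one]
      have h3 : s.re - 1 ≤ ‖s + t * Complex.I - 1‖ := by
        refine le_trans (le_of_eq ?_) (Complex.re_le_norm _)
        simp
      have : 0 < s.re - 1 := by linarith
      gcongr
  have e3 : ∀ t : ℝ, LSeries (fun n => (ArithmeticFunction.vonMangoldt n : ℂ))
      (s + t * Complex.I) = zetaG (s + t * Complex.I) + 1 / (s + t * Complex.I - 1) := by
    intro t
    rw [zetaG_eq_LSeries (by simpa using h1)]; ring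
  simp_rw [e3, mul_add] at e1
  rw [MeasureTheory.integral_add (integrable_mul_zetaG hRH hk hkb (by linarith) h2) i1,
    ← e2] at e1
  have e4 : ∫ y in Set.Ioi (0 : ℝ), Complex.exp ((1 - s) * y) * expIntegral k y =
      ∫ y in (0 : ℝ)..A, Complex.exp ((1 - s) * y) * expIntegral k y := by
    rw [intervalIntegral.integral_of_le hA]
    refine (MeasureTheory.setIntegral_eq_of_subset_of_forall_sdiff_eq_zero measurableSet_Ioi
      Set.Ioc_subset_Ioi_self fun y hy => ?_)
    have : A ≤ y := by
      by_contra h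
      exact hy.2 ⟨hy.1, (not_le.1 h).le⟩
    rw [hKA y this, mul_zero]
  rw [e4, tsum_eq_sum (s := range (⌊Real.exp A⌋₊ + 1))] at e1
  · rw [sub_eq_iff_eq_add, ← e1]
    refine Finset.sum_congr rfl fun n _ => ?_
    rcases eq_or_ne n 0 with rfl | hn
    · simp
    rw [LSeries.term_of_ne_zero hn, Complex.cpow_neg]; rfl
  · intro n hn
    rw [mem_range, not_lt, Nat.add_one_le_iff, Nat.floor_lt (Real.exp_pos _).le] at hn
    rw [hKA _ ((Real.le_log_iff_exp_le ((Real.exp_pos _).trans hn)).2 hn.le), mul_zero]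

theorem sum_vonMangoldt_sub_integral (hRH : RiemannHypothesis) {k : ℝ → ℂ} {C : ℝ}
    (hk : Continuous k) (hkb : ∀ t, ‖k t‖ ≤ C / (1 + t ^ 2)) {A : ℝ} (hA : 0 ≤ A)
    (hKA : ∀ y, A ≤ y → expIntegral k y = 0) {s : ℂ} (h1 : 1 / 2 < s.re) (h2 : s.re < 2) :
    ∑ n ∈ range (⌊Real.exp A⌋₊ + 1), (ArithmeticFunction.vonMangoldt n : ℂ) *
        (n : ℂ) ^ (-s) * expIntegral k (Real.log n) -
      ∫ y in (0 : ℝ)..A, Complex.exp ((1 - s) * y) * expIntegral k y =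
      ∫ t : ℝ, k t * zetaG (s + t * Complex.I) := by
  have hki := integrable_of_le_div hk hkb
  have hKc := continuous_expIntegral hki
  set U : Set ℂ := {s : ℂ | 1 / 2 < s.re} ∩ {s : ℂ | s.re < 2} with hU
  have hUo : IsOpen U := (isOpen_lt continuous_const Complex.continuous_re).inter
    (isOpen_lt Complex.continuous_re continuous_const)
  have hUc : IsPreconnected U :=
    ((convex_halfSpace_re_gt _).inter (convex_halfSpace_re_lt _)).isPreconnected
  have hd1 : ∀ n : ℕ, Differentiable ℂ fun s : ℂ => (ArithmeticFunction.vonMangoldt n : ℂ) *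
        (n : ℂ) ^ (-s) * expIntegral k (Real.log n) := by
    intro n
    rcases eq_or_ne n 0 with rfl | hn
    · simp
    have hn' : (n : ℂ) ≠ 0 := by exact_mod_cast hn
    exact ((differentiable_id.neg.const_cpow (Or.inl hn')).const_mul _).mul_const _
  have hd2 : Differentiable ℂ fun s : ℂ =>
      ∫ y in (0 : ℝ)..A, Complex.exp ((1 - s) * y) * expIntegral k y := by
    intro s
    have hb : ∃ B : ℝ, ∀ y ∈ Set.uIcc 0 A, ‖expIntegral k y‖ ≤ B :=
      isCompact_uIcc.exists_bound_of_continuousOn hKc.continuousOn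
    obtain ⟨B, hB⟩ := hb
    have := intervalIntegral.hasDerivAt_integral_of_dominated_loc_of_deriv_le (𝕜 := ℂ)
      (μ := MeasureTheory.volume) (a := 0) (b := A)
      (F := fun (s : ℂ) (y : ℝ) => Complex.exp ((1 - s) * y) * expIntegral k y)
      (F' := fun (s : ℂ) (y : ℝ) => Complex.exp ((1 - s) * y) * (-y) * expIntegral k y)
      (x₀ := s) (s := Metric.ball s 1)
      (bound := fun _ => Real.exp ((2 + ‖s‖) * A) * A * B)
      (Metric.ball_mem_nhds _ one_pos)
      (Eventually.of_forall fun z => Continuous.aestronglyMeasurable (by fun_prop))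
      (Continuous.intervalIntegrable (by fun_prop) _ _)
      (Continuous.aestronglyMeasurable (by fun_prop))
      (Eventually.of_forall fun y hy z hz => ?_)
      (Continuous.intervalIntegrable (by fun_prop) _ _)
      (Eventually.of_forall fun y hy z hz => ?_)
    · exact this.2.differentiableAt
    · have hy' : y ∈ Set.uIcc 0 A := Set.uIoc_subset_uIcc hy
      rw [Set.uIoc_of_le hA] at hy
      rw [norm_mul, norm_mul, Complex.norm_exp, norm_neg, Complex.norm_of_nonneg hy.1.le]
      have hz' : ‖z‖ ≤ 1 + ‖s‖ := by
        have := norm_le_norm_add_norm_sub' z s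
        have h3 : ‖z - s‖ < 1 := by simpa [dist_eq_norm] using hz
        rw [← norm_sub_rev] at this
        linarith [norm_sub_rev z s]
      have h4 : ((1 - z) * y).re ≤ (2 + ‖s‖) * A := by
        have h5 : ((1 - z) * y).re = (1 - z.re) * y := by simp
        have h6 := (abs_le.1 (Complex.abs_re_le_norm z)).1
        rw [h5]
        exact mul_le_mul (by linarith) hy.2 hy.1.le (by positivity)
      gcongr
      · exact hy.1.le
      · exact hy.2
      · exact hB y hy'
    · have h5 : HasDerivAt (fun z : ℂ => (1 - z) * (y : ℂ)) (-y) z := by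
        simpa using ((hasDerivAt_id z).const_sub 1).mul_const (y : ℂ)
      exact h5.cexp.mul_const _
  have hf1 : AnalyticOnNhd ℂ (fun s : ℂ => ∑ n ∈ range (⌊Real.exp A⌋₊ + 1),
      (ArithmeticFunction.vonMangoldt n : ℂ) * (n : ℂ) ^ (-s) * expIntegral k (Real.log n) -
      ∫ y in (0 : ℝ)..A, Complex.exp ((1 - s) * y) * expIntegral k y) U := by
    refine DifferentiableOn.analyticOnNhd (Differentiable.differentiableOn ?_) hUo
    exact (Differentiable.fun_sum fun n _ => hd1 n).sub hd2
  have hf2 : AnalyticOnNhd ℂ (fun s : ℂ => ∫ t : ℝ, k t * zetaG (s + t * Complex.I)) U :=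
    DifferentiableOn.analyticOnNhd (fun z hz =>
      (differentiableAt_integral_zetaG hRH hk hkb hz.1 hz.2).differentiableWithinAt) hUo
  refine hf1.eqOn_of_preconnected_of_eventuallyEq hf2 hUc (z₀ := 3 / 2) ?_ ?_ ⟨h1, h2⟩
  · constructor <;> simp <;> norm_num
  · have ho : IsOpen ({s : ℂ | 1 < s.re} ∩ {s : ℂ | s.re < 2}) :=
      (isOpen_lt continuous_const Complex.continuous_re).inter
        (isOpen_lt Complex.continuous_re continuous_const)
    have hm : (3 / 2 : ℂ) ∈ {s : ℂ | 1 < s.re} ∩ {s : ℂ | s.re < 2} := by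
      constructor <;> simp <;> norm_num
    filter_upwards [ho.mem_nhds hm] with z hz
    exact sum_vonMangoldt_sub_integral_of_one_lt hRH hk hkb hA hKA hz.1 hz.2

open FourierTransform in
lemma expIntegral_eq_of_eq_integral {K k : ℝ → ℂ} (hK : Continuous K)
    (hKi : MeasureTheory.Integrable K) (hki : MeasureTheory.Integrable k)
    (hk : ∀ t : ℝ, ∫ y : ℝ, K y * Complex.exp (t * y * Complex.I) = 2 * Real.pi * k t) (y : ℝ) :
    expIntegral k y = K y := by
  have hpi : -(2 * Real.pi) ≠ 0 := by have := Real.pi_pos; linarith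
  have h1 : 𝓕 K = fun ξ => 2 * Real.pi * k (-(2 * Real.pi) * ξ) := by
    ext ξ
    rw [Real.fourier_real_eq_integral_exp_smul, ← hk]
    congr 1; ext v
    rw [smul_eq_mul, mul_comm]
    congr 2; push_cast; ring
  have h2 : MeasureTheory.Integrable (𝓕 K) := by
    rw [h1]
    exact (hki.comp_mul_left' hpi).const_mul _
  rw [← congrFun (hK.fourierInv_fourier_eq hKi h2) y, h1, Real.fourierInv_eq']
  have h3 := MeasureTheory.Measure.integral_comp_mul_left
    (fun t : ℝ => k t * Complex.exp (-(t * y : ℝ) * Complex.I)) (-(2 * Real.pi))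
  have h4 : |(-(2 * Real.pi))⁻¹| = (2 * Real.pi)⁻¹ := by
    rw [inv_neg, abs_neg, abs_of_pos (by positivity)]
  rw [h4] at h3
  have h5 : ∀ v : ℝ, Complex.exp (↑(2 * Real.pi * inner ℝ v y) * Complex.I) •
      (2 * Real.pi * k (-(2 * Real.pi) * v)) = (2 * Real.pi : ℝ) •
      (k (-(2 * Real.pi) * v) *
        Complex.exp (-(-(2 * Real.pi) * v * y : ℝ) * Complex.I)) := by
    intro v
    rw [Complex.real_smul, smul_eq_mul]
    have : (inner ℝ v y : ℝ) = v * y := by simp [mul_comm]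
    rw [this]
    push_cast
    rw [show (-(-(2 * (Real.pi : ℂ)) * v * y) * Complex.I) = 2 * Real.pi * (v * y) * Complex.I
      by ring]
    ring
  simp_rw [h5]
  rw [MeasureTheory.integral_smul, h3, smul_smul, mul_inv_cancel₀ (by positivity), one_smul,
    expIntegral]

/-- The continuous function equal to `η` on `(-∞, 0]`, to `0` on `[η, ∞)` and linear between. -/
noncomputable def ramp (η y : ℝ) : ℝ := max 0 (min η (η - y))

@[fun_prop]
lemma continuous_ramp (η : ℝ) : Continuous (ramp η) := by unfold ramp; fun_prop

lemma ramp_of_nonpos {η y : ℝ} (hη : 0 ≤ η) (hy : y ≤ 0) : ramp η y = η := by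
  rw [ramp, min_eq_left (by linarith), max_eq_right hη]

lemma ramp_of_mem {η y : ℝ} (hy : 0 ≤ y) (hy' : y ≤ η) : ramp η y = η - y := by
  rw [ramp, min_eq_right (by linarith), max_eq_right (by linarith)]

lemma ramp_of_le {η y : ℝ} (hη : 0 ≤ η) (hy : η ≤ y) : ramp η y = 0 := by
  rw [ramp, min_eq_right (by linarith), max_eq_left (by linarith)]

lemma integral_ramp_mul_exp {η : ℝ} (hη : 0 < η) {w : ℂ} (hw : 0 < w.re) :
    MeasureTheory.Integrable (fun y : ℝ => (ramp η y : ℂ) * Complex.exp (w * y)) ∧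
    ∫ y : ℝ, (ramp η y : ℂ) * Complex.exp (w * y) = (Complex.exp (η * w) - 1) / w ^ 2 := by
  have hw0 : w ≠ 0 := by rintro rfl; simp at hw
  set f : ℝ → ℂ := fun y => (ramp η y : ℂ) * Complex.exp (w * y) with hf
  have hfc : Continuous f := by fun_prop
  have e1 : Set.EqOn (fun y : ℝ => (η : ℂ) * Complex.exp (w * y)) f (Set.Iic 0) := by
    intro y hy
    simp only [hf, ramp_of_nonpos hη.le hy]
  have e2 : Set.EqOn (fun _ : ℝ => (0 : ℂ)) f (Set.Ioi η) := by
    intro y hy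
    simp only [hf, ramp_of_le hη.le (le_of_lt hy)]
    simp
  have i1 : MeasureTheory.IntegrableOn f (Set.Iic 0) :=
    MeasureTheory.IntegrableOn.congr_fun
      ((integrableOn_exp_mul_complex_Iic hw 0).const_mul (η : ℂ)) e1 measurableSet_Iic
  have i3 : MeasureTheory.IntegrableOn f (Set.Ioi η) :=
    MeasureTheory.integrableOn_zero.congr_fun e2 measurableSet_Ioi
  have i23 : MeasureTheory.IntegrableOn f (Set.Ioi 0) := by
    rw [← Set.Ioc_union_Ioi_eq_Ioi hη.le]
    exact (hfc.integrableOn_Icc.mono_set Set.Ioc_subset_Icc_self).union i3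
  refine ⟨by rw [← MeasureTheory.integrableOn_univ, ← Set.Iic_union_Ioi]; exact i1.union i23, ?_⟩
  rw [← intervalIntegral.integral_Iic_add_Ioi i1 i23,
    ← intervalIntegral.integral_interval_add_Ioi i23 i3,
    ← MeasureTheory.setIntegral_congr_fun measurableSet_Iic e1,
    ← MeasureTheory.setIntegral_congr_fun measurableSet_Ioi e2, MeasureTheory.integral_const_mul,
    integral_exp_mul_complex_Iic hw]
  have hd : ∀ y ∈ Set.uIcc 0 η, HasDerivAt
      (fun y : ℝ => ((η - y) / w + 1 / w ^ 2 : ℂ) * Complex.exp (w * y)) (f y) y := by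
    intro y hy
    rw [Set.uIcc_of_le hη.le] at hy
    have h1 : HasDerivAt (fun y : ℝ => ((η - y) / w + 1 / w ^ 2 : ℂ)) (-1 / w) y :=
      (((Complex.ofRealCLM.hasDerivAt (x := y)).const_sub (η : ℂ)).div_const w).add_const _
    have h2 : HasDerivAt (fun y : ℝ => w * (y : ℂ)) w y := by
      simpa using (Complex.ofRealCLM.hasDerivAt (x := y)).const_mul w
    refine (h1.mul h2.cexp).congr_deriv ?_
    simp only [hf, ramp_of_mem hy.1 hy.2]
    push_cast
    field_simp
    ring
  rw [intervalIntegral.integral_eq_sub_of_hasDerivAt hd (hfc.intervalIntegrable _ _)]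
  simp only [Complex.ofReal_zero, mul_zero, Complex.exp_zero, MeasureTheory.integral_zero]
  field_simp
  ring_nf

/-- The trapezoid function vanishing outside `[0, X + η]`, equal to `1` on `[η, X]`. -/
noncomputable def trapezoid (η X y : ℝ) : ℝ := (ramp η (y - X) - ramp η y) / η

@[fun_prop]
lemma continuous_trapezoid (η X : ℝ) : Continuous (trapezoid η X) := by
  unfold trapezoid; fun_prop

lemma trapezoid_of_nonpos {η X y : ℝ} (hη : 0 ≤ η) (hX : 0 ≤ X) (hy : y ≤ 0) :
    trapezoid η X y = 0 := by
  rw [trapezoid, ramp_of_nonpos hη hy, ramp_of_nonpos hη (by linarith)]; simp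

lemma trapezoid_of_le {η X y : ℝ} (hη : 0 ≤ η) (hX : 0 ≤ X) (hy : X + η ≤ y) :
    trapezoid η X y = 0 := by
  rw [trapezoid, ramp_of_le hη (by linarith), ramp_of_le hη (by linarith)]; simp

lemma trapezoid_of_mem {η X y : ℝ} (hη : 0 < η) (hy : η ≤ y) (hy' : y ≤ X) :
    trapezoid η X y = 1 := by
  rw [trapezoid, ramp_of_le hη.le hy, ramp_of_nonpos hη.le (by linarith), sub_zero,
    div_self hη.ne']

/-- `(e^{ηw} - 1) / (ηw)`. -/
noncomputable def expSlope (η : ℝ) (w : ℂ) : ℂ := (Complex.exp (η * w) - 1) / (η * w)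

lemma integral_trapezoid_mul_exp {η : ℝ} (hη : 0 < η) (X : ℝ) {w : ℂ} (hw : 0 < w.re) :
    ∫ y : ℝ, (trapezoid η X y : ℂ) * Complex.exp (w * y) =
      expSlope η w * ((Complex.exp (X * w) - 1) / w) := by
  obtain ⟨h1, h2⟩ := integral_ramp_mul_exp hη hw
  have hw0 : w ≠ 0 := by rintro rfl; simp at hw
  have hη0 : (η : ℂ) ≠ 0 := by exact_mod_cast hη.ne'
  have h3 := h1.comp_sub_right X
  have h4 := MeasureTheory.integral_sub_right_eq_self (μ := MeasureTheory.volume)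
    (fun y : ℝ => (ramp η y : ℂ) * Complex.exp (w * y)) X
  have e : ∀ y : ℝ, (trapezoid η X y : ℂ) * Complex.exp (w * y) =
      (Complex.exp (X * w) / η) * ((ramp η (y - X) : ℂ) * Complex.exp (w * (y - X : ℝ))) -
      (1 / η) * ((ramp η y : ℂ) * Complex.exp (w * y)) := by
    intro y
    have : Complex.exp (w * y) = Complex.exp (X * w) * Complex.exp (w * (y - X : ℝ)) := by
      rw [← Complex.exp_add]; congr 1; push_cast; ring
    rw [trapezoid]
    push_cast
    rw [this]
    push_cast
    field_simp
  simp_rw [e]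
  rw [MeasureTheory.integral_sub (h3.const_mul _) (h1.const_mul _),
    MeasureTheory.integral_const_mul, MeasureTheory.integral_const_mul, h4, h2, expSlope]
  field_simp

lemma norm_exp_sub_one_le_four {z : ℂ} (hz : z.re ≤ 1) : ‖Complex.exp z - 1‖ ≤ 4 := by
  refine (norm_sub_le _ _).trans ?_
  rw [Complex.norm_exp, norm_one]
  have h1 := Real.exp_le_exp.2 hz
  have h2 := Real.exp_one_lt_d9
  linarith

lemma norm_expSlope_le {η : ℝ} {w : ℂ} (hη : 0 < η) (hη1 : η ≤ 1)
    (hw1 : w.re ≤ 1) : ‖expSlope η w‖ ≤ 4 := by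
  set z : ℂ := η * w with hz
  have hzr : z.re ≤ 1 := by
    have : z.re = η * w.re := by simp [hz]
    rw [this]; nlinarith
  rw [expSlope, norm_div]
  rcases le_total ‖z‖ 1 with h | h
  · have := Complex.norm_exp_sub_one_le h
    exact div_le_of_le_mul₀ (norm_nonneg _) (by norm_num) (by linarith [norm_nonneg z])
  · refine div_le_of_le_mul₀ (norm_nonneg _) (by norm_num) ?_
    linarith [norm_exp_sub_one_le_four hzr]

lemma norm_expSlope_le_div {η : ℝ} {w : ℂ} (hη : 0 < η) (hη1 : η ≤ 1) (hw : 0 < w.re)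
    (hw1 : w.re ≤ 1) : ‖expSlope η w‖ ≤ 4 / (η * ‖w‖) := by
  have hzr : ((η : ℂ) * w).re ≤ 1 := by
    have : ((η : ℂ) * w).re = η * w.re := by simp
    rw [this]; nlinarith
  rw [expSlope, norm_div, norm_mul, Complex.norm_of_nonneg hη.le]
  have : 0 < ‖w‖ := lt_of_lt_of_le hw (Complex.re_le_norm w)
  gcongr
  exact norm_exp_sub_one_le_four hzr

lemma re_add_mul_I (σ t : ℝ) : (σ + t * Complex.I : ℂ).re = σ := by simp

lemma norm_sq_add_mul_I (σ t : ℝ) : ‖(σ + t * Complex.I : ℂ)‖ ^ 2 = σ ^ 2 + t ^ 2 := by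
  rw [Complex.sq_norm, Complex.normSq_add_mul_I]

lemma add_mul_I_ne_zero {σ : ℝ} (hσ : 0 < σ) (t : ℝ) : (σ + t * Complex.I : ℂ) ≠ 0 := by
  intro h
  have := congrArg Complex.re h
  simp at this
  linarith

lemma continuous_expSlope_line {η σ : ℝ} (hη : 0 < η) (hσ : 0 < σ) :
    Continuous fun t : ℝ => expSlope η (σ + t * Complex.I) := by
  unfold expSlope
  refine Continuous.div (by fun_prop) (by fun_prop) fun t => ?_
  exact mul_ne_zero (by exact_mod_cast hη.ne') (add_mul_I_ne_zero hσ t)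

lemma norm_exp_mul_sub_one_le {X σ : ℝ} (hX : 0 ≤ X) (hσ : σ ≤ 1) (t : ℝ) :
    ‖Complex.exp (X * (σ + t * Complex.I)) - 1‖ ≤ Real.exp X + 1 := by
  refine (norm_sub_le _ _).trans ?_
  rw [Complex.norm_exp, norm_one]
  gcongr
  have : ((X : ℂ) * (σ + t * Complex.I)).re = X * σ := by simp
  rw [this]; nlinarith

lemma norm_trapezoidKernel_le {η X σ : ℝ} (hη : 0 < η) (hη1 : η ≤ 1) (hX : 0 ≤ X)
    (h1 : 1 / 2 < σ) (h2 : σ ≤ 1) (t : ℝ) :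
    ‖expSlope η (σ + t * Complex.I) * ((Complex.exp (X * (σ + t * Complex.I)) - 1) /
      (σ + t * Complex.I))‖ ≤ (16 / η * (Real.exp X + 1)) / (1 + t ^ 2) := by
  set w : ℂ := σ + t * Complex.I with hw
  have h3 := norm_sq_add_mul_I σ t
  rw [← hw] at h3
  have h4 : 0 < ‖w‖ := norm_pos_iff.2 (add_mul_I_ne_zero (by linarith) t)
  have hre : w.re = σ := re_add_mul_I σ t
  have h5 := norm_expSlope_le_div (w := w) hη hη1 (by rw [hre]; linarith) (by rw [hre]; exact h2)
  rw [norm_mul, norm_div]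
  calc _ ≤ 4 / (η * ‖w‖) * ((Real.exp X + 1) / ‖w‖) := by
        gcongr
        exact norm_exp_mul_sub_one_le hX h2 t
    _ = 4 / η * (Real.exp X + 1) / ‖w‖ ^ 2 := by field_simp
    _ ≤ 4 / η * (Real.exp X + 1) / ((1 + t ^ 2) / 4) := by
        gcongr
        rw [h3]; nlinarith [sq_nonneg t]
    _ = _ := by rw [div_div_eq_mul_div]; ring

/-- The real part of `-ζ'/ζ - 1/(s-1)` on `Re s = σ`, divided by `π` and smoothed at scale `η`. -/
noncomputable def zetaDensity (η σ t : ℝ) : ℂ :=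
  (((1 / Real.pi) * (zetaG (σ + t * Complex.I)).re : ℝ) : ℂ) * expSlope η (σ + t * Complex.I)

theorem sum_vonMangoldt_trapezoid (hRH : RiemannHypothesis) {η X σ : ℝ} (hη : 0 < η)
    (hη1 : η ≤ 1) (hX : 0 ≤ X) (h1 : 1 / 2 < σ) (h2 : σ ≤ 1) :
    ((∑ n ∈ range (⌊Real.exp (X + η)⌋₊ + 1),
      ArithmeticFunction.vonMangoldt n * trapezoid η X (Real.log n) : ℝ) : ℂ) -
      expSlope η 1 * (Complex.exp X - 1) =
    ∫ t : ℝ, zetaDensity η σ t * ((Complex.exp (X * (σ + t * Complex.I)) - 1) /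
      (σ + t * Complex.I)) := by
  have hpi := Real.pi_pos
  set k : ℝ → ℂ := fun t => (1 / (2 * Real.pi) : ℝ) * (expSlope η (σ + t * Complex.I) *
    ((Complex.exp (X * (σ + t * Complex.I)) - 1) / (σ + t * Complex.I))) with hk
  set K : ℝ → ℂ := fun y => (trapezoid η X y : ℂ) * Complex.exp (σ * y) with hK
  have hkc : Continuous k := by
    refine continuous_const.mul ((continuous_expSlope_line hη (by linarith)).mul ?_)
    exact Continuous.div (by fun_prop) (by fun_prop) (add_mul_I_ne_zero (by linarith))
  obtain ⟨C, hkb⟩ : ∃ C : ℝ, ∀ t, ‖k t‖ ≤ C / (1 + t ^ 2) := by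
    refine ⟨1 / (2 * Real.pi) * (16 / η * (Real.exp X + 1)), fun t => ?_⟩
    rw [hk, norm_mul, Complex.norm_of_nonneg (by positivity), mul_div_assoc]
    gcongr
    exact norm_trapezoidKernel_le hη hη1 hX h1 h2 t
  have hki := integrable_of_le_div hkc hkb
  have hKc : Continuous K := by fun_prop
  have hK0 : ∀ y ≤ 0, K y = 0 := by
    intro y hy; simp [hK, trapezoid_of_nonpos hη.le hX hy]
  have hKA : ∀ y, X + η ≤ y → K y = 0 := by
    intro y hy; simp [hK, trapezoid_of_le hη.le hX hy]
  have hKs : HasCompactSupport K := by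
    refine HasCompactSupport.intro (isCompact_Icc (a := 0) (b := X + η)) fun y hy => ?_
    rw [Set.mem_Icc, not_and_or, not_le, not_le] at hy
    exact hy.elim (fun h => hK0 y h.le) (fun h => hKA y h.le)
  have hKi : MeasureTheory.Integrable K := hKc.integrable_of_hasCompactSupport hKs
  have hFT : ∀ y, expIntegral k y = K y := by
    refine fun y => expIntegral_eq_of_eq_integral hKc hKi hki (fun t => ?_) y
    have h3 := integral_trapezoid_mul_exp hη X (w := σ + t * Complex.I) (by simp; linarith)
    rw [hk]
    push_cast
    rw [← h3]
    rw [show ∀ z : ℂ, 2 * (Real.pi : ℂ) * (1 / (2 * Real.pi) * z) = z from fun z => by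
      have : (Real.pi : ℂ) ≠ 0 := by exact_mod_cast hpi.ne'
      field_simp]
    congr 1; ext y
    rw [hK, mul_assoc, ← Complex.exp_add]
    congr 2; ring
  have hF1 := sum_vonMangoldt_sub_integral hRH hkc hkb (A := X + η) (by linarith)
    (fun y hy => by rw [hFT, hKA y hy]) (s := σ) (by simpa using h1) (by simp; linarith)
  have hF2 := sum_vonMangoldt_sub_integral hRH (k := fun t => k (-t)) (C := C)
    (by fun_prop) (fun t => by simpa using hkb (-t)) (A := 0) le_rfl
    (fun y hy => by
      have e : expIntegral (fun t => k (-t)) y = expIntegral k (-y) := by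
        rw [expIntegral, expIntegral, ← MeasureTheory.integral_neg_eq_self]
        simp
      rw [e, hFT, hK0 _ (by linarith)]) (s := σ) (by simpa using h1) (by simp; linarith)
  rw [intervalIntegral.integral_same, sub_zero] at hF2
  have hF2' : (0 : ℂ) = ∫ t : ℝ, k t * (starRingEnd ℂ) (zetaG (σ + t * Complex.I)) := by
    rw [← MeasureTheory.integral_neg_eq_self]
    rw [show (fun t : ℝ => k (-t) * (starRingEnd ℂ) (zetaG (σ + (-t : ℝ) * Complex.I))) =
      fun t : ℝ => k (-t) * zetaG (σ + t * Complex.I) from ?_, ← hF2]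
    · simp [Finset.sum_range_succ]
    · ext t
      rw [← zetaG_conj]; simp
  have i1 := integrable_mul_zetaG hRH hkc hkb (s := σ) (by simpa using h1) (by simp; linarith)
  have i2 : MeasureTheory.Integrable
      fun t : ℝ => k t * (starRingEnd ℂ) (zetaG (σ + t * Complex.I)) := by
    refine i1.mono (hkc.mul ?_).aestronglyMeasurable (Eventually.of_forall fun t => ?_)
    · exact Complex.continuous_conj.comp (continuous_zetaG_line hRH h1)
    · simp only [norm_mul, RCLike.norm_conj, le_refl]
  have hsum := congrArg₂ (· + ·) hF1 hF2'
  simp only [add_zero] at hsum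
  rw [← MeasureTheory.integral_add i1 i2] at hsum
  convert hsum using 1
  · congr 1
    · push_cast
      refine Finset.sum_congr rfl fun n _ => ?_
      rw [hFT, hK]
      rcases Nat.eq_zero_or_pos n with rfl | hn
      · simp
      have hn' : (n : ℂ) ≠ 0 := by exact_mod_cast hn.ne'
      have e : (n : ℂ) ^ (-(σ : ℂ)) * Complex.exp (σ * Real.log n) = 1 := by
        rw [Complex.cpow_def_of_ne_zero hn', ← Complex.exp_add, ← Complex.natCast_log]
        ring_nf; simp
      linear_combination (-(ArithmeticFunction.vonMangoldt n : ℂ) * trapezoid η X (Real.log n)) * e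
    · have h3 := integral_trapezoid_mul_exp hη X (w := 1) (by simp)
      rw [mul_one, div_one] at h3
      rw [← h3, ← intervalIntegral.integral_eq_integral_of_support_subset (a := 0) (b := X + η)]
      · refine intervalIntegral.integral_congr fun y _ => ?_
        simp only [hFT, hK]
        rw [mul_left_comm, ← Complex.exp_add]
        congr 2; ring
      · intro y hy
        by_contra h
        rw [Set.mem_Ioc, not_and_or, not_lt, not_le] at h
        refine hy ?_
        rcases h with h | h
        · simp [trapezoid_of_nonpos hη.le hX h]
        · simp [trapezoid_of_le hη.le hX h.le]
  · congr 1; ext t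
    rw [← mul_add, Complex.add_conj, hk, zetaDensity]
    push_cast
    have : (Real.pi : ℂ) ≠ 0 := by exact_mod_cast hpi.ne'
    field_simp

/-- The weight `min(1, Y²/u²)` for `u > 0`. -/
noncomputable def sqWeight (Y u : ℝ) : ℝ := if u ≤ Y then 1 else Y ^ 2 * u ^ (-2 : ℝ)

lemma sqWeight_nonneg {u : ℝ} (Y : ℝ) (hu : 0 < u) : 0 ≤ sqWeight Y u := by
  unfold sqWeight; split_ifs <;> positivity

lemma exp_mul_log_mul_I_eq_cpow {u : ℝ} (hu : 0 < u) (s : ℝ) :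
    Complex.exp ((s * Real.log u / 2 : ℝ) * Complex.I) = (u : ℂ) ^ (s / 2 * Complex.I : ℂ) := by
  rw [Complex.cpow_def_of_ne_zero (by exact_mod_cast hu.ne'), ← Complex.ofReal_log hu.le]
  congr 1; push_cast; ring

lemma integral_sqWeight_mul_exp {Y : ℝ} (hY : 0 < Y) (s : ℝ) :
    MeasureTheory.IntegrableOn (fun u : ℝ => (sqWeight Y u : ℂ) *
      Complex.exp ((s * Real.log u / 2 : ℝ) * Complex.I)) (Set.Ioi 0) ∧
    ‖∫ u in Set.Ioi (0 : ℝ), (sqWeight Y u : ℂ) *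
      Complex.exp ((s * Real.log u / 2 : ℝ) * Complex.I)‖ = Y * (8 / (4 + s ^ 2)) := by
  set f : ℝ → ℂ := fun u : ℝ => (sqWeight Y u : ℂ) *
    Complex.exp ((s * Real.log u / 2 : ℝ) * Complex.I) with hf
  set r : ℂ := s / 2 * Complex.I with hr
  have hr0 : r.re = 0 := by simp [hr]
  have hYc : (Y : ℂ) ≠ 0 := by exact_mod_cast hY.ne'
  have e1 : Set.EqOn (fun u : ℝ => (u : ℂ) ^ r) f (Set.Ioc 0 Y) := by
    intro u hu
    simp only [hf, sqWeight, if_pos hu.2, exp_mul_log_mul_I_eq_cpow hu.1]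
    simp [hr]
  have e2 : Set.EqOn (fun u : ℝ => (Y : ℂ) ^ 2 * (u : ℂ) ^ (-2 + r)) f (Set.Ioi Y) := by
    intro u hu
    have hu0 : 0 < u := hY.trans hu
    simp only [hf, sqWeight, if_neg (not_le.2 (Set.mem_Ioi.1 hu)), exp_mul_log_mul_I_eq_cpow hu0]
    rw [Complex.cpow_add _ _ (by exact_mod_cast hu0.ne')]
    push_cast
    rw [Complex.ofReal_cpow hu0.le]
    push_cast
    ring
  have i1 : MeasureTheory.IntegrableOn f (Set.Ioc 0 Y) :=
    MeasureTheory.IntegrableOn.congr_fun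
      ((intervalIntegrable_iff_integrableOn_Ioc_of_le hY.le).1
        (intervalIntegral.intervalIntegrable_cpow' (by rw [hr0]; norm_num))) e1 measurableSet_Ioc
  have i2 : MeasureTheory.IntegrableOn f (Set.Ioi Y) :=
    MeasureTheory.IntegrableOn.congr_fun
      ((integrableOn_Ioi_cpow_of_lt (a := -2 + r) (by simp [hr0]) hY).const_mul _)
        e2 measurableSet_Ioi
  refine ⟨by rw [← Set.Ioc_union_Ioi_eq_Ioi hY.le]; exact i1.union i2, ?_⟩
  have hne1 : r + 1 ≠ 0 := by
    intro h
    have := congrArg Complex.re h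
    simp [hr0] at this
  have hne2 : -2 + r + 1 ≠ 0 := by
    intro h
    have := congrArg Complex.re h
    simp [hr0] at this
    norm_num at this
  rw [← Set.Ioc_union_Ioi_eq_Ioi hY.le, MeasureTheory.setIntegral_union
    (Set.Ioc_disjoint_Ioi le_rfl) measurableSet_Ioi i1 i2,
    ← MeasureTheory.setIntegral_congr_fun measurableSet_Ioc e1,
    ← MeasureTheory.setIntegral_congr_fun measurableSet_Ioi e2, MeasureTheory.integral_const_mul,
    integral_Ioi_cpow_of_lt (by simp [hr0]) hY, ← intervalIntegral.integral_of_le hY.le,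
    integral_cpow (Or.inl (by rw [hr0]; norm_num)), Complex.ofReal_zero, Complex.zero_cpow hne1]
  have e3 : (Y : ℂ) ^ (r + 1) = Y * (Y : ℂ) ^ r := by
    rw [Complex.cpow_add _ _ hYc, Complex.cpow_one, mul_comm]
  have e4 : (Y : ℂ) ^ (-2 + r + 1) = (Y : ℂ)⁻¹ * (Y : ℂ) ^ r := by
    rw [show -2 + r + 1 = -1 + r by ring, Complex.cpow_add _ _ hYc, Complex.cpow_neg_one]
  have e5 : r ^ 2 = -(s ^ 2 / 4 : ℝ) := by
    rw [hr]; push_cast; linear_combination (s : ℂ) ^ 2 / 4 * Complex.I_sq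
  have hs : (4 : ℝ) + s ^ 2 ≠ 0 := by positivity
  have hs' : (4 : ℂ) + s ^ 2 ≠ 0 := by exact_mod_cast hs
  have e6 : ((Y : ℂ) ^ (r + 1) - 0) / (r + 1) + (Y : ℂ) ^ 2 *
      (-(Y : ℂ) ^ (-2 + r + 1) / (-2 + r + 1)) = (Y * (8 / (4 + s ^ 2)) : ℝ) * (Y : ℂ) ^ r := by
    rw [e3, e4]
    push_cast
    push_cast at e5
    field_simp
    linear_combination (-8 * (Y : ℂ) * (Y : ℂ) ^ r) * e5
  rw [e6, norm_mul, Complex.norm_cpow_eq_rpow_re_of_pos hY, hr0, Real.rpow_zero, mul_one,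
    Complex.norm_of_nonneg (by positivity)]

lemma lintegral_enorm_sq_le {f : ℝ → ℂ} (hf : MeasureTheory.Integrable f) {Y : ℝ} (hY : 0 < Y) :
    ∫⁻ u in Set.Ioc 0 Y, ‖∫ t : ℝ, f t *
      Complex.exp ((t * Real.log u / 2 : ℝ) * Complex.I)‖ₑ ^ 2 ≤
    ∫⁻ t : ℝ, ∫⁻ t' : ℝ, ‖f t‖ₑ * ‖f t'‖ₑ * ENNReal.ofReal (Y * (8 / (4 + (t - t') ^ 2))) := by
  set e : ℝ → ℝ → ℂ := fun u t => Complex.exp ((t * Real.log u / 2 : ℝ) * Complex.I) with he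
  have hem : Measurable (Function.uncurry e) := by
    refine Complex.measurable_exp.comp ((Complex.measurable_ofReal.comp ?_).mul_const _)
    exact ((measurable_snd.mul (Real.measurable_log.comp measurable_fst)).div_const 2)
  have hen : ∀ u t, ‖e u t‖ = 1 := fun u t => Complex.norm_exp_ofReal_mul_I _
  set F : ℝ → ℂ := fun u => ∫ t : ℝ, f t * e u t with hF
  set W : ℝ → ℂ := fun u => sqWeight Y u with hW
  set g : ℝ × ℝ → ℂ := fun p => f p.1 * (starRingEnd ℂ) (f p.2) with hg
  have hgi : MeasureTheory.Integrable g (MeasureTheory.volume.prod MeasureTheory.volume) :=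
    hf.mul_prod ((RCLike.conjLIE (K := ℂ)).integrable_comp_iff.2 hf)
  have hWi : MeasureTheory.Integrable W (MeasureTheory.volume.restrict (Set.Ioi 0)) := by
    simpa [hW, MeasureTheory.IntegrableOn] using (integral_sqWeight_mul_exp hY 0).1
  set Q : ℝ → ℝ × ℝ → ℂ := fun u p => e u (p.1 - p.2) * (W u * g p) with hQ
  have hQi : MeasureTheory.Integrable (Function.uncurry Q)
      ((MeasureTheory.volume.restrict (Set.Ioi 0)).prod
        (MeasureTheory.volume.prod MeasureTheory.volume)) := by
    refine (hWi.mul_prod hgi).bdd_mul (c := 1) ?_ (Eventually.of_forall fun z => (hen _ _).le)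
    exact (hem.comp (measurable_fst.prodMk ((measurable_fst.comp measurable_snd).sub
      (measurable_snd.comp measurable_snd)))).aestronglyMeasurable
  have hinner : ∀ u, ∫ p, Q u p ∂(MeasureTheory.volume.prod MeasureTheory.volume) =
      ((sqWeight Y u * ‖F u‖ ^ 2 : ℝ) : ℂ) := by
    intro u
    have h1 : ∀ p : ℝ × ℝ, Q u p = W u * ((f p.1 * e u p.1) *
        (starRingEnd ℂ) (f p.2 * e u p.2)) := by
      intro p
      have : e u (p.1 - p.2) = e u p.1 * (starRingEnd ℂ) (e u p.2) := by
        simp only [he, ← Complex.exp_conj, ← Complex.exp_add, map_mul, Complex.conj_ofReal,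
          Complex.conj_I]
        congr 1; push_cast; ring
      rw [hQ]; simp only [hg, map_mul, this]; ring
    simp_rw [h1]
    rw [MeasureTheory.integral_const_mul, MeasureTheory.integral_prod_mul
      (fun t => f t * e u t) (fun t => (starRingEnd ℂ) (f t * e u t)), integral_conj,
      Complex.mul_conj, Complex.normSq_eq_norm_sq]
    push_cast; rfl
  have hWF : MeasureTheory.Integrable (fun u => ((sqWeight Y u * ‖F u‖ ^ 2 : ℝ) : ℂ))
      (MeasureTheory.volume.restrict (Set.Ioi 0)) := by
    simpa only [Function.uncurry_apply_pair, hinner] using hQi.integral_prod_left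
  have hpos : ∀ u ∈ Set.Ioi (0 : ℝ), 0 ≤ sqWeight Y u * ‖F u‖ ^ 2 := fun u hu =>
    mul_nonneg (sqWeight_nonneg Y hu) (sq_nonneg _)
  calc _ ≤ ∫⁻ u in Set.Ioi (0 : ℝ), ENNReal.ofReal (sqWeight Y u * ‖F u‖ ^ 2) := by
        refine le_trans (le_of_eq ?_) (MeasureTheory.lintegral_mono_set
          (s := Set.Ioc 0 Y) Set.Ioc_subset_Ioi_self)
        refine MeasureTheory.setLIntegral_congr_fun measurableSet_Ioc fun u hu => ?_
        simp only [sqWeight, if_pos hu.2, one_mul]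
        rw [ENNReal.ofReal_pow (norm_nonneg _), ofReal_norm]
    _ = ‖∫ u in Set.Ioi (0 : ℝ), ((sqWeight Y u * ‖F u‖ ^ 2 : ℝ) : ℂ)‖ₑ := by
        rw [integral_complex_ofReal, ← ofReal_norm, Complex.norm_of_nonneg
          (MeasureTheory.setIntegral_nonneg measurableSet_Ioi hpos),
          MeasureTheory.ofReal_integral_eq_lintegral_ofReal]
        · exact hWF.re
        · exact (MeasureTheory.ae_restrict_iff' measurableSet_Ioi).2 (Eventually.of_forall hpos)
    _ = ‖∫ p, ∫ u in Set.Ioi (0 : ℝ), Q u p ∂MeasureTheory.volume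
          ∂(MeasureTheory.volume.prod MeasureTheory.volume)‖ₑ := by
        rw [← MeasureTheory.integral_integral_swap hQi]
        simp_rw [hinner]
    _ ≤ ∫⁻ p, ‖∫ u in Set.Ioi (0 : ℝ), Q u p‖ₑ
          ∂(MeasureTheory.volume.prod MeasureTheory.volume) :=
        MeasureTheory.enorm_integral_le_lintegral_enorm _
    _ = ∫⁻ p : ℝ × ℝ, ‖f p.1‖ₑ * ‖f p.2‖ₑ *
          ENNReal.ofReal (Y * (8 / (4 + (p.1 - p.2) ^ 2)))
          ∂(MeasureTheory.volume.prod MeasureTheory.volume) := by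
        congr 1; ext p
        have h1 : ∀ u, Q u p = g p * (W u * e u (p.1 - p.2)) := fun u => by rw [hQ]; ring
        simp_rw [h1]
        rw [MeasureTheory.integral_const_mul, enorm_mul, enorm_mul, RCLike.enorm_conj]
        congr 1
        rw [← ofReal_norm, (integral_sqWeight_mul_exp hY _).2]
    _ = _ := by
        refine MeasureTheory.lintegral_prod _ ?_
        have h1 := hf.aestronglyMeasurable.enorm
        refine ((h1.comp_quasiMeasurePreserving MeasureTheory.Measure.quasiMeasurePreserving_fst).mul
          (h1.comp_quasiMeasurePreserving MeasureTheory.Measure.quasiMeasurePreserving_snd)).mul ?_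
        exact (by fun_prop : Measurable fun p : ℝ × ℝ =>
          ENNReal.ofReal (Y * (8 / (4 + (p.1 - p.2) ^ 2)))).aemeasurable

/-- The mass of `φ` on `[x, x + 1]`. -/
noncomputable def unitMass (φ : ℝ → ENNReal) (x : ℝ) : ENNReal := ∫⁻ t in Set.Icc x (x + 1), φ t

lemma measurableSet_unitStrip : MeasurableSet {p : ℝ × ℝ | p.1 ≤ p.2 ∧ p.2 ≤ p.1 + 1} :=
  (measurableSet_le measurable_fst measurable_snd).inter
    (measurableSet_le measurable_snd (measurable_fst.add_const 1))

lemma unitMass_eq (φ : ℝ → ENNReal) (x : ℝ) : unitMass φ x =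
    ∫⁻ t, {p : ℝ × ℝ | p.1 ≤ p.2 ∧ p.2 ≤ p.1 + 1}.indicator (fun p => φ p.2) (x, t) := by
  rw [unitMass, ← MeasureTheory.lintegral_indicator measurableSet_Icc]
  rfl

lemma measurable_unitMass {φ : ℝ → ENNReal} (hφ : Measurable φ) : Measurable (unitMass φ) := by
  rw [show unitMass φ = fun x => _ from funext (unitMass_eq φ)]
  exact ((hφ.comp measurable_snd).indicator measurableSet_unitStrip).lintegral_prod_right'

lemma lintegral_mul_le_unitMass {φ A : ℝ → ENNReal} (hφ : Measurable φ) (hA : Measurable A)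
    {c : ENNReal} (h : ∀ t x, |t - x| ≤ 1 → A t ≤ c * A x) :
    ∫⁻ t, φ t * A t ≤ c * ∫⁻ x, unitMass φ x * A x := by
  set S := {p : ℝ × ℝ | p.1 ≤ p.2 ∧ p.2 ≤ p.1 + 1} with hS
  have hm : Measurable (S.indicator fun p : ℝ × ℝ => φ p.2 * A p.1) :=
    ((hφ.comp measurable_snd).mul (hA.comp measurable_fst)).indicator measurableSet_unitStrip
  calc ∫⁻ t, φ t * A t
      ≤ ∫⁻ t, c * ∫⁻ x, S.indicator (fun p : ℝ × ℝ => φ p.2 * A p.1) (x, t) := by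
        refine MeasureTheory.lintegral_mono fun t => ?_
        have hmt : Measurable fun x => S.indicator (fun p : ℝ × ℝ => φ p.2 * A p.1) (x, t) :=
          hm.comp (measurable_id.prodMk measurable_const)
        rw [← MeasureTheory.lintegral_const_mul _ hmt]
        calc φ t * A t = ∫⁻ x in Set.Icc (t - 1) t, φ t * A t := by simp
          _ ≤ ∫⁻ x in Set.Icc (t - 1) t, c * (φ t * A x) := by
              refine MeasureTheory.setLIntegral_mono ((hA.const_mul _).const_mul _) fun x hx => ?_
              rw [mul_left_comm]
              gcongr
              exact h t x (abs_le.2 ⟨by linarith [hx.2], by linarith [hx.1]⟩)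
          _ = _ := by
              rw [← MeasureTheory.lintegral_indicator measurableSet_Icc]
              congr 1; ext x
              by_cases hx : x ∈ Set.Icc (t - 1) t
              · rw [Set.indicator_of_mem hx, Set.indicator_of_mem
                  (show (x, t) ∈ S from ⟨hx.2, by linarith [hx.1]⟩)]
              · rw [Set.indicator_of_notMem hx, Set.indicator_of_notMem, mul_zero]
                exact fun h' => hx ⟨by linarith [h'.2], h'.1⟩
    _ = c * ∫⁻ t, ∫⁻ x, S.indicator (fun p : ℝ × ℝ => φ p.2 * A p.1) (x, t) :=
        MeasureTheory.lintegral_const_mul _ hm.lintegral_prod_left'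
    _ = c * ∫⁻ x, unitMass φ x * A x := by
        rw [MeasureTheory.lintegral_lintegral_swap
          (f := fun t x => S.indicator (fun p : ℝ × ℝ => φ p.2 * A p.1) (x, t))
          (hm.comp measurable_swap).aemeasurable]
        congr 2; ext x
        rw [unitMass_eq, ← MeasureTheory.lintegral_mul_const]
        · congr 1; ext t
          by_cases hx : (x, t) ∈ S
          · rw [Set.indicator_of_mem hx, Set.indicator_of_mem hx]
          · rw [Set.indicator_of_notMem hx, Set.indicator_of_notMem hx, zero_mul]
        · exact ((hφ.comp measurable_snd).indicator measurableSet_unitStrip).comp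
            (measurable_const.prodMk measurable_id)

lemma lintegral_lintegral_mul_le {φ κ : ℝ → ENNReal} (hφ : Measurable φ) (hκ : Measurable κ)
    {c : ENNReal} (h : ∀ s s', |s - s'| ≤ 1 → κ s ≤ c * κ s') (heven : ∀ s, κ (-s) = κ s) :
    ∫⁻ t, ∫⁻ t', φ t * φ t' * κ (t - t') ≤
      c * (c * ((∫⁻ s, κ s) * ∫⁻ x, unitMass φ x ^ 2)) := by
  have hκ2 : Measurable fun p : ℝ × ℝ => κ (p.1 - p.2) :=
    hκ.comp (measurable_fst.sub measurable_snd)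
  have hA : ∀ ψ : ℝ → ENNReal, Measurable ψ → Measurable fun t => ∫⁻ t', ψ t' * κ (t - t') :=
    fun ψ hψ => ((hψ.comp measurable_snd).mul hκ2).lintegral_prod_right'
  have hs : ∀ t x y : ℝ, |t - x| ≤ 1 → κ (t - y) ≤ c * κ (x - y) := fun t x y htx =>
    h _ _ (by simpa using htx)
  have hshift : ∀ (t : ℝ) , Measurable fun t' => κ (t - t') := fun t =>
    hκ.comp (measurable_const.sub measurable_id)
  have hmul : ∀ ψ : ℝ → ENNReal, ∀ t, Measurable ψ → Measurable fun t' => ψ t' * κ (t - t') :=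
    fun ψ t hψ => hψ.mul (hshift t)
  have hP := measurable_unitMass hφ
  have hsymm : ∀ ψ ψ' : ℝ → ENNReal, Measurable ψ → Measurable ψ' →
      ∫⁻ x, ψ x * ∫⁻ t', ψ' t' * κ (x - t') = ∫⁻ t', ψ' t' * ∫⁻ x, ψ x * κ (t' - x) := by
    intro ψ ψ' hψ hψ'
    have e1 : ∀ x, ψ x * ∫⁻ t', ψ' t' * κ (x - t') = ∫⁻ t', ψ x * (ψ' t' * κ (x - t')) :=
      fun x => (MeasureTheory.lintegral_const_mul _ (hψ'.mul (hshift x))).symm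
    have e2 : ∀ t', ψ' t' * ∫⁻ x, ψ x * κ (t' - x) = ∫⁻ x, ψ' t' * (ψ x * κ (t' - x)) :=
      fun x => (MeasureTheory.lintegral_const_mul _ (hψ.mul (hshift x))).symm
    simp_rw [e1, e2]
    rw [MeasureTheory.lintegral_lintegral_swap]
    · congr 1; ext t'
      congr 1; ext x
      rw [← heven (x - t'), neg_sub, mul_left_comm]
    · exact ((hψ.comp measurable_fst).mul ((hψ'.comp measurable_snd).mul hκ2)).aemeasurable
  have hbound : ∀ t x : ℝ, |t - x| ≤ 1 → ∀ ψ : ℝ → ENNReal, Measurable ψ →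
      ∫⁻ t', ψ t' * κ (t - t') ≤ c * ∫⁻ t', ψ t' * κ (x - t') := by
    intro t x htx ψ hψ
    rw [← MeasureTheory.lintegral_const_mul _ (hmul ψ x hψ)]
    refine MeasureTheory.lintegral_mono fun t' => ?_
    change ψ t' * κ (t - t') ≤ c * (ψ t' * κ (x - t'))
    rw [mul_left_comm]
    gcongr
    exact hs t x t' htx
  calc ∫⁻ t, ∫⁻ t', φ t * φ t' * κ (t - t')
      = ∫⁻ t, φ t * ∫⁻ t', φ t' * κ (t - t') := by
        congr 1; ext t
        rw [← MeasureTheory.lintegral_const_mul _ (hmul φ t hφ)]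
        simp_rw [mul_assoc]
    _ ≤ c * ∫⁻ x, unitMass φ x * ∫⁻ t', φ t' * κ (x - t') :=
        lintegral_mul_le_unitMass hφ (hA φ hφ) fun t x htx => hbound t x htx φ hφ
    _ = c * ∫⁻ t', φ t' * ∫⁻ x, unitMass φ x * κ (t' - x) := by rw [hsymm _ _ hP hφ]
    _ ≤ c * (c * ∫⁻ x, unitMass φ x * ∫⁻ t', unitMass φ t' * κ (x - t')) := by
        gcongr
        exact lintegral_mul_le_unitMass hφ (hA _ hP) fun t x htx => hbound t x htx _ hP
    _ ≤ c * (c * ((∫⁻ s, κ s) * ∫⁻ x, unitMass φ x ^ 2)) := by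
        gcongr
        set P := unitMass φ
        have hκ1 : ∀ x, ∫⁻ t', κ (x - t') = ∫⁻ s, κ s := fun x =>
          MeasureTheory.lintegral_sub_left_eq_self κ x
        have hamgm : ∀ a b : ENNReal, 2 * (a * b) ≤ a ^ 2 + b ^ 2 := by
          intro a b
          rcases le_total a b with hab | hab
          · obtain ⟨d, rfl⟩ := exists_add_of_le hab
            calc 2 * (a * (a + d)) ≤ 2 * (a * (a + d)) + d ^ 2 := le_self_add
              _ = _ := by ring
          · obtain ⟨d, rfl⟩ := exists_add_of_le hab
            calc 2 * ((b + d) * b) ≤ 2 * ((b + d) * b) + d ^ 2 := le_self_add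
              _ = _ := by ring
        have h2 : 2 * ∫⁻ x, P x * ∫⁻ t', P t' * κ (x - t') ≤
            2 * ((∫⁻ s, κ s) * ∫⁻ x, P x ^ 2) := by
          have hPsq : Measurable fun x => P x ^ 2 := hP.pow_const 2
          have h1 : Measurable fun x => ∫⁻ t', P x ^ 2 * κ (x - t') :=
            ((hPsq.comp measurable_fst).mul hκ2).lintegral_prod_right'
          calc 2 * ∫⁻ x, P x * ∫⁻ t', P t' * κ (x - t')
              = ∫⁻ x, ∫⁻ t', 2 * (P x * P t') * κ (x - t') := by
                have hm : Measurable fun x => P x * ∫⁻ t', P t' * κ (x - t') := hP.mul (hA _ hP)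
                rw [← MeasureTheory.lintegral_const_mul _ hm]
                congr 1; ext x
                rw [← MeasureTheory.lintegral_const_mul _ (hmul P x hP),
                  ← MeasureTheory.lintegral_const_mul _ ((hmul P x hP).const_mul _)]
                congr 1; ext t'; ring
            _ ≤ ∫⁻ x, ∫⁻ t', (P x ^ 2 * κ (x - t') + P t' ^ 2 * κ (x - t')) := by
                refine MeasureTheory.lintegral_mono fun x => MeasureTheory.lintegral_mono
                  fun t' => ?_
                rw [← add_mul]
                gcongr
                exact hamgm _ _
            _ = ∫⁻ x, ((∫⁻ t', P x ^ 2 * κ (x - t')) + ∫⁻ t', P t' ^ 2 * κ (x - t')) := by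
                congr 1; ext x
                have hm : Measurable fun t' => P x ^ 2 * κ (x - t') := (hshift x).const_mul _
                exact MeasureTheory.lintegral_add_left hm _
            _ = (∫⁻ x, ∫⁻ t', P x ^ 2 * κ (x - t')) + ∫⁻ x, ∫⁻ t', P t' ^ 2 * κ (x - t') :=
                MeasureTheory.lintegral_add_left h1 _
            _ = (∫⁻ s, κ s) * (∫⁻ x, P x ^ 2) + (∫⁻ s, κ s) * (∫⁻ x, P x ^ 2) := by
                congr 1
                · rw [← MeasureTheory.lintegral_const_mul _ hPsq]
                  refine MeasureTheory.lintegral_congr fun x => ?_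
                  rw [MeasureTheory.lintegral_const_mul _ (hshift x), hκ1, mul_comm]
                · rw [MeasureTheory.lintegral_lintegral_swap
                    ((hPsq.comp measurable_snd).mul hκ2).aemeasurable,
                    ← MeasureTheory.lintegral_const_mul _ hPsq]
                  refine MeasureTheory.lintegral_congr fun x => ?_
                  have hm : Measurable fun t => κ (t - x) :=
                    hκ.comp (measurable_id.sub measurable_const)
                  rw [MeasureTheory.lintegral_const_mul _ hm, mul_comm]
                  congr 1
                  exact MeasureTheory.lintegral_sub_right_eq_self κ x
            _ = _ := by ring
        exact (ENNReal.mul_le_mul_iff_right two_ne_zero ENNReal.ofNat_ne_top).1 h2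

/-- Mean square of `∫ f(t) u^{it/2} dt` over `0 < u ≤ Y`. -/
theorem exists_lintegral_enorm_sq_le : ∃ C : NNReal, ∀ f : ℝ → ℂ, Continuous f →
    MeasureTheory.Integrable f → ∀ Y : ℝ, 0 < Y →
    ∫⁻ u in Set.Ioc 0 Y, ‖∫ t : ℝ, f t *
      Complex.exp ((t * Real.log u / 2 : ℝ) * Complex.I)‖ₑ ^ 2 ≤
    C * (ENNReal.ofReal Y * ∫⁻ x, unitMass (fun t => ‖f t‖ₑ) x ^ 2) := by
  set κ : ℝ → ENNReal := fun s => ENNReal.ofReal (8 / (4 + s ^ 2)) with hκ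
  have hκm : Measurable κ := by fun_prop
  have hfin : ∫⁻ s, κ s ≠ ⊤ := by
    have h1 : MeasureTheory.Integrable fun s : ℝ => 8 / (4 + s ^ 2) := by
      refine (integrable_inv_one_add_sq.const_mul 8).mono'
        (by fun_prop : Measurable fun s : ℝ => 8 / (4 + s ^ 2)).aestronglyMeasurable
        (Eventually.of_forall fun s => ?_)
      rw [Real.norm_of_nonneg (by positivity), ← div_eq_mul_inv]
      gcongr
      norm_num
    exact h1.lintegral_lt_top.ne
  have hslow : ∀ s s', |s - s'| ≤ 1 → κ s ≤ 2 * κ s' := by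
    intro s s' h
    rw [hκ]
    simp only
    rw [← ENNReal.ofReal_ofNat 2, ← ENNReal.ofReal_mul (by norm_num)]
    refine ENNReal.ofReal_le_ofReal ?_
    rw [← mul_div_assoc, div_le_div_iff₀ (by positivity) (by positivity)]
    obtain ⟨h1, h2⟩ := abs_le.1 h
    nlinarith [sq_nonneg (s + (s - s')), sq_nonneg (2 * s - s'), sq_nonneg (s - s')]
  refine ⟨2 * (2 * (∫⁻ s, κ s).toNNReal), fun f hf hfi Y hY => ?_⟩
  refine (lintegral_enorm_sq_le hfi hY).trans ?_
  have h1 := lintegral_lintegral_mul_le (φ := fun t => ‖f t‖ₑ) hf.enorm.measurable hκm hslow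
    (by simp [hκ])
  have hm : Measurable fun p : ℝ × ℝ => ‖f p.1‖ₑ * ‖f p.2‖ₑ * κ (p.1 - p.2) := by
    exact ((hf.enorm.measurable.comp measurable_fst).mul
      (hf.enorm.measurable.comp measurable_snd)).mul (hκm.comp (measurable_fst.sub measurable_snd))
  calc _ = ∫⁻ t, ∫⁻ t', ENNReal.ofReal Y * (‖f t‖ₑ * ‖f t'‖ₑ * κ (t - t')) := by
        congr 1; ext t; congr 1; ext t'
        rw [ENNReal.ofReal_mul hY.le]; ring
    _ = ENNReal.ofReal Y * ∫⁻ t, ∫⁻ t', ‖f t‖ₑ * ‖f t'‖ₑ * κ (t - t') := by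
        rw [← MeasureTheory.lintegral_const_mul _ hm.lintegral_prod_right']
        congr 1; ext t
        have hmt : Measurable fun t' => ‖f t‖ₑ * ‖f t'‖ₑ * κ (t - t') :=
          hm.comp (measurable_const.prodMk measurable_id)
        rw [MeasureTheory.lintegral_const_mul _ hmt]
    _ ≤ ENNReal.ofReal Y * (2 * (2 * ((∫⁻ s, κ s) *
        ∫⁻ x, unitMass (fun t => ‖f t‖ₑ) x ^ 2))) := by gcongr
    _ = _ := by
        push_cast
        rw [ENNReal.coe_toNNReal hfin]
        ring

/-- The density `zetaDensity η σ` twisted by `l` times the exponential slope: it represents the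
increment of the smoothed prime sum under a dilation by `exp l`. -/
noncomputable def dilationDensity (η σ l t : ℝ) : ℂ :=
  zetaDensity η σ t * (l * expSlope l (σ + t * Complex.I))

lemma continuous_zetaDensity (hRH : RiemannHypothesis) {η σ : ℝ} (hη : 0 < η) (h1 : 1 / 2 < σ) :
    Continuous (zetaDensity η σ) := by
  unfold zetaDensity
  refine (Complex.continuous_ofReal.comp (continuous_const.mul
    (Complex.continuous_re.comp (continuous_zetaG_line hRH h1)))).mul ?_
  exact continuous_expSlope_line hη (by linarith)

lemma continuous_dilationDensity (hRH : RiemannHypothesis) {η σ l : ℝ} (hη : 0 < η)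
    (h1 : 1 / 2 < σ) (hl : 0 < l) : Continuous (dilationDensity η σ l) :=
  (continuous_zetaDensity hRH hη h1).mul
    (continuous_const.mul (continuous_expSlope_line hl (by linarith)))

lemma norm_mul_expSlope_le_div {l σ : ℝ} (hl : 0 < l) (hl1 : l ≤ 1) (h0 : 0 < σ) (h2 : σ ≤ 1)
    (t : ℝ) : ‖(l : ℂ) * expSlope l (σ + t * Complex.I)‖ ≤ 4 / ‖(σ + t * Complex.I : ℂ)‖ := by
  rw [norm_mul, Complex.norm_real, Real.norm_of_nonneg hl.le]
  have h := norm_expSlope_le_div hl hl1 (w := σ + t * Complex.I) (by simpa using h0)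
    (by simpa using h2)
  calc _ ≤ l * (4 / (l * ‖(σ + t * Complex.I : ℂ)‖)) := by gcongr
    _ = _ := by
      have := norm_pos_iff.2 (add_mul_I_ne_zero h0 t)
      field_simp

lemma norm_mul_expSlope_le {l σ : ℝ} (hl : 0 < l) (hl1 : l ≤ 1) (h2 : σ ≤ 1)
    (t : ℝ) : ‖(l : ℂ) * expSlope l (σ + t * Complex.I)‖ ≤ 4 * l := by
  rw [norm_mul, Complex.norm_real, Real.norm_of_nonneg hl.le]
  have h := norm_expSlope_le hl hl1 (w := σ + t * Complex.I) (by simpa using h2)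
  nlinarith

lemma integrable_zetaDensity_mul (hRH : RiemannHypothesis) {η σ D : ℝ} (hη : 0 < η)
    (hη1 : η ≤ 1) (h1 : 1 / 2 < σ) (h2 : σ ≤ 1) {k : ℝ → ℂ} (hk : Continuous k)
    (hkb : ∀ t, ‖k t‖ ≤ D / ‖(σ + t * Complex.I : ℂ)‖) :
    MeasureTheory.Integrable fun t => zetaDensity η σ t * k t := by
  obtain ⟨C, hC, hG⟩ := exists_norm_zetaG_le hRH
  have h0 : 0 < σ := by linarith
  have hD : 0 ≤ D := by
    have h := (norm_nonneg _).trans (hkb 0)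
    by_contra! hD
    exact absurd h (not_le.2 (div_neg_of_neg_of_pos hD (norm_pos_iff.2 (add_mul_I_ne_zero h0 0))))
  refine (integrable_log_div.const_mul (C / (σ - 1 / 2) * (4 * D / η) * 4)).mono'
    ((continuous_zetaDensity hRH hη h1).mul hk).aestronglyMeasurable
    (Eventually.of_forall fun t => ?_)
  have hw := norm_pos_iff.2 (add_mul_I_ne_zero h0 t)
  have hsq := norm_sq_add_mul_I σ t
  have hL := log_abs_add_two_pos t
  have hσ : 0 < σ - 1 / 2 := by linarith
  have hre : ‖(((1 / Real.pi) * (zetaG (σ + t * Complex.I)).re : ℝ) : ℂ)‖ ≤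
      C / (σ - 1 / 2) * Real.log (|t| + 2) := by
    rw [Complex.norm_real, norm_mul, Real.norm_of_nonneg (by positivity), Real.norm_eq_abs]
    have hpi : 1 / Real.pi ≤ 1 := by
      rw [div_le_one Real.pi_pos]; linarith [Real.pi_gt_three]
    calc _ ≤ 1 * |(zetaG (σ + t * Complex.I)).re| := by gcongr
      _ ≤ ‖zetaG (σ + t * Complex.I)‖ := by rw [one_mul]; exact Complex.abs_re_le_norm _
      _ ≤ _ := hG σ h1 (by linarith) t
  have he := norm_expSlope_le_div hη hη1 (w := σ + t * Complex.I) (by simpa using h0)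
    (by simpa using h2)
  rw [zetaDensity, norm_mul, norm_mul]
  calc _ ≤ C / (σ - 1 / 2) * Real.log (|t| + 2) * (4 / (η * ‖(σ + t * Complex.I : ℂ)‖)) *
        (D / ‖(σ + t * Complex.I : ℂ)‖) := by
        gcongr
        exact hkb t
    _ = C / (σ - 1 / 2) * Real.log (|t| + 2) * (4 * D / η) *
        (1 / ‖(σ + t * Complex.I : ℂ)‖ ^ 2) := by
        field_simp
    _ ≤ C / (σ - 1 / 2) * Real.log (|t| + 2) * (4 * D / η) * (4 / (1 + t ^ 2)) := by
        gcongr ?_ * ?_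
        rw [hsq, div_le_div_iff₀ (by positivity) (by positivity)]
        nlinarith [sq_nonneg t]
    _ = _ := by ring

lemma integrable_dilationDensity (hRH : RiemannHypothesis) {η σ l : ℝ} (hη : 0 < η) (hη1 : η ≤ 1)
    (h1 : 1 / 2 < σ) (h2 : σ ≤ 1) (hl : 0 < l) (hl1 : l ≤ 1) :
    MeasureTheory.Integrable (dilationDensity η σ l) :=
  integrable_zetaDensity_mul hRH hη hη1 h1 h2
    (continuous_const.mul (continuous_expSlope_line hl (by linarith)))
    (norm_mul_expSlope_le_div hl hl1 (by linarith) h2)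

lemma exists_unitMass_dilationDensity_le (hRH : RiemannHypothesis) :
    ∃ C : ℝ, 0 < C ∧ ∀ η σ l θ : ℝ, 0 < η → η ≤ 1 → 1 / 2 < σ → σ ≤ 1 → 0 < l → l ≤ 1 → l ≤ θ →
    ∀ x, unitMass (fun t => ‖dilationDensity η σ l t‖ₑ) x ≤
      ENNReal.ofReal (C * (θ / (1 + θ * |x|) * Real.log (|x| + 2))) := by
  obtain ⟨C, hC, hG⟩ := exists_integral_re_zetaG_le hRH
  refine ⟨28 * (4 * C), by positivity, fun η σ l θ hη hη1 h1 h2 hl hl1 hlθ x => ?_⟩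
  have h0 : 0 < σ := by linarith
  have hθ : 0 < θ := hl.trans_le hlθ
  have hx0 := abs_nonneg x
  have hpt : ∀ t ∈ Set.Icc x (x + 1), ‖dilationDensity η σ l t‖ ≤
      112 * (θ / (1 + θ * |x|)) * |(zetaG (σ + t * Complex.I)).re| := by
    intro t ht
    have hw := norm_pos_iff.2 (add_mul_I_ne_zero h0 t)
    have hre : ‖(((1 / Real.pi) * (zetaG (σ + t * Complex.I)).re : ℝ) : ℂ)‖ ≤
        |(zetaG (σ + t * Complex.I)).re| := by
      rw [Complex.norm_real, norm_mul, Real.norm_of_nonneg (by positivity), Real.norm_eq_abs]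
      have hpi : 1 / Real.pi ≤ 1 := by
        rw [div_le_one Real.pi_pos]; linarith [Real.pi_gt_three]
      calc _ ≤ 1 * |(zetaG (σ + t * Complex.I)).re| := by gcongr
        _ = _ := one_mul _
    have he := norm_expSlope_le hη hη1 (w := σ + t * Complex.I) (by simpa using h2)
    have hm : ‖(l : ℂ) * expSlope l (σ + t * Complex.I)‖ ≤ 28 * (θ / (1 + θ * |x|)) := by
      set m := ‖(l : ℂ) * expSlope l (σ + t * Complex.I)‖
      have hm1 : m ≤ 4 * θ := (norm_mul_expSlope_le hl hl1 h2 t).trans (by linarith)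
      have hm2 : m * ‖(σ + t * Complex.I : ℂ)‖ ≤ 4 :=
        (le_div_iff₀ hw).1 (norm_mul_expSlope_le_div hl hl1 h0 h2 t)
      have hm0 : 0 ≤ m := norm_nonneg _
      have hn1 : 1 / 2 ≤ ‖(σ + t * Complex.I : ℂ)‖ := by
        have := Complex.abs_re_le_norm (σ + t * Complex.I)
        simp only [re_add_mul_I, abs_of_pos h0] at this
        linarith
      have hn2 : |t| ≤ ‖(σ + t * Complex.I : ℂ)‖ := by
        simpa using Complex.abs_im_le_norm (σ + t * Complex.I)
      have hxt : |x| ≤ |t| + 1 := by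
        have : |x - t| ≤ 1 := abs_le.2 ⟨by linarith [ht.2], by linarith [ht.1]⟩
        linarith [abs_sub_abs_le_abs_sub x t]
      have hm3 : m * |x| ≤ 12 := by nlinarith
      rw [← mul_div_assoc, le_div_iff₀ (by positivity)]
      nlinarith
    rw [dilationDensity, zetaDensity, norm_mul, norm_mul]
    calc _ ≤ |(zetaG (σ + t * Complex.I)).re| * 4 * (28 * (θ / (1 + θ * |x|))) := by gcongr
      _ = _ := by ring
  have hcont : Continuous fun t : ℝ => |(zetaG (σ + t * Complex.I)).re| :=
    (Complex.continuous_re.comp (continuous_zetaG_line hRH h1)).abs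
  set c := 112 * (θ / (1 + θ * |x|)) with hc
  have hc0 : 0 ≤ c := by positivity
  calc unitMass (fun t => ‖dilationDensity η σ l t‖ₑ) x
      ≤ ∫⁻ t in Set.Icc x (x + 1), ENNReal.ofReal (c * |(zetaG (σ + t * Complex.I)).re|) := by
        refine MeasureTheory.setLIntegral_mono
          (ENNReal.measurable_ofReal.comp (continuous_const.mul hcont).measurable) fun t ht => ?_
        rw [← ofReal_norm]
        exact ENNReal.ofReal_le_ofReal (hpt t ht)
    _ = ENNReal.ofReal (∫ t in Set.Icc x (x + 1), c * |(zetaG (σ + t * Complex.I)).re|) := by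
        have hi : MeasureTheory.IntegrableOn
            (fun t : ℝ => c * |(zetaG (σ + t * Complex.I)).re|) (Set.Icc x (x + 1)) :=
          (continuous_const.mul hcont).integrableOn_Icc
        rw [MeasureTheory.ofReal_integral_eq_lintegral_ofReal hi
          (Eventually.of_forall fun t => by positivity)]
    _ ≤ _ := by
        refine ENNReal.ofReal_le_ofReal ?_
        rw [MeasureTheory.integral_const_mul, MeasureTheory.integral_Icc_eq_integral_Ioc,
          ← intervalIntegral.integral_of_le (by linarith)]
        calc _ ≤ c * (C * Real.log (|x| + 2)) := by
              gcongr
              exact hG σ h1 (by linarith) x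
          _ = _ := by rw [hc]; ring

lemma log_two_add_inv_pos {θ : ℝ} (hθ : 0 < θ) : 1 / 2 < Real.log (2 + 1 / θ) := by
  have := Real.log_two_gt_d9
  have h : Real.log 2 ≤ Real.log (2 + 1 / θ) := Real.log_le_log (by norm_num) (by
    have : 0 < 1 / θ := by positivity
    linarith)
  linarith

lemma log_abs_add_two_le_mul {θ : ℝ} (hθ : 0 < θ) (x : ℝ) : Real.log (|x| + 2) ≤
    9 * (Real.log (2 + 1 / θ) * (1 + θ * |x|) ^ ((1 : ℝ) / 4)) := by
  have hx := abs_nonneg x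
  have hL := log_two_add_inv_pos hθ
  have hy : 1 ≤ (1 + θ * |x|) ^ ((1 : ℝ) / 4) := Real.one_le_rpow (by nlinarith) (by norm_num)
  have h1 : Real.log (1 + θ * |x|) ≤ 4 * (1 + θ * |x|) ^ ((1 : ℝ) / 4) := by
    have := Real.log_le_rpow_div (x := 1 + θ * |x|) (ε := 1 / 4) (by positivity) (by norm_num)
    linarith
  have h2 : Real.log (|x| + 2) ≤ Real.log (2 + 1 / θ) + Real.log (1 + θ * |x|) := by
    rw [← Real.log_mul (by positivity) (by positivity)]
    refine Real.log_le_log (by positivity) ?_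
    have : (2 + 1 / θ) * (1 + θ * |x|) = 2 + 1 / θ + 2 * (θ * |x|) + |x| := by
      field_simp
      ring
    rw [this]
    have : 0 < 1 / θ := by positivity
    nlinarith [mul_nonneg hθ.le hx]
  nlinarith

theorem exists_lintegral_unitMass_sq_le (hRH : RiemannHypothesis) :
    ∃ C : ℝ, 0 < C ∧ ∀ η σ l θ : ℝ, 0 < η → η ≤ 1 → 1 / 2 < σ → σ ≤ 1 → 0 < l → l ≤ 1 → l ≤ θ →
    ∫⁻ x, unitMass (fun t => ‖dilationDensity η σ l t‖ₑ) x ^ 2 ≤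
      ENNReal.ofReal (C * (θ * Real.log (2 + 1 / θ) ^ 2)) := by
  obtain ⟨C, hC, hM⟩ := exists_unitMass_dilationDensity_le hRH
  set g : ℝ → ℝ := fun y => (1 + ‖y‖) ^ (-(3 / 2 : ℝ)) with hg
  have hgi : MeasureTheory.Integrable g := integrable_one_add_norm (by simp; norm_num)
  have hg0 : ∀ y, 0 ≤ g y := fun y => by positivity
  set J := ∫ y, g y
  have hJ : 0 ≤ J := MeasureTheory.integral_nonneg hg0
  refine ⟨(9 * C) ^ 2 * (J + 1), by positivity, fun η σ l θ hη hη1 h1 h2 hl hl1 hlθ => ?_⟩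
  have hθ : 0 < θ := hl.trans_le hlθ
  set L := Real.log (2 + 1 / θ)
  have hL : 1 / 2 < L := log_two_add_inv_pos hθ
  have hpt : ∀ x, unitMass (fun t => ‖dilationDensity η σ l t‖ₑ) x ^ 2 ≤
      ENNReal.ofReal ((9 * C) ^ 2 * (θ * L) ^ 2 * g (θ * x)) := by
    intro x
    have hx := abs_nonneg x
    have hy : 0 < 1 + θ * |x| := by positivity
    calc _ ≤ (ENNReal.ofReal (C * (θ / (1 + θ * |x|) * Real.log (|x| + 2)))) ^ 2 := by
          gcongr
          exact hM η σ l θ hη hη1 h1 h2 hl hl1 hlθ x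
      _ ≤ (ENNReal.ofReal (C * (θ / (1 + θ * |x|) *
          (9 * (L * (1 + θ * |x|) ^ ((1 : ℝ) / 4)))))) ^ 2 := by
          gcongr
          exact log_abs_add_two_le_mul hθ x
      _ = _ := by
          rw [← ENNReal.ofReal_pow (by positivity)]
          congr 1
          have e : g (θ * x) = ((1 + θ * |x|) ^ ((1 : ℝ) / 4)) ^ 2 / (1 + θ * |x|) ^ 2 := by
            rw [hg]
            simp only [norm_mul, Real.norm_eq_abs, abs_of_pos hθ]
            rw [← Real.rpow_natCast, ← Real.rpow_natCast, ← Real.rpow_mul hy.le,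
              ← Real.rpow_sub hy]
            norm_num
          rw [e]
          field_simp
  calc _ ≤ ∫⁻ x, ENNReal.ofReal ((9 * C) ^ 2 * (θ * L) ^ 2 * g (θ * x)) :=
        MeasureTheory.lintegral_mono hpt
    _ = ENNReal.ofReal (∫ x, (9 * C) ^ 2 * (θ * L) ^ 2 * g (θ * x)) := by
        rw [MeasureTheory.ofReal_integral_eq_lintegral_ofReal
          ((hgi.comp_mul_left' hθ.ne').const_mul _)
          (Eventually.of_forall fun t => mul_nonneg (by positivity) (hg0 _))]
    _ ≤ _ := by
        refine ENNReal.ofReal_le_ofReal ?_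
        rw [MeasureTheory.integral_const_mul, MeasureTheory.Measure.integral_comp_mul_left,
          abs_of_pos (by positivity), smul_eq_mul]
        calc _ = (9 * C) ^ 2 * J * (θ * L ^ 2) := by field_simp; rfl
          _ ≤ (9 * C) ^ 2 * (J + 1) * (θ * L ^ 2) := by gcongr; linarith

/-- The error term of the smoothed explicit formula for `∑ Λ(n)` over `1 < n ≤ exp X`. -/
noncomputable def smoothError (η X : ℝ) : ℂ :=
  ((∑ n ∈ range (⌊Real.exp (X + η)⌋₊ + 1),
    ArithmeticFunction.vonMangoldt n * trapezoid η X (Real.log n) : ℝ) : ℂ) -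
    expSlope η 1 * (Complex.exp X - 1)

lemma norm_exp_ofReal_mul (X σ t : ℝ) :
    ‖Complex.exp (X * (σ + t * Complex.I))‖ = Real.exp (X * σ) := by
  rw [Complex.norm_exp]
  simp

lemma smoothError_add_sub (hRH : RiemannHypothesis) {η X σ l : ℝ} (hη : 0 < η)
    (hη1 : η ≤ 1) (hX : 0 ≤ X) (h1 : 1 / 2 < σ) (h2 : σ ≤ 1) (hl : 0 < l) :
    smoothError η (X + l) - smoothError η X =
      Real.exp (X * σ) * expIntegral (dilationDensity η σ l) (-X) := by
  have h0 : 0 < σ := by linarith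
  have hi : ∀ Z : ℝ, MeasureTheory.Integrable fun t : ℝ => zetaDensity η σ t *
      ((Complex.exp (Z * (σ + t * Complex.I)) - 1) / (σ + t * Complex.I)) := by
    intro Z
    refine integrable_zetaDensity_mul (D := Real.exp (Z * σ) + 1) hRH hη hη1 h1 h2
      (Continuous.div (by fun_prop) (by fun_prop) (add_mul_I_ne_zero h0)) fun t => ?_
    rw [norm_div]
    gcongr
    refine (norm_sub_le _ _).trans ?_
    rw [norm_exp_ofReal_mul, norm_one]
  rw [smoothError, smoothError, sum_vonMangoldt_trapezoid hRH hη hη1 (by positivity) h1 h2,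
    sum_vonMangoldt_trapezoid hRH hη hη1 hX h1 h2, ← MeasureTheory.integral_sub (hi _) (hi _),
    expIntegral, ← MeasureTheory.integral_const_mul]
  refine MeasureTheory.integral_congr_ae (Eventually.of_forall fun t => ?_)
  have hw := add_mul_I_ne_zero h0 t
  have hl' : (l : ℂ) ≠ 0 := by exact_mod_cast hl.ne'
  have e1 : Complex.exp ((X + l : ℝ) * (σ + t * Complex.I)) =
      Complex.exp (X * (σ + t * Complex.I)) * Complex.exp (l * (σ + t * Complex.I)) := by
    rw [← Complex.exp_add]; congr 1; push_cast; ring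
  have e2 : Complex.exp (X * (σ + t * Complex.I)) =
      (Real.exp (X * σ) : ℂ) * Complex.exp (-(t * -X : ℝ) * Complex.I) := by
    rw [Complex.ofReal_exp, ← Complex.exp_add]; congr 1; push_cast; ring
  simp only [dilationDensity, expSlope]
  rw [e1, e2]
  field_simp
  ring

/-- The prime number theorem error `ψ(√u) - √u`. -/
noncomputable def psiError (u : ℝ) : ℝ := Chebyshev.psi √u - √u

lemma measurable_psiError : Measurable psiError :=
  (Chebyshev.psi_mono.measurable.comp Real.continuous_sqrt.measurable).sub
    Real.continuous_sqrt.measurable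

lemma tendsto_expSlope_one : Tendsto (fun n : ℕ => expSlope (1 / ((n : ℝ) + 1)) 1) atTop (nhds 1) := by
  have h1 : Tendsto (fun n : ℕ => ((1 / ((n : ℝ) + 1) : ℝ) : ℂ)) atTop (nhdsWithin 0 {0}ᶜ) := by
    refine tendsto_nhdsWithin_iff.2 ⟨?_, Eventually.of_forall fun n => ?_⟩
    · exact_mod_cast (Complex.continuous_ofReal.tendsto 0).comp
        (tendsto_one_div_add_atTop_nhds_zero_nat (𝕜 := ℝ))
    · have : (0 : ℝ) < 1 / ((n : ℝ) + 1) := by positivity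
      simpa using (by positivity : ((n : ℝ) + 1) ≠ 0) |> fun h => by exact_mod_cast h
  have h2 := (Complex.hasDerivAt_exp 0).tendsto_slope
  rw [Complex.exp_zero] at h2
  refine (h2.comp h1).congr fun n => ?_
  simp [slope_def_field, expSlope]

lemma tendsto_smoothError {X : ℝ} (hX : 0 ≤ X) :
    Tendsto (fun n : ℕ => smoothError (1 / ((n : ℝ) + 1)) X) atTop
      (nhds ((Chebyshev.psi (Real.exp X) - Real.exp X + 1 : ℝ) : ℂ)) := by
  have hη0 : ∀ n : ℕ, (0 : ℝ) < 1 / ((n : ℝ) + 1) := fun n => by positivity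
  have hη1 : ∀ n : ℕ, 1 / ((n : ℝ) + 1) ≤ 1 := fun n => by
    rw [div_le_one (by positivity)]; linarith [Nat.cast_nonneg (α := ℝ) n]
  have hη := tendsto_one_div_add_atTop_nhds_zero_nat (𝕜 := ℝ)
  set K := range (⌊Real.exp (X + 1)⌋₊ + 1)
  have e1 : ∀ n : ℕ, ∑ m ∈ range (⌊Real.exp (X + 1 / ((n : ℝ) + 1))⌋₊ + 1),
      ArithmeticFunction.vonMangoldt m * trapezoid (1 / ((n : ℝ) + 1)) X (Real.log m) =
      ∑ m ∈ K, ArithmeticFunction.vonMangoldt m *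
        trapezoid (1 / ((n : ℝ) + 1)) X (Real.log m) := by
    intro n
    refine sum_subset (range_subset_range.2 ?_) fun m _ hm' => ?_
    · gcongr
      exact hη1 n
    · rw [mem_range, not_lt, Nat.succ_le_iff, Nat.floor_lt (Real.exp_pos _).le] at hm'
      have hm0 : (0 : ℝ) < m := (Real.exp_pos _).trans hm'
      rw [trapezoid_of_le (hη0 n).le hX, mul_zero]
      exact ((Real.lt_log_iff_exp_lt hm0).2 hm').le
  have e2 : Chebyshev.psi (Real.exp X) =
      ∑ m ∈ K, ArithmeticFunction.vonMangoldt m * (if Real.log m ≤ X then 1 else 0) := by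
    rw [Chebyshev.psi]
    simp_rw [mul_ite, mul_one, mul_zero]
    rw [← sum_filter]
    refine sum_subset_zero_on_sdiff (fun m hm => ?_) (fun m hm => ?_) fun _ _ => rfl
    · rw [mem_Ioc, Nat.le_floor_iff (Real.exp_pos _).le] at hm
      have hm0 : (0 : ℝ) < m := by exact_mod_cast hm.1
      rw [mem_filter, mem_range, Nat.lt_succ_iff, Nat.le_floor_iff (Real.exp_pos _).le,
        Real.log_le_iff_le_exp hm0]
      exact ⟨hm.2.trans (Real.exp_le_exp.2 (by linarith)), hm.2⟩
    · rw [Finset.mem_sdiff, mem_filter, mem_Ioc, Nat.le_floor_iff (Real.exp_pos _).le] at hm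
      rcases Nat.eq_zero_or_pos m with rfl | hm0
      · simp
      · exact absurd ⟨hm0, (Real.log_le_iff_le_exp (by exact_mod_cast hm0)).1 hm.1.2⟩ hm.2
  have e3 : Tendsto (fun n : ℕ => ∑ m ∈ K, ArithmeticFunction.vonMangoldt m *
      trapezoid (1 / ((n : ℝ) + 1)) X (Real.log m)) atTop
      (nhds (Chebyshev.psi (Real.exp X))) := by
    rw [e2]
    refine tendsto_finsetSum _ fun m _ => ?_
    rcases Nat.lt_or_ge m 2 with hm | hm
    · interval_cases m <;> simp
    refine Tendsto.const_mul _ ?_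
    have hlog : 0 < Real.log m := Real.log_pos (by exact_mod_cast hm)
    split_ifs with h
    · refine tendsto_const_nhds.congr' ?_
      filter_upwards [hη.eventually_lt_const hlog] with n hn
      rw [trapezoid_of_mem (hη0 n) hn.le h]
    · refine tendsto_const_nhds.congr' ?_
      filter_upwards [hη.eventually_lt_const (sub_pos.2 (not_le.1 h))] with n hn
      rw [trapezoid_of_le (hη0 n).le hX (by linarith)]
  have e4 := (Complex.continuous_ofReal.tendsto _).comp e3
  have e5 := e4.sub (tendsto_expSlope_one.mul_const (Complex.exp X - 1))
  have e6 : ((Chebyshev.psi (Real.exp X) - Real.exp X + 1 : ℝ) : ℂ) =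
      (Chebyshev.psi (Real.exp X) : ℂ) - 1 * (Complex.exp X - 1) := by
    push_cast; ring
  rw [e6]
  refine e5.congr fun n => ?_
  simp only [smoothError, Function.comp_apply, e1 n]

lemma exists_lintegral_smoothError_le (hRH : RiemannHypothesis) :
    ∃ C : NNReal, ∀ η σ θ Y : ℝ, 0 < η → η ≤ 1 → 1 / 2 < σ → σ ≤ 1 → 0 < θ → θ ≤ 3 → 1 ≤ Y →
    ∫⁻ u in Set.Ioc 1 Y, ‖Real.exp (Real.log u / 2 * σ) *
      expIntegral (dilationDensity η σ (Real.log (1 + θ) / 2)) (-(Real.log u / 2))‖ₑ ^ 2 ≤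
    C * ENNReal.ofReal (Y ^ (1 + σ) * (θ * Real.log (2 + 1 / θ) ^ 2)) := by
  obtain ⟨C₁, hC₁⟩ := exists_lintegral_enorm_sq_le
  obtain ⟨C₂, hC₂, hU⟩ := exists_lintegral_unitMass_sq_le hRH
  refine ⟨C₁ * C₂.toNNReal, fun η σ θ Y hη hη1 h1 h2 hθ hθ3 hY => ?_⟩
  set l := Real.log (1 + θ) / 2 with hl
  have hl0 : 0 < l := by
    have := Real.log_pos (show 1 < 1 + θ by linarith)
    positivity
  have hlθ : l ≤ θ := by
    have := Real.log_le_sub_one_of_pos (show 0 < 1 + θ by linarith)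
    rw [hl]; linarith
  have hl1 : l ≤ 1 := by
    have h4 : Real.log (1 + θ) ≤ Real.log (2 ^ 2) := Real.log_le_log (by linarith) (by linarith)
    rw [Real.log_pow] at h4
    have := Real.log_two_lt_d9
    push_cast at h4
    rw [hl]; linarith
  have hf := integrable_dilationDensity hRH hη hη1 h1 h2 hl0 hl1
  have hY0 : 0 < Y := by linarith
  have h3 := hC₁ _ (continuous_dilationDensity hRH hη h1 hl0) hf Y hY0
  have h4 := hU η σ l θ hη hη1 h1 h2 hl0 hl1 hlθ
  have hexp : ∀ u : ℝ, ∫ t : ℝ, dilationDensity η σ l t *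
      Complex.exp ((t * Real.log u / 2 : ℝ) * Complex.I) =
      expIntegral (dilationDensity η σ l) (-(Real.log u / 2)) := by
    intro u
    rw [expIntegral]
    congr 1
    ext t
    congr 3
    push_cast
    ring
  simp_rw [hexp] at h3
  have hm : Measurable fun u : ℝ =>
      ‖expIntegral (dilationDensity η σ l) (-(Real.log u / 2))‖ₑ ^ 2 :=
    ((continuous_expIntegral hf).enorm.measurable.comp
      (Real.measurable_log.div_const 2).neg).pow_const 2
  calc _ ≤ ∫⁻ u in Set.Ioc 1 Y, ENNReal.ofReal (Y ^ σ) *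
        ‖expIntegral (dilationDensity η σ l) (-(Real.log u / 2))‖ₑ ^ 2 := by
        refine MeasureTheory.setLIntegral_mono (hm.const_mul _) fun u hu => ?_
        have hu0 : 0 < u := by linarith [hu.1]
        rw [enorm_mul, mul_pow]
        gcongr ?_ * _
        rw [← ofReal_norm, ← ENNReal.ofReal_pow (norm_nonneg _), Complex.norm_real,
          Real.norm_of_nonneg (Real.exp_pos _).le, ← Real.exp_nat_mul]
        refine ENNReal.ofReal_le_ofReal ?_
        rw [Real.rpow_def_of_pos hY0]
        refine Real.exp_le_exp.2 ?_
        have := Real.log_le_log hu0 hu.2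
        push_cast
        nlinarith
    _ = ENNReal.ofReal (Y ^ σ) * ∫⁻ u in Set.Ioc 1 Y,
        ‖expIntegral (dilationDensity η σ l) (-(Real.log u / 2))‖ₑ ^ 2 :=
        MeasureTheory.lintegral_const_mul _ hm
    _ ≤ ENNReal.ofReal (Y ^ σ) * ∫⁻ u in Set.Ioc 0 Y,
        ‖expIntegral (dilationDensity η σ l) (-(Real.log u / 2))‖ₑ ^ 2 := by
        gcongr
        exact zero_le_one
    _ ≤ ENNReal.ofReal (Y ^ σ) * (C₁ * (ENNReal.ofReal Y *
        ENNReal.ofReal (C₂ * (θ * Real.log (2 + 1 / θ) ^ 2)))) := by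
        gcongr
        exact h3.trans (by gcongr)
    _ = _ := by
        rw [add_comm 1 σ, Real.rpow_add_one hY0.ne', ENNReal.coe_mul,
          ENNReal.ofReal_mul hC₂.le, ENNReal.ofReal_mul (p := Y ^ σ * Y) (by positivity),
          ENNReal.ofReal_mul (p := Y ^ σ) (by positivity)]
        change _ = C₁ * ENNReal.ofReal C₂ * _
        ring

theorem exists_lintegral_psiError_dilation_le (hRH : RiemannHypothesis) :
    ∃ C : NNReal, ∀ θ Y : ℝ, 0 < θ → θ ≤ 3 → 1 ≤ Y →
    ∫⁻ u in Set.Ioc 1 Y, ‖psiError ((1 + θ) * u) - psiError u‖ₑ ^ 2 ≤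
    C * ENNReal.ofReal (Y ^ ((3 : ℝ) / 2) * (θ * Real.log (2 + 1 / θ) ^ 2)) := by
  obtain ⟨C, hC⟩ := exists_lintegral_smoothError_le hRH
  refine ⟨C, fun θ Y hθ hθ3 hY => ?_⟩
  have hY0 : 0 < Y := by linarith
  have hη0 : ∀ n : ℕ, (0 : ℝ) < 1 / ((n : ℝ) + 1) := fun n => by positivity
  have hη1 : ∀ n : ℕ, 1 / ((n : ℝ) + 1) ≤ 1 := fun n => by
    rw [div_le_one (by positivity)]; linarith [Nat.cast_nonneg (α := ℝ) n]
  have hl0 : 0 < Real.log (1 + θ) / 2 := by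
    have := Real.log_pos (show 1 < 1 + θ by linarith)
    positivity
  have hl1 : Real.log (1 + θ) / 2 ≤ 1 := by
    have h4 : Real.log (1 + θ) ≤ Real.log (2 ^ 2) := Real.log_le_log (by linarith) (by linarith)
    rw [Real.log_pow] at h4
    have := Real.log_two_lt_d9
    push_cast at h4
    linarith
  have key : ∀ σ : ℝ, 1 / 2 < σ → σ ≤ 1 →
      ∫⁻ u in Set.Ioc 1 Y, ‖psiError ((1 + θ) * u) - psiError u‖ₑ ^ 2 ≤
      C * ENNReal.ofReal (Y ^ (1 + σ) * (θ * Real.log (2 + 1 / θ) ^ 2)) := by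
    intro σ h1 h2
    set g : ℕ → ℝ → ENNReal := fun n u => ‖Real.exp (Real.log u / 2 * σ) *
      expIntegral (dilationDensity (1 / ((n : ℝ) + 1)) σ (Real.log (1 + θ) / 2))
        (-(Real.log u / 2))‖ₑ ^ 2 with hg
    have hgm : ∀ n, Measurable (g n) := by
      intro n
      have hf := integrable_dilationDensity hRH (hη0 n) (hη1 n) h1 h2 hl0 hl1
      refine Measurable.pow_const (Measurable.enorm (Measurable.mul ?_ ?_)) 2
      · exact Complex.measurable_ofReal.comp
          (Real.measurable_exp.comp ((Real.measurable_log.div_const 2).mul_const σ))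
      · exact (continuous_expIntegral hf).measurable.comp (Real.measurable_log.div_const 2).neg
    calc _ ≤ ∫⁻ u in Set.Ioc 1 Y, liminf (fun n => g n u) atTop := by
          refine MeasureTheory.setLIntegral_mono (Measurable.liminf hgm) fun u hu => le_of_eq ?_
          have hu0 : 0 < u := by linarith [hu.1]
          have hX : 0 ≤ Real.log u / 2 := by
            have := Real.log_nonneg hu.1.le
            positivity
          have e : ∀ v : ℝ, 0 < v → Real.exp (Real.log v / 2) = √v := fun v hv => by
            rw [Real.exp_half, Real.exp_log hv]
          have e' : Real.exp (Real.log u / 2 + Real.log (1 + θ) / 2) = √((1 + θ) * u) := by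
            rw [← e _ (by positivity), Real.log_mul (by positivity) hu0.ne']
            congr 1; ring
          have hlim := (tendsto_smoothError (add_nonneg hX hl0.le)).sub (tendsto_smoothError hX)
          rw [e', e u hu0] at hlim
          have hlim2 : Tendsto (fun n => g n u) atTop
              (nhds (‖psiError ((1 + θ) * u) - psiError u‖ₑ ^ 2)) := by
            have h5 := ((ENNReal.continuous_pow 2).tendsto _).comp
              ((continuous_enorm.tendsto _).comp hlim)
            have e6 : ‖psiError ((1 + θ) * u) - psiError u‖ₑ =
                ‖((Chebyshev.psi √((1 + θ) * u) - √((1 + θ) * u) + 1 : ℝ) : ℂ) -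
                  ((Chebyshev.psi √u - √u + 1 : ℝ) : ℂ)‖ₑ := by
              rw [← Complex.ofReal_sub, ← ofReal_norm, ← ofReal_norm, Complex.norm_real]
              congr 2
              rw [psiError, psiError]
              ring
            rw [e6]
            refine h5.congr fun n => ?_
            simp only [Function.comp_apply, hg]
            rw [smoothError_add_sub hRH (hη0 n) (hη1 n) hX h1 h2 hl0]
          exact hlim2.liminf_eq.symm
      _ ≤ liminf (fun n => ∫⁻ u in Set.Ioc 1 Y, g n u) atTop :=
          MeasureTheory.lintegral_liminf_le hgm
      _ ≤ liminf (fun _ : ℕ => C * ENNReal.ofReal (Y ^ (1 + σ) *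
          (θ * Real.log (2 + 1 / θ) ^ 2))) atTop :=
          liminf_le_liminf (Eventually.of_forall fun n =>
            hC _ σ θ Y (hη0 n) (hη1 n) h1 h2 hθ hθ3 hY)
      _ = _ := liminf_const _
  have hσ : Tendsto (fun σ : ℝ => (C : ENNReal) * ENNReal.ofReal (Y ^ (1 + σ) *
      (θ * Real.log (2 + 1 / θ) ^ 2))) (nhdsWithin (1 / 2) (Set.Ioi (1 / 2)))
      (nhds (C * ENNReal.ofReal (Y ^ ((3 : ℝ) / 2) * (θ * Real.log (2 + 1 / θ) ^ 2)))) := by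
    refine ENNReal.Tendsto.const_mul (ENNReal.tendsto_ofReal ?_) (Or.inr ENNReal.coe_ne_top)
    have hc : Continuous fun σ : ℝ => Y ^ (1 + σ) * (θ * Real.log (2 + 1 / θ) ^ 2) :=
      (Real.continuous_const_rpow hY0.ne' |>.comp (by fun_prop : Continuous fun σ : ℝ => 1 + σ)).mul
        continuous_const
    have h := (hc.tendsto (1 / 2)).mono_left
      (nhdsWithin_le_nhds (s := Set.Ioi (1 / 2)))
    convert h using 4
    norm_num
  refine ge_of_tendsto hσ ?_
  filter_upwards [Ioo_mem_nhdsGT (show (1 / 2 : ℝ) < 1 by norm_num)] with σ hσ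
  exact key σ hσ.1 hσ.2.le

lemma enorm_sq_eq_ofReal (x : ℝ) : ‖x‖ₑ ^ 2 = ENNReal.ofReal (x ^ 2) := by
  rw [← ofReal_norm, ← ENNReal.ofReal_pow (norm_nonneg _), Real.norm_eq_abs, sq_abs]

lemma enorm_sub_sq_le (a b c : ℝ) : ‖a - c‖ₑ ^ 2 ≤ 2 * ‖b - c‖ₑ ^ 2 + 2 * ‖b - a‖ₑ ^ 2 := by
  simp only [enorm_sq_eq_ofReal]
  rw [← ENNReal.ofReal_ofNat 2, ← ENNReal.ofReal_mul (by norm_num), ← ENNReal.ofReal_mul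
    (by norm_num), ← ENNReal.ofReal_add (by positivity) (by positivity)]
  refine ENNReal.ofReal_le_ofReal ?_
  nlinarith [sq_nonneg (b - c + (b - a))]

lemma lintegral_eq_mul_comp_mul_left (g : ℝ → ENNReal) {a : ℝ} (ha : 0 < a) :
    ∫⁻ x, g x = ENNReal.ofReal a * ∫⁻ x, g (a * x) := by
  have h := MeasureTheory.lintegral_map_equiv (μ := MeasureTheory.volume) g
    (Homeomorph.mulLeft₀ a ha.ne').toMeasurableEquiv
  conv_lhs => rw [← Real.smul_map_volume_mul_left ha.ne', abs_of_pos ha]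
  rw [MeasureTheory.lintegral_smul_measure, smul_eq_mul]
  congr 1

lemma abs_psiError_le (u : ℝ) : |psiError u| ≤ 6 * √u := by
  have h0 := Real.sqrt_nonneg u
  have h1 := Chebyshev.psi_nonneg √u
  have h2 := Chebyshev.psi_le_const_mul_self h0
  have h3 : Real.log 4 ≤ 2 := by
    rw [show (4 : ℝ) = 2 ^ 2 by norm_num, Real.log_pow]
    have := Real.log_two_lt_d9
    push_cast
    linarith
  rw [psiError, abs_le]
  constructor <;> nlinarith

lemma lintegral_psiError_sq_le_of_le {A Y : ℝ} (hY : 0 ≤ Y) (hA : Y ≤ A) :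
    ∫⁻ u in Set.Ioc 0 Y, ‖psiError u‖ₑ ^ 2 ≤ ENNReal.ofReal (36 * A * Y) := by
  calc _ ≤ ∫⁻ u in Set.Ioc 0 Y, ENNReal.ofReal (36 * A) := by
        refine MeasureTheory.setLIntegral_mono measurable_const fun u hu => ?_
        rw [enorm_sq_eq_ofReal]
        refine ENNReal.ofReal_le_ofReal ?_
        have h := abs_psiError_le u
        rw [← sq_abs]
        calc |psiError u| ^ 2 ≤ (6 * √u) ^ 2 := by gcongr
          _ = 36 * u := by rw [mul_pow, Real.sq_sqrt hu.1.le]; norm_num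
          _ ≤ _ := by linarith [hu.2]
    _ = _ := by
        rw [MeasureTheory.lintegral_const, MeasureTheory.Measure.restrict_apply_univ,
          Real.volume_Ioc, sub_zero, ENNReal.ofReal_mul (p := 36 * A) (by linarith)]

lemma exists_lintegral_psiError_four_mul_le (hRH : RiemannHypothesis) :
    ∃ C : NNReal, ∀ Y : ℝ, 1 ≤ Y → ∫⁻ u in Set.Ioc 0 (4 * Y), ‖psiError u‖ₑ ^ 2 ≤
      6 * (∫⁻ u in Set.Ioc 0 Y, ‖psiError u‖ₑ ^ 2) + C * ENNReal.ofReal (Y ^ ((3 : ℝ) / 2)) := by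
  obtain ⟨C, hC⟩ := exists_lintegral_psiError_dilation_le hRH
  set K : NNReal := (3 * Real.log (2 + 1 / 3) ^ 2).toNNReal
  set D : ENNReal := ∫⁻ u in Set.Ioc 0 1, ‖psiError (4 * u) - psiError u‖ₑ ^ 2
  have hD : D ≠ ⊤ := by
    refine ne_top_of_le_ne_top (b := ENNReal.ofReal 400) ENNReal.ofReal_ne_top ?_
    calc D ≤ ∫⁻ u in Set.Ioc (0 : ℝ) 1, ENNReal.ofReal 400 := by
          refine MeasureTheory.setLIntegral_mono measurable_const fun u hu => ?_
          rw [enorm_sq_eq_ofReal]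
          refine ENNReal.ofReal_le_ofReal ?_
          have h1 := abs_psiError_le u
          have h2 := abs_psiError_le (4 * u)
          have h3 : √u ≤ 1 := Real.sqrt_le_one.2 hu.2
          have h4 : √(4 * u) ≤ 2 := Real.sqrt_le_iff.2 ⟨by norm_num, by linarith [hu.2]⟩
          rw [← sq_abs, show (400 : ℝ) = 20 ^ 2 by norm_num]
          gcongr
          have := abs_sub (psiError (4 * u)) (psiError u)
          linarith
      _ = _ := by simp
  refine ⟨12 * (D.toNNReal + C * K), fun Y hY => ?_⟩
  have hm : Measurable fun u => ‖psiError (4 * u) - psiError u‖ₑ ^ 2 :=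
    ((measurable_psiError.comp (measurable_const_mul 4)).sub measurable_psiError).enorm.pow_const 2
  have hm' : Measurable fun u => ‖psiError u‖ₑ ^ 2 := measurable_psiError.enorm.pow_const 2
  have h1 := hC 3 Y (by norm_num) le_rfl hY
  have hY1 : 1 ≤ Y ^ ((3 : ℝ) / 2) := Real.one_le_rpow hY (by norm_num)
  have hd : ∫⁻ u in Set.Ioc 0 Y, ‖psiError (4 * u) - psiError u‖ₑ ^ 2 ≤
      (D.toNNReal + C * K : NNReal) * ENNReal.ofReal (Y ^ ((3 : ℝ) / 2)) := by
    rw [← Set.Ioc_union_Ioc_eq_Ioc zero_le_one hY]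
    refine (MeasureTheory.lintegral_union_le _ _ _).trans ?_
    rw [ENNReal.coe_add, add_mul, ENNReal.coe_toNNReal hD]
    gcongr ?_ + ?_
    · change D ≤ _
      calc D = D * 1 := (mul_one _).symm
        _ ≤ _ := by gcongr; exact ENNReal.one_le_ofReal.2 hY1
    · refine le_trans (le_of_eq ?_) (h1.trans (le_of_eq ?_))
      · norm_num
      · rw [ENNReal.ofReal_mul (by positivity), ENNReal.coe_mul]
        change _ = C * ENNReal.ofReal _ * _
        ring
  have hpt : ∀ a b : ℝ, 4 * ‖a‖ₑ ^ 2 ≤ 6 * ‖b‖ₑ ^ 2 + 12 * ‖a - b‖ₑ ^ 2 := by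
    intro a b
    simp only [enorm_sq_eq_ofReal]
    rw [← ENNReal.ofReal_ofNat 4, ← ENNReal.ofReal_ofNat 6, ← ENNReal.ofReal_ofNat 12,
      ← ENNReal.ofReal_mul (by norm_num), ← ENNReal.ofReal_mul (by norm_num),
      ← ENNReal.ofReal_mul (by norm_num), ← ENNReal.ofReal_add (by positivity) (by positivity)]
    refine ENNReal.ofReal_le_ofReal ?_
    nlinarith [sq_nonneg (2 * a - 3 * b)]
  calc ∫⁻ u in Set.Ioc 0 (4 * Y), ‖psiError u‖ₑ ^ 2
      = 4 * ∫⁻ u in Set.Ioc 0 Y, ‖psiError (4 * u)‖ₑ ^ 2 := by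
        rw [← MeasureTheory.lintegral_indicator measurableSet_Ioc,
          lintegral_eq_mul_comp_mul_left _ (show (0 : ℝ) < 4 by norm_num),
          ← MeasureTheory.lintegral_indicator measurableSet_Ioc, ENNReal.ofReal_ofNat]
        congr 2; ext u
        simp only [Set.indicator_apply, Set.mem_Ioc]
        congr 1
        simp
    _ = ∫⁻ u in Set.Ioc 0 Y, 4 * ‖psiError (4 * u)‖ₑ ^ 2 :=
        (MeasureTheory.lintegral_const_mul' _ _ (by norm_num)).symm
    _ ≤ ∫⁻ u in Set.Ioc 0 Y, (6 * ‖psiError u‖ₑ ^ 2 +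
        12 * ‖psiError (4 * u) - psiError u‖ₑ ^ 2) :=
        MeasureTheory.lintegral_mono fun u => hpt _ _
    _ = 6 * (∫⁻ u in Set.Ioc 0 Y, ‖psiError u‖ₑ ^ 2) +
        12 * ∫⁻ u in Set.Ioc 0 Y, ‖psiError (4 * u) - psiError u‖ₑ ^ 2 := by
        rw [MeasureTheory.lintegral_add_left (hm'.const_mul 6),
          MeasureTheory.lintegral_const_mul _ hm', MeasureTheory.lintegral_const_mul _ hm]
    _ ≤ _ := by
        rw [ENNReal.coe_mul, mul_assoc]
        gcongr
        norm_num

theorem exists_lintegral_psiError_sq_le (hRH : RiemannHypothesis) :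
    ∃ C : NNReal, ∀ Y : ℝ, 1 ≤ Y → ∫⁻ u in Set.Ioc 0 Y, ‖psiError u‖ₑ ^ 2 ≤
      C * ENNReal.ofReal (Y ^ ((3 : ℝ) / 2)) := by
  obtain ⟨C, hC⟩ := exists_lintegral_psiError_four_mul_le hRH
  set K : NNReal := (36 * 4 * 4 : ℝ).toNNReal + C
  have hind : ∀ n : ℕ, ∀ Y : ℝ, 1 ≤ Y → Y ≤ 4 ^ (n + 1) →
      ∫⁻ u in Set.Ioc 0 Y, ‖psiError u‖ₑ ^ 2 ≤ K * ENNReal.ofReal (Y ^ ((3 : ℝ) / 2)) := by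
    intro n
    induction n with
    | zero =>
      intro Y hY hY4
      have hY1 : 1 ≤ Y ^ ((3 : ℝ) / 2) := Real.one_le_rpow hY (by norm_num)
      calc _ ≤ ENNReal.ofReal (36 * 4 * Y) :=
            lintegral_psiError_sq_le_of_le (by linarith) (by simpa using hY4)
        _ ≤ ENNReal.ofReal (36 * 4 * 4) := ENNReal.ofReal_le_ofReal (by
            have : Y ≤ 4 := by simpa using hY4
            linarith)
        _ = ((36 * 4 * 4 : ℝ).toNNReal : ENNReal) * 1 := (mul_one _).symm
        _ ≤ _ := by
            gcongr
            · exact le_self_add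
            · exact ENNReal.one_le_ofReal.2 hY1
    | succ n ih =>
      intro Y hY hY4
      by_cases h4 : Y ≤ 4
      · exact ih Y hY (h4.trans (by rw [pow_succ]; nlinarith [one_le_pow₀ (a := (4 : ℝ)) (n := n) (by norm_num)]))
      have hY' : 1 ≤ Y / 4 := by linarith
      have h1 := hC (Y / 4) hY'
      have h2 := ih (Y / 4) hY' (by rw [pow_succ] at hY4; linarith)
      rw [mul_div_cancel₀ _ (by norm_num)] at h1
      have e : ENNReal.ofReal (Y ^ ((3 : ℝ) / 2)) =
          8 * ENNReal.ofReal ((Y / 4) ^ ((3 : ℝ) / 2)) := by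
        rw [← ENNReal.ofReal_ofNat 8, ← ENNReal.ofReal_mul (by norm_num)]
        congr 1
        rw [Real.div_rpow (by linarith) (by norm_num), show (4 : ℝ) = 2 ^ (2 : ℝ) by norm_num,
          ← Real.rpow_mul (by norm_num)]
        norm_num
        ring
      refine h1.trans ?_
      calc _ ≤ 6 * (K * ENNReal.ofReal ((Y / 4) ^ ((3 : ℝ) / 2))) +
            (2 * K) * ENNReal.ofReal ((Y / 4) ^ ((3 : ℝ) / 2)) := by
            gcongr
            calc (C : ENNReal) ≤ K := ENNReal.coe_le_coe.2 le_add_self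
              _ ≤ 2 * K := by rw [two_mul]; exact le_self_add
        _ = _ := by rw [e]; ring
  refine ⟨K, fun Y hY => ?_⟩
  obtain ⟨n, hn⟩ := pow_unbounded_of_one_lt Y (show (1 : ℝ) < 4 by norm_num)
  exact hind n Y hY (hn.le.trans (pow_le_pow_right₀ (by norm_num) (by omega)))

lemma lintegral_rpow_neg_le {c b : ℝ} (hc : 0 < c) :
    ∫⁻ θ in Set.Ioc c b, ENNReal.ofReal (θ ^ (-(3 / 2) : ℝ)) ≤
      ENNReal.ofReal (2 * c ^ (-(1 / 2) : ℝ)) := by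
  have hi := integrableOn_Ioi_rpow_of_lt (a := -(3 / 2)) (by norm_num) hc
  calc _ ≤ ∫⁻ θ in Set.Ioi c, ENNReal.ofReal (θ ^ (-(3 / 2) : ℝ)) :=
        MeasureTheory.lintegral_mono_set Set.Ioc_subset_Ioi_self
    _ = ENNReal.ofReal (∫ θ in Set.Ioi c, θ ^ (-(3 / 2) : ℝ)) := by
        rw [MeasureTheory.ofReal_integral_eq_lintegral_ofReal hi]
        filter_upwards [MeasureTheory.ae_restrict_mem measurableSet_Ioi] with θ hθ
        exact Real.rpow_nonneg (hc.le.trans (le_of_lt hθ)) _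
    _ = _ := by
        rw [integral_Ioi_rpow_of_lt (by norm_num) hc]
        congr 1
        norm_num
        ring

lemma lintegral_lintegral_shift_le {F : ℝ → ℝ → ENNReal} (hF : Measurable (Function.uncurry F))
    {h Y : ℝ} (hh : 0 < h) :
    ∫⁻ u in Set.Ioc h Y, ∫⁻ v in Set.Ioc h (3 * h), F u v ≤
      ∫⁻ θ in Set.Ioc (h / Y) 3, ENNReal.ofReal (3 * h / θ) *
        ∫⁻ u in Set.Ioc h (3 * h / θ), F u (θ * u) := by
  set G : ℝ → ℝ → ENNReal := fun u θ =>
    {p : ℝ × ℝ | (h < p.1 ∧ p.1 ≤ 3 * h / p.2) ∧ (h / Y < p.2 ∧ p.2 ≤ 3)}.indicator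
      (fun p => ENNReal.ofReal (3 * h / p.2) * F p.1 (p.2 * p.1)) (u, θ) with hG
  have hGm : Measurable (Function.uncurry G) := by
    refine Measurable.indicator (Measurable.mul ?_ ?_) ?_
    · exact ENNReal.measurable_ofReal.comp (measurable_const.div measurable_snd)
    · exact hF.comp (measurable_fst.prodMk (measurable_snd.mul measurable_fst))
    · exact ((measurableSet_lt measurable_const measurable_fst).inter
        (measurableSet_le measurable_fst (measurable_const.div measurable_snd))).inter
        ((measurableSet_lt measurable_const measurable_snd).inter
        (measurableSet_le measurable_snd measurable_const))
  calc _ ≤ ∫⁻ u in Set.Ioc h Y, ∫⁻ θ, G u θ := by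
        refine MeasureTheory.setLIntegral_mono hGm.lintegral_prod_right' fun u hu => ?_
        have hu0 : 0 < u := hh.trans hu.1
        rw [← MeasureTheory.lintegral_indicator measurableSet_Ioc,
          lintegral_eq_mul_comp_mul_left _ hu0,
          ← MeasureTheory.lintegral_const_mul' _ _ ENNReal.ofReal_ne_top]
        refine MeasureTheory.lintegral_mono fun θ => ?_
        by_cases hθ : u * θ ∈ Set.Ioc h (3 * h)
        · have hθ0 : 0 < θ := pos_of_mul_pos_right (hh.trans hθ.1) hu0.le
          have h1 : u ≤ 3 * h / θ := (le_div_iff₀ hθ0).2 hθ.2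
          have h2 : h / Y < θ := by
            rw [div_lt_iff₀ (hu0.trans_le hu.2)]
            nlinarith [hθ.1, hu.2]
          have h3 : θ ≤ 3 := by
            by_contra! h3
            nlinarith [hθ.2, hu.1]
          rw [Set.indicator_of_mem hθ, hG]
          simp only
          rw [Set.indicator_of_mem (by exact ⟨⟨hu.1, h1⟩, h2, h3⟩), mul_comm u θ]
          gcongr
        · rw [Set.indicator_of_notMem hθ, mul_zero]
          exact zero_le
    _ ≤ ∫⁻ u, ∫⁻ θ, G u θ := MeasureTheory.setLIntegral_le_lintegral _ _
    _ = ∫⁻ θ, ∫⁻ u, G u θ := MeasureTheory.lintegral_lintegral_swap hGm.aemeasurable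
    _ = _ := by
        rw [← MeasureTheory.lintegral_indicator measurableSet_Ioc]
        refine MeasureTheory.lintegral_congr fun θ => ?_
        by_cases hθ : θ ∈ Set.Ioc (h / Y) 3
        · rw [Set.indicator_of_mem hθ, ← MeasureTheory.lintegral_const_mul' _ _ ENNReal.ofReal_ne_top,
            ← MeasureTheory.lintegral_indicator measurableSet_Ioc]
          refine MeasureTheory.lintegral_congr fun u => ?_
          by_cases hu : u ∈ Set.Ioc h (3 * h / θ)
          · rw [Set.indicator_of_mem hu, hG]
            exact Set.indicator_of_mem (by exact ⟨hu, hθ⟩) _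
          · rw [Set.indicator_of_notMem hu, hG]
            exact Set.indicator_of_notMem (fun h' => hu h'.1) _
        · rw [Set.indicator_of_notMem hθ, ← MeasureTheory.lintegral_zero]
          refine MeasureTheory.lintegral_congr fun u => ?_
          exact Set.indicator_of_notMem (fun h' => hθ h'.2) _

lemma measurable_psiError_add_sub :
    Measurable (Function.uncurry fun u v : ℝ => ‖psiError (u + v) - psiError u‖ₑ ^ 2) :=
  ((measurable_psiError.comp (measurable_fst.add measurable_snd)).sub
    (measurable_psiError.comp measurable_fst)).enorm.pow_const 2

lemma exists_lintegral_psiError_add_sub_le (hRH : RiemannHypothesis) :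
    ∃ C : NNReal, ∀ h Y : ℝ, 1 ≤ h → h ≤ Y →
    ∫⁻ u in Set.Ioc h Y, ∫⁻ v in Set.Ioc h (3 * h), ‖psiError (u + v) - psiError u‖ₑ ^ 2 ≤
      C * ENNReal.ofReal (h ^ 2 * (√Y * Real.log (Y + 2) ^ 2)) := by
  obtain ⟨C, hC⟩ := exists_lintegral_psiError_dilation_le hRH
  refine ⟨C * (2 * (3 : ℝ) ^ ((5 : ℝ) / 2)).toNNReal, fun h Y hh hY => ?_⟩
  have hh0 : 0 < h := by linarith
  have hY0 : 0 < Y := by linarith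
  set L := Real.log (Y + 2)
  have hL : 0 < L := Real.log_pos (by linarith)
  refine (lintegral_lintegral_shift_le measurable_psiError_add_sub hh0).trans ?_
  calc _ ≤ ∫⁻ θ in Set.Ioc (h / Y) 3, C * ENNReal.ofReal ((3 * h) ^ ((5 : ℝ) / 2) * L ^ 2) *
        ENNReal.ofReal (θ ^ (-(3 / 2) : ℝ)) := by
        refine MeasureTheory.setLIntegral_mono (by fun_prop) fun θ hθ => ?_
        have hθ0 : 0 < θ := (div_pos hh0 hY0).trans hθ.1
        have h1 : 1 ≤ 3 * h / θ := by
          rw [le_div_iff₀ hθ0]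
          linarith [hθ.2]
        have h2 : ∫⁻ u in Set.Ioc h (3 * h / θ), ‖psiError (u + θ * u) - psiError u‖ₑ ^ 2 ≤
            C * ENNReal.ofReal ((3 * h / θ) ^ ((3 : ℝ) / 2) *
              (θ * Real.log (2 + 1 / θ) ^ 2)) := by
          refine le_trans ?_ (hC θ (3 * h / θ) hθ0 hθ.2 h1)
          simp_rw [show ∀ u : ℝ, (1 + θ) * u = u + θ * u from fun u => by ring]
          exact MeasureTheory.lintegral_mono_set (Set.Ioc_subset_Ioc_left hh)
        have hlog : Real.log (2 + 1 / θ) ≤ L := by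
          refine Real.log_le_log (by positivity) ?_
          have : 1 / θ ≤ Y := by
            rw [div_le_iff₀ hθ0]
            have := (div_lt_iff₀ hY0).1 hθ.1
            nlinarith
          linarith
        have hlog0 := (log_two_add_inv_pos hθ0)
        calc _ ≤ ENNReal.ofReal (3 * h / θ) * (C * ENNReal.ofReal ((3 * h / θ) ^ ((3 : ℝ) / 2) *
              (θ * L ^ 2))) := by
              gcongr _ * ?_
              refine h2.trans ?_
              gcongr
          _ = _ := by
              rw [mul_left_comm, ← ENNReal.ofReal_mul (by positivity), mul_assoc,
                ← ENNReal.ofReal_mul (by positivity)]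
              congr 2
              rw [Real.div_rpow (by positivity) hθ0.le, show (5 : ℝ) / 2 = 1 + 3 / 2 by norm_num,
                Real.rpow_add (by positivity), Real.rpow_one, Real.rpow_neg hθ0.le]
              field_simp
    _ = C * ENNReal.ofReal ((3 * h) ^ ((5 : ℝ) / 2) * L ^ 2) *
        ∫⁻ θ in Set.Ioc (h / Y) 3, ENNReal.ofReal (θ ^ (-(3 / 2) : ℝ)) :=
        MeasureTheory.lintegral_const_mul _ (by fun_prop)
    _ ≤ C * ENNReal.ofReal ((3 * h) ^ ((5 : ℝ) / 2) * L ^ 2) *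
        ENNReal.ofReal (2 * (h / Y) ^ (-(1 / 2) : ℝ)) := by
        gcongr
        exact lintegral_rpow_neg_le (by positivity)
    _ = _ := by
        have hcoe : ((2 * (3 : ℝ) ^ ((5 : ℝ) / 2)).toNNReal : ENNReal) =
          ENNReal.ofReal (2 * (3 : ℝ) ^ ((5 : ℝ) / 2)) := rfl
        rw [mul_assoc, ← ENNReal.ofReal_mul (by positivity), ENNReal.coe_mul, hcoe,
          mul_assoc (C : ENNReal), ← ENNReal.ofReal_mul (by positivity)]
        congr 2
        rw [Real.rpow_neg (by positivity), Real.div_rpow hh0.le hY0.le,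
          Real.mul_rpow (by norm_num) hh0.le, show (5 : ℝ) / 2 = 2 + 1 / 2 by norm_num,
          Real.rpow_add hh0, Real.sqrt_eq_rpow, Real.rpow_two]
        have := Real.rpow_pos_of_pos hh0 (1 / 2)
        have := Real.rpow_pos_of_pos hY0 (1 / 2)
        field_simp

lemma mul_lintegral_diagonal_le {F : ℝ → ℝ → ENNReal} (hFm : Measurable (Function.uncurry F))
    {h X : ℝ} (hh0 : 0 < h) (hX : h ≤ X)
    (hF : ∀ u v, F u h ≤ 2 * F u v + 2 * F (u + h) (v - h)) :
    ENNReal.ofReal h * ∫⁻ u in Set.Ioc h X, F u h ≤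
      4 * ∫⁻ u in Set.Ioc h (2 * X), ∫⁻ v in Set.Ioc h (3 * h), F u v := by
  have hFv : ∀ u, Measurable (F u) := fun u => hFm.comp measurable_prodMk_left
  have hI : Measurable fun u => ∫⁻ v in Set.Ioc h (3 * h), F u v :=
    hFm.lintegral_prod_right'
  set I := ∫⁻ u in Set.Ioc h (2 * X), ∫⁻ v in Set.Ioc h (3 * h), F u v with hIdef
  have hshift : ∀ u, ∫⁻ v in Set.Ioc (2 * h) (3 * h), F (u + h) (v - h) ≤
      ∫⁻ v in Set.Ioc h (3 * h), F (u + h) v := by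
    intro u
    rw [← MeasureTheory.lintegral_indicator measurableSet_Ioc,
      ← MeasureTheory.lintegral_indicator measurableSet_Ioc,
      ← MeasureTheory.lintegral_add_right_eq_self _ h]
    refine MeasureTheory.lintegral_mono fun v => ?_
    by_cases hv : v + h ∈ Set.Ioc (2 * h) (3 * h)
    · rw [Set.indicator_of_mem hv, Set.indicator_of_mem
        (show v ∈ Set.Ioc h (3 * h) from ⟨by linarith [hv.1], by linarith [hv.2]⟩), add_sub_cancel_right]
    · rw [Set.indicator_of_notMem hv]
      exact zero_le
  have hpt : ∀ u, ENNReal.ofReal h * F u h ≤ 2 * (∫⁻ v in Set.Ioc h (3 * h), F u v) +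
      2 * ∫⁻ v in Set.Ioc h (3 * h), F (u + h) v := by
    intro u
    have hm2 : Measurable fun v => F (u + h) (v - h) := (hFv _).comp (measurable_id.sub_const h)
    calc ENNReal.ofReal h * F u h = ∫⁻ v in Set.Ioc (2 * h) (3 * h), F u h := by
          rw [MeasureTheory.lintegral_const, MeasureTheory.Measure.restrict_apply_univ,
            Real.volume_Ioc, mul_comm]
          congr 2; ring
      _ ≤ ∫⁻ v in Set.Ioc (2 * h) (3 * h), (2 * F u v + 2 * F (u + h) (v - h)) := by
          refine MeasureTheory.lintegral_mono fun v => ?_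
          exact hF u v
      _ = 2 * (∫⁻ v in Set.Ioc (2 * h) (3 * h), F u v) +
          2 * ∫⁻ v in Set.Ioc (2 * h) (3 * h), F (u + h) (v - h) := by
          rw [MeasureTheory.lintegral_add_left ((hFv u).const_mul 2),
            MeasureTheory.lintegral_const_mul _ (hFv u), MeasureTheory.lintegral_const_mul _ hm2]
      _ ≤ _ := by
          gcongr ?_ + 2 * ?_
          · gcongr
            linarith
          · exact hshift u
  rw [← MeasureTheory.lintegral_const_mul' _ _ ENNReal.ofReal_ne_top]
  calc _ ≤ ∫⁻ u in Set.Ioc h X, (2 * (∫⁻ v in Set.Ioc h (3 * h), F u v) +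
        2 * ∫⁻ v in Set.Ioc h (3 * h), F (u + h) v) := MeasureTheory.lintegral_mono hpt
    _ = 2 * (∫⁻ u in Set.Ioc h X, ∫⁻ v in Set.Ioc h (3 * h), F u v) +
        2 * ∫⁻ u in Set.Ioc h X, ∫⁻ v in Set.Ioc h (3 * h), F (u + h) v := by
        rw [MeasureTheory.lintegral_add_left (hI.const_mul 2),
          MeasureTheory.lintegral_const_mul _ hI,
          MeasureTheory.lintegral_const_mul' _ _ (by norm_num)]
    _ ≤ 2 * I + 2 * I := by
        gcongr 2 * ?_ + 2 * ?_
        · exact MeasureTheory.lintegral_mono_set (Set.Ioc_subset_Ioc_right (by linarith))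
        · rw [hIdef, ← MeasureTheory.lintegral_indicator measurableSet_Ioc,
            ← MeasureTheory.lintegral_indicator measurableSet_Ioc,
            ← MeasureTheory.lintegral_add_right_eq_self
              ((Set.Ioc h (2 * X)).indicator _) h]
          refine MeasureTheory.lintegral_mono fun u => ?_
          by_cases hu : u ∈ Set.Ioc h X
          · rw [Set.indicator_of_mem hu, Set.indicator_of_mem
              (show u + h ∈ Set.Ioc h (2 * X) from ⟨by linarith [hu.1], by linarith [hu.2]⟩)]
          · rw [Set.indicator_of_notMem hu]
            exact zero_le
    _ = 4 * I := by ring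

theorem exists_lintegral_psiError_sub_sq_le (hRH : RiemannHypothesis) :
    ∃ C : NNReal, ∀ h X : ℝ, 1 ≤ h → h ≤ X →
    ∫⁻ u in Set.Ioc h X, ‖psiError (u + h) - psiError u‖ₑ ^ 2 ≤
      C * ENNReal.ofReal (h * (√X * Real.log (X + 2) ^ 2)) := by
  obtain ⟨C, hC⟩ := exists_lintegral_psiError_add_sub_le hRH
  refine ⟨4 * (C * 8), fun h X hh hX => ?_⟩
  have hh0 : 0 < h := by linarith
  have hX0 : 0 < X := by linarith
  have h1 := mul_lintegral_diagonal_le measurable_psiError_add_sub hh0 hX fun u v => by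
    have := enorm_sub_sq_le (psiError (u + h)) (psiError (u + v)) (psiError u)
    simpa only [show u + h + (v - h) = u + v by ring] using this
  have key := hC h (2 * X) hh (by linarith)
  set I := ∫⁻ u in Set.Ioc h (2 * X), ∫⁻ v in Set.Ioc h (3 * h),
    ‖psiError (u + v) - psiError u‖ₑ ^ 2
  have hh' : ENNReal.ofReal h ≠ 0 := by simpa using hh0
  refine (ENNReal.mul_le_mul_iff_right hh' ENNReal.ofReal_ne_top).1 (h1.trans ?_)
  have hlog : Real.log (2 * X + 2) ≤ 2 * Real.log (X + 2) := by
    rw [← Real.log_rpow (by linarith)]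
    refine Real.log_le_log (by linarith) ?_
    rw [Real.rpow_two]
    nlinarith
  have hlog0 : 0 ≤ Real.log (2 * X + 2) := Real.log_nonneg (by linarith)
  have hsqrt : √(2 * X) ≤ 2 * √X := by
    rw [Real.sqrt_mul (by norm_num)]
    gcongr
    exact Real.sqrt_le_iff.2 ⟨by norm_num, by norm_num⟩
  calc 4 * I ≤ 4 * (C * ENNReal.ofReal (h ^ 2 * ((2 * √X) * (2 * Real.log (X + 2)) ^ 2))) := by
        gcongr
        exact key.trans (by gcongr)
    _ = 4 * (C * (ENNReal.ofReal h * (8 * ENNReal.ofReal (h * (√X * Real.log (X + 2) ^ 2))))) := by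
        rw [← ENNReal.ofReal_ofNat 8, ← ENNReal.ofReal_mul (by norm_num),
          ← ENNReal.ofReal_mul hh0.le]
        congr 3
        ring
    _ = _ := by
        push_cast
        ring

/-- The contribution of proper prime powers to `Chebyshev.psi √t`. -/
noncomputable def properPowerSum (t : ℝ) : ℝ := Chebyshev.psi √t - Chebyshev.theta √t

/-- The error in the prime number theorem for `Chebyshev.theta √t`. -/
noncomputable def thetaError (t : ℝ) : ℝ := Chebyshev.theta √t - √t

lemma thetaError_eq (t : ℝ) : thetaError t = psiError t - properPowerSum t := by
  unfold thetaError psiError properPowerSum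
  ring

lemma thetaError_of_nonpos {t : ℝ} (ht : t ≤ 0) : thetaError t = 0 := by
  simp [thetaError, Real.sqrt_eq_zero_of_nonpos ht]

lemma properPowerSum_nonneg (t : ℝ) : 0 ≤ properPowerSum t :=
  sub_nonneg.2 (Chebyshev.theta_le_psi _)

lemma monotone_properPowerSum : Monotone properPowerSum := by
  intro s t hst
  simp only [properPowerSum, Chebyshev.psi_sub_theta_eq_sum_not_prime]
  refine Finset.sum_le_sum_of_subset_of_nonneg (Finset.filter_subset_filter _
    (Finset.Ioc_subset_Ioc_right (Nat.floor_mono (Real.sqrt_le_sqrt hst))))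
    fun _ _ _ => ArithmeticFunction.vonMangoldt_nonneg

lemma measurable_thetaError : Measurable thetaError := by
  have : thetaError = fun t => psiError t - properPowerSum t := funext thetaError_eq
  rw [this]
  exact measurable_psiError.sub monotone_properPowerSum.measurable

lemma exists_properPowerSum_sq_le : ∃ C : NNReal, ∀ t : ℝ, properPowerSum t ^ 2 ≤ C * √t := by
  obtain ⟨C, hC⟩ := Chebyshev.psi_sub_theta_le_mul_sqrt
  refine ⟨⟨C ^ 2, sq_nonneg C⟩, fun t => ?_⟩
  calc properPowerSum t ^ 2 ≤ (C * √√t) ^ 2 :=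
        pow_le_pow_left₀ (properPowerSum_nonneg t) (hC _) 2
    _ = C ^ 2 * √t := by rw [mul_pow, Real.sq_sqrt (Real.sqrt_nonneg t)]

lemma lintegral_properPowerSum_sub_sq_le {h X : ℝ} (hh : 0 ≤ h) (hX : h ≤ X) :
    ∫⁻ t in Set.Ioc h X, ‖properPowerSum (t + h) - properPowerSum t‖ₑ ^ 2 ≤
      ENNReal.ofReal (h * properPowerSum (X + h) ^ 2) := by
  set Q := properPowerSum
  have hQ : Monotone Q := monotone_properPowerSum
  have hQs : Monotone fun t => Q (t + h) := fun a b hab => hQ (by linarith)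
  have hi : ∀ a b, IntervalIntegrable Q MeasureTheory.volume a b := fun a b => hQ.intervalIntegrable
  have hi' : ∀ a b, IntervalIntegrable (fun t => Q (t + h)) MeasureTheory.volume a b :=
    fun a b => hQs.intervalIntegrable
  have hint : ∫ t in h..X, (Q (t + h) - Q t) ≤ h * Q (X + h) := by
    rw [intervalIntegral.integral_sub (hi' _ _) (hi _ _), intervalIntegral.integral_comp_add_right,
      intervalIntegral.integral_interval_sub_interval_comm (hi _ _) (hi _ _) (hi _ _)]
    have h1 : ∫ t in X..X + h, Q t ≤ ∫ t in X..X + h, Q (X + h) :=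
      intervalIntegral.integral_mono_on (by linarith) (hi _ _) intervalIntegrable_const
        fun t ht => hQ ht.2
    have h2 : 0 ≤ ∫ t in h..h + h, Q t :=
      intervalIntegral.integral_nonneg (by linarith) fun t _ => properPowerSum_nonneg t
    rw [intervalIntegral.integral_const, smul_eq_mul] at h1
    rw [intervalIntegral.integral_symm h, intervalIntegral.integral_symm X]
    linarith
  have h0 : 0 ≤ Q (X + h) := properPowerSum_nonneg _
  calc _ ≤ ∫⁻ t in Set.Ioc h X, ENNReal.ofReal (Q (X + h)) * ENNReal.ofReal (Q (t + h) - Q t) := by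
        refine MeasureTheory.setLIntegral_mono (by
          have := hQ.measurable
          fun_prop) fun t ht => ?_
        rw [enorm_sq_eq_ofReal, ← ENNReal.ofReal_mul h0]
        refine ENNReal.ofReal_le_ofReal ?_
        have h1 : 0 ≤ Q (t + h) - Q t := sub_nonneg.2 (hQ (by linarith))
        have h2 : Q (t + h) - Q t ≤ Q (X + h) := by
          have := hQ (show t + h ≤ X + h by linarith [ht.2])
          linarith [properPowerSum_nonneg t]
        rw [sq]
        gcongr
    _ = ENNReal.ofReal (Q (X + h)) * ENNReal.ofReal (∫ t in h..X, (Q (t + h) - Q t)) := by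
        rw [MeasureTheory.lintegral_const_mul' _ _ ENNReal.ofReal_ne_top,
          intervalIntegral.integral_of_le hX, MeasureTheory.ofReal_integral_eq_lintegral_ofReal]
        · exact ((hi' h X).sub (hi h X)).1
        · exact Eventually.of_forall fun t => sub_nonneg.2 (hQ (by linarith))
    _ ≤ ENNReal.ofReal (Q (X + h)) * ENNReal.ofReal (h * Q (X + h)) := by gcongr
    _ = _ := by
        rw [← ENNReal.ofReal_mul h0]
        congr 1
        ring

lemma exists_lintegral_thetaError_sq_le (hRH : RiemannHypothesis) :
    ∃ C : NNReal, ∀ Y : ℝ, 1 ≤ Y →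
    ∫⁻ u in Set.Ioc 0 Y, ‖thetaError u‖ₑ ^ 2 ≤ C * ENNReal.ofReal (Y * √Y) := by
  obtain ⟨C, hC⟩ := exists_lintegral_psiError_sq_le hRH
  obtain ⟨D, hD⟩ := exists_properPowerSum_sq_le
  refine ⟨2 * D + 2 * C, fun Y hY => ?_⟩
  have hY0 : 0 < Y := by linarith
  have h1 : ∫⁻ u in Set.Ioc 0 Y, ‖properPowerSum u‖ₑ ^ 2 ≤ D * ENNReal.ofReal (Y * √Y) := by
    calc _ ≤ ∫⁻ u in Set.Ioc 0 Y, ENNReal.ofReal (D * √Y) := by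
          refine MeasureTheory.setLIntegral_mono measurable_const fun u hu => ?_
          rw [enorm_sq_eq_ofReal]
          refine ENNReal.ofReal_le_ofReal ((hD u).trans ?_)
          gcongr
          exact hu.2
      _ = _ := by
          rw [MeasureTheory.lintegral_const, MeasureTheory.Measure.restrict_apply_univ,
            Real.volume_Ioc, ENNReal.ofReal_mul D.coe_nonneg, ENNReal.ofReal_mul hY0.le,
            ENNReal.ofReal_coe_nnreal, sub_zero]
          ring
  have h2 := hC Y hY
  rw [show (3 : ℝ) / 2 = 1 + 1 / 2 by norm_num, Real.rpow_add hY0, Real.rpow_one,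
    ← Real.sqrt_eq_rpow] at h2
  calc _ ≤ ∫⁻ u in Set.Ioc 0 Y, (2 * ‖properPowerSum u‖ₑ ^ 2 + 2 * ‖psiError u‖ₑ ^ 2) := by
        refine MeasureTheory.lintegral_mono fun u => ?_
        have := enorm_sub_sq_le (psiError u) 0 (properPowerSum u)
        rw [zero_sub, zero_sub, enorm_neg, enorm_neg, ← thetaError_eq] at this
        exact this
    _ = 2 * (∫⁻ u in Set.Ioc 0 Y, ‖properPowerSum u‖ₑ ^ 2) +
        2 * ∫⁻ u in Set.Ioc 0 Y, ‖psiError u‖ₑ ^ 2 := by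
        have := monotone_properPowerSum.measurable
        rw [MeasureTheory.lintegral_add_left (by fun_prop),
          MeasureTheory.lintegral_const_mul' _ _ (by norm_num),
          MeasureTheory.lintegral_const_mul' _ _ (by norm_num)]
    _ ≤ 2 * (D * ENNReal.ofReal (Y * √Y)) + 2 * (C * ENNReal.ofReal (Y * √Y)) := by gcongr
    _ = _ := by
        push_cast
        ring

lemma sqrt_two_mul_le (X : ℝ) : √(2 * X) ≤ 2 * √X := by
  rw [Real.sqrt_mul (by norm_num)]
  gcongr
  exact Real.sqrt_le_iff.2 ⟨by norm_num, by norm_num⟩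

lemma exists_lintegral_thetaError_sub_sq_le_edge (hRH : RiemannHypothesis) :
    ∃ C : NNReal, ∀ h : ℝ, 1 ≤ h →
    ∫⁻ u in Set.Ioc (-h) h, ‖thetaError (u + h) - thetaError u‖ₑ ^ 2 ≤
      C * ENNReal.ofReal (h * √h) := by
  obtain ⟨C, hC⟩ := exists_lintegral_thetaError_sq_le hRH
  refine ⟨4 * (C * 4), fun h hh => ?_⟩
  have hh0 : 0 < h := by linarith
  have key := hC (2 * h) (by linarith)
  set I := ∫⁻ u in Set.Ioc 0 (2 * h), ‖thetaError u‖ₑ ^ 2 with hI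
  have hm := measurable_thetaError
  have h1 : ∫⁻ u in Set.Ioc (-h) h, ‖thetaError (u + h)‖ₑ ^ 2 ≤ I := by
    rw [hI, ← MeasureTheory.lintegral_indicator measurableSet_Ioc,
      ← MeasureTheory.lintegral_indicator measurableSet_Ioc,
      ← MeasureTheory.lintegral_add_right_eq_self ((Set.Ioc 0 (2 * h)).indicator _) h]
    refine MeasureTheory.lintegral_mono fun u => ?_
    by_cases hu : u ∈ Set.Ioc (-h) h
    · rw [Set.indicator_of_mem hu, Set.indicator_of_mem
        (show u + h ∈ Set.Ioc 0 (2 * h) from ⟨by linarith [hu.1], by linarith [hu.2]⟩)]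
    · rw [Set.indicator_of_notMem hu]
      exact zero_le
  have h2 : ∫⁻ u in Set.Ioc (-h) h, ‖thetaError u‖ₑ ^ 2 ≤ I := by
    rw [hI, ← MeasureTheory.lintegral_indicator measurableSet_Ioc,
      ← MeasureTheory.lintegral_indicator measurableSet_Ioc]
    refine MeasureTheory.lintegral_mono fun u => ?_
    by_cases hu : u ∈ Set.Ioc (-h) h
    · rw [Set.indicator_of_mem hu]
      by_cases hu0 : u ≤ 0
      · simp [thetaError_of_nonpos hu0]
      · rw [Set.indicator_of_mem
          (show u ∈ Set.Ioc 0 (2 * h) from ⟨not_le.1 hu0, by linarith [hu.2]⟩)]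
    · rw [Set.indicator_of_notMem hu]
      exact zero_le
  calc _ ≤ ∫⁻ u in Set.Ioc (-h) h, (2 * ‖thetaError u‖ₑ ^ 2 + 2 * ‖thetaError (u + h)‖ₑ ^ 2) := by
        refine MeasureTheory.lintegral_mono fun u => ?_
        have := enorm_sub_sq_le (thetaError (u + h)) 0 (thetaError u)
        rwa [zero_sub, zero_sub, enorm_neg, enorm_neg] at this
    _ = 2 * (∫⁻ u in Set.Ioc (-h) h, ‖thetaError u‖ₑ ^ 2) +
        2 * ∫⁻ u in Set.Ioc (-h) h, ‖thetaError (u + h)‖ₑ ^ 2 := by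
        rw [MeasureTheory.lintegral_add_left (by fun_prop),
          MeasureTheory.lintegral_const_mul' _ _ (by norm_num),
          MeasureTheory.lintegral_const_mul' _ _ (by norm_num)]
    _ ≤ 2 * I + 2 * I := by gcongr
    _ = 4 * I := by ring
    _ ≤ 4 * (C * ENNReal.ofReal (2 * h * (2 * √h))) := by
        gcongr
        refine key.trans ?_
        gcongr
        exact sqrt_two_mul_le h
    _ = _ := by
        rw [show 2 * h * (2 * √h) = 4 * (h * √h) by ring, ENNReal.ofReal_mul (by norm_num),
          ENNReal.ofReal_ofNat]
        push_cast
        ring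

/-- Under RH, the mean square of `thetaError` over short intervals. -/
theorem exists_lintegral_thetaError_sub_sq_le (hRH : RiemannHypothesis) :
    ∃ C : NNReal, ∀ h X : ℝ, 1 ≤ h → h ≤ X →
    ∫⁻ u in Set.Ioc (-h) X, ‖thetaError (u + h) - thetaError u‖ₑ ^ 2 ≤
      C * ENNReal.ofReal (h * (√X * Real.log (X + 2) ^ 2)) := by
  obtain ⟨A, hA⟩ := exists_lintegral_thetaError_sub_sq_le_edge hRH
  obtain ⟨B, hB⟩ := exists_lintegral_psiError_sub_sq_le hRH
  obtain ⟨D, hD⟩ := exists_properPowerSum_sq_le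
  refine ⟨A + (2 * (D * 2) + 2 * B), fun h X hh hX => ?_⟩
  have hh0 : 0 < h := by linarith
  have hlog : 1 ≤ Real.log (X + 2) ^ 2 := by
    refine one_le_pow₀ ?_
    rw [Real.le_log_iff_exp_le (by linarith)]
    linarith [Real.exp_one_lt_d9]
  set K := h * (√X * Real.log (X + 2) ^ 2)
  have hK : h * √X ≤ K := by
    have : √X * 1 ≤ √X * Real.log (X + 2) ^ 2 := by gcongr
    rw [mul_one] at this
    exact mul_le_mul_of_nonneg_left this hh0.le
  have hedge : ∫⁻ u in Set.Ioc (-h) h, ‖thetaError (u + h) - thetaError u‖ₑ ^ 2 ≤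
      A * ENNReal.ofReal K := by
    refine (hA h hh).trans ?_
    gcongr
    refine le_trans ?_ hK
    gcongr
  have hQ : ∫⁻ t in Set.Ioc h X, ‖properPowerSum (t + h) - properPowerSum t‖ₑ ^ 2 ≤
      D * (2 * ENNReal.ofReal K) := by
    refine (lintegral_properPowerSum_sub_sq_le hh0.le hX).trans ?_
    rw [← ENNReal.ofReal_coe_nnreal, ← ENNReal.ofReal_ofNat 2, ← ENNReal.ofReal_mul (by norm_num),
      ← ENNReal.ofReal_mul D.coe_nonneg]
    refine ENNReal.ofReal_le_ofReal ?_
    calc h * properPowerSum (X + h) ^ 2 ≤ h * (D * (2 * √X)) := by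
          gcongr
          refine (hD _).trans ?_
          gcongr
          exact (Real.sqrt_le_sqrt (by linarith)).trans (sqrt_two_mul_le X)
      _ = D * (2 * (h * √X)) := by ring
      _ ≤ _ := by gcongr
  have hmain : ∫⁻ u in Set.Ioc h X, ‖thetaError (u + h) - thetaError u‖ₑ ^ 2 ≤
      2 * (D * (2 * ENNReal.ofReal K)) + 2 * (B * ENNReal.ofReal K) := by
    calc _ ≤ ∫⁻ u in Set.Ioc h X, (2 * ‖properPowerSum (u + h) - properPowerSum u‖ₑ ^ 2 +
          2 * ‖psiError (u + h) - psiError u‖ₑ ^ 2) := by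
          refine MeasureTheory.lintegral_mono fun u => ?_
          have := enorm_sub_sq_le (psiError (u + h) - psiError u) 0
            (properPowerSum (u + h) - properPowerSum u)
          rw [zero_sub, zero_sub, enorm_neg, enorm_neg] at this
          rw [thetaError_eq, thetaError_eq]
          convert this using 3
          ring
      _ = 2 * (∫⁻ u in Set.Ioc h X, ‖properPowerSum (u + h) - properPowerSum u‖ₑ ^ 2) +
          2 * ∫⁻ u in Set.Ioc h X, ‖psiError (u + h) - psiError u‖ₑ ^ 2 := by
          have := monotone_properPowerSum.measurable
          rw [MeasureTheory.lintegral_add_left (by fun_prop),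
            MeasureTheory.lintegral_const_mul' _ _ (by norm_num),
            MeasureTheory.lintegral_const_mul' _ _ (by norm_num)]
      _ ≤ _ := by
          gcongr
          exact hB h X hh hX
  rw [← Set.Ioc_union_Ioc_eq_Ioc (show -h ≤ h by linarith) hX]
  refine (MeasureTheory.lintegral_union_le _ _ _).trans ((add_le_add hedge hmain).trans_eq ?_)
  push_cast
  ring

/-- A measurable function vanishing on the negative half-line and bounded on every half-line
`(-∞, T]`. -/
structure CausalFunction (f : ℝ → ℝ) : Prop where
  measurable : Measurable f
  eq_zero : ∀ t ≤ 0, f t = 0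
  bounded : ∀ T, ∃ B, ∀ t ≤ T, |f t| ≤ B

namespace CausalFunction

variable {f g : ℝ → ℝ}

lemma of_monotone (hf : Monotone f) (h0 : ∀ t ≤ 0, f t = 0) : CausalFunction f where
  measurable := hf.measurable
  eq_zero := h0
  bounded T := ⟨f (max T 0), fun t ht => by
    have h1 : f t ≤ f (max T 0) := hf (ht.trans (le_max_left _ _))
    have h2 : 0 ≤ f t := by
      rw [← h0 (min t 0) (min_le_right _ _)]
      exact hf (min_le_left _ _)
    rwa [abs_of_nonneg h2]⟩

lemma sub (hf : CausalFunction f) (hg : CausalFunction g) :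
    CausalFunction fun t => f t - g t where
  measurable := hf.measurable.sub hg.measurable
  eq_zero t ht := by rw [hf.eq_zero t ht, hg.eq_zero t ht, sub_zero]
  bounded T := by
    obtain ⟨B, hB⟩ := hf.bounded T
    obtain ⟨D, hD⟩ := hg.bounded T
    exact ⟨B + D, fun t ht => (abs_sub _ _).trans (add_le_add (hB t ht) (hD t ht))⟩

lemma integrable_mul_sub (hf : CausalFunction f) (hg : CausalFunction g) (z : ℝ) :
    MeasureTheory.Integrable fun t => f t * g (z - t) := by
  obtain ⟨B, hB⟩ := hf.bounded z
  obtain ⟨D, hD⟩ := hg.bounded z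
  have hmf := hf.measurable
  have hmg := hg.measurable
  refine MeasureTheory.Integrable.mono' (g := (Set.Icc 0 z).indicator fun _ => B * D)
    ?_ (by fun_prop) (Eventually.of_forall fun t => ?_)
  · exact (MeasureTheory.integrable_indicator_iff measurableSet_Icc).2
      (MeasureTheory.integrableOn_const (by simp))
  · by_cases ht : t ∈ Set.Icc 0 z
    · rw [Set.indicator_of_mem ht, norm_mul]
      exact mul_le_mul (hB t ht.2) (hD _ (by linarith [ht.1])) (norm_nonneg _)
        ((abs_nonneg _).trans (hB t ht.2))
    · rw [Set.indicator_of_notMem ht]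
      rw [Set.mem_Icc, not_and_or, not_le, not_le] at ht
      rcases ht with ht | ht
      · rw [hf.eq_zero t ht.le, zero_mul, norm_zero]
      · rw [hg.eq_zero _ (by linarith), mul_zero, norm_zero]

end CausalFunction

/-- The mixed second difference of the convolution of `f` and `g` at `z`, with steps `a`
and `b`. -/
noncomputable def diffPairing (a b z : ℝ) (f g : ℝ → ℝ) : ℝ :=
  ∫ t, (f (t + a) - f t) * (g (z - t + b) - g (z - t))

lemma CausalFunction.integrable_shift {f g : ℝ → ℝ} (hf : CausalFunction f)
    (hg : CausalFunction g) (a b z : ℝ) :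
    MeasureTheory.Integrable fun t => f (t + a) * g (z - t + b) := by
  have := (hf.integrable_mul_sub hg (z + a + b)).comp_add_right a
  refine this.congr (Eventually.of_forall fun t => ?_)
  simp only
  congr 2
  ring

lemma CausalFunction.integral_shift (f g : ℝ → ℝ) (a b z : ℝ) :
    ∫ t, f (t + a) * g (z - t + b) = ∫ t, f t * g (z + a + b - t) := by
  rw [← MeasureTheory.integral_add_right_eq_self (fun t => f t * g (z + a + b - t)) a]
  refine MeasureTheory.integral_congr_ae (Eventually.of_forall fun t => ?_)
  simp only
  congr 2
  ring

lemma CausalFunction.integrable_diff {f g : ℝ → ℝ} (hf : CausalFunction f)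
    (hg : CausalFunction g) (a b z : ℝ) :
    MeasureTheory.Integrable fun t => (f (t + a) - f t) * (g (z - t + b) - g (z - t)) := by
  have h1 := hf.integrable_shift hg a b z
  have h2 := hf.integrable_shift hg a 0 z
  have h3 := hf.integrable_shift hg 0 b z
  have h4 := hf.integrable_shift hg 0 0 z
  simp only [add_zero] at h2 h3 h4
  refine ((h1.sub h2).sub (h3.sub h4)).congr (Eventually.of_forall fun t => ?_)
  simp only [Pi.sub_apply]
  ring

lemma diffPairing_eq {f g : ℝ → ℝ} (hf : CausalFunction f) (hg : CausalFunction g) (a b z : ℝ) :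
    diffPairing a b z f g = (∫ t, f t * g (z + a + b - t)) - (∫ t, f t * g (z + a - t)) -
      ((∫ t, f t * g (z + b - t)) - ∫ t, f t * g (z - t)) := by
  have h1 := hf.integrable_shift hg a b z
  have h2 := hf.integrable_shift hg a 0 z
  have h3 := hf.integrable_shift hg 0 b z
  have h4 := hf.integrable_shift hg 0 0 z
  have e2 := CausalFunction.integral_shift f g a 0 z
  have e3 := CausalFunction.integral_shift f g 0 b z
  simp only [add_zero] at h2 h3 h4 e2 e3
  rw [← CausalFunction.integral_shift f g a b z, ← e2, ← e3, ← MeasureTheory.integral_sub' h1 h2,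
    ← MeasureTheory.integral_sub' h3 h4, ← MeasureTheory.integral_sub' (h1.sub h2) (h3.sub h4)]
  refine MeasureTheory.integral_congr_ae (Eventually.of_forall fun t => ?_)
  simp only [Pi.sub_apply]
  ring

lemma diffPairing_comm {f g : ℝ → ℝ} (hf : CausalFunction f) (hg : CausalFunction g)
    (a b z : ℝ) : diffPairing a b z f g = diffPairing a b z g f := by
  have h : ∀ w : ℝ, ∫ t, f t * g (w - t) = ∫ t, g t * f (w - t) := fun w => by
    rw [← MeasureTheory.integral_sub_left_eq_self (fun t => f t * g (w - t))
      MeasureTheory.volume w]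
    refine MeasureTheory.integral_congr_ae (Eventually.of_forall fun t => ?_)
    simp only [sub_sub_cancel]
    ring
  rw [diffPairing_eq hf hg, diffPairing_eq hg hf, h, h, h, h]

lemma diffPairing_self_sub {f g : ℝ → ℝ} (hf : CausalFunction f) (hg : CausalFunction g)
    (a b z : ℝ) :
    diffPairing a b z f f - diffPairing a b z g g =
      2 * diffPairing a b z (fun t => f t - g t) g +
        diffPairing a b z (fun t => f t - g t) (fun t => f t - g t) := by
  have he := hf.sub hg
  have h1 := he.integrable_diff hg a b z
  have h2 := hg.integrable_diff he a b z
  have h3 := he.integrable_diff he a b z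
  have h4 := hg.integrable_diff hg a b z
  rw [two_mul]
  nth_rewrite 2 [diffPairing_comm he hg]
  unfold diffPairing
  rw [← MeasureTheory.integral_add' h1 h2, ← MeasureTheory.integral_add' (h1.add h2) h3,
    ← MeasureTheory.integral_sub' (hf.integrable_diff hf a b z) h4]
  refine MeasureTheory.integral_congr_ae (Eventually.of_forall fun t => ?_)
  simp only [Pi.add_apply, Pi.sub_apply]
  ring

lemma lintegral_mul_le_of_sq {F G : ℝ → ℝ} (hF : Measurable F) (hG : Measurable G)
    {s : Set ℝ} {A B : ℝ}
    (hA : ∫⁻ t in s, ‖F t‖ₑ ^ 2 ≤ ENNReal.ofReal A) (hB : ∫⁻ t in s, ‖G t‖ₑ ^ 2 ≤ ENNReal.ofReal B) :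
    ∫⁻ t in s, ‖F t * G t‖ₑ ≤ ENNReal.ofReal (√A * √B) := by
  have h := ENNReal.lintegral_mul_le_Lp_mul_Lq (MeasureTheory.volume.restrict s)
    Real.HolderConjugate.two_two hF.enorm.aemeasurable hG.enorm.aemeasurable
  simp only [Pi.mul_apply, ENNReal.rpow_two, ← enorm_mul] at h
  refine h.trans ?_
  have hsq : ∀ {I : ENNReal} {x : ℝ}, I ≤ ENNReal.ofReal x →
      I ^ (1 / 2 : ℝ) ≤ ENNReal.ofReal √x := by
    intro I x hI
    rw [Real.sqrt_eq_rpow]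
    rcases le_or_gt 0 x with hx | hx
    · rw [← ENNReal.ofReal_rpow_of_nonneg hx (by norm_num)]
      exact ENNReal.rpow_le_rpow hI (by norm_num)
    · rw [ENNReal.ofReal_of_nonpos hx.le] at hI
      rw [le_zero_iff.1 hI, ENNReal.zero_rpow_of_pos (by norm_num)]
      exact zero_le
  rw [ENNReal.ofReal_mul (Real.sqrt_nonneg _)]
  exact mul_le_mul' (hsq hA) (hsq hB)

lemma abs_diffPairing_le {f g : ℝ → ℝ} (hf : CausalFunction f) (hg : CausalFunction g)
    {a b z X A B : ℝ} (ha : 0 ≤ a) (hb : 0 ≤ b) (hXa : z + a ≤ X) (hXb : z + b ≤ X)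
    (hA : ∫⁻ t in Set.Ioc (-a) X, ‖f (t + a) - f t‖ₑ ^ 2 ≤ ENNReal.ofReal A)
    (hB : ∫⁻ t in Set.Ioc (-b) X, ‖g (t + b) - g t‖ₑ ^ 2 ≤ ENNReal.ofReal B) :
    |diffPairing a b z f g| ≤ √A * √B := by
  have hmf := hf.measurable
  have hmg := hg.measurable
  set S := Set.Ioo (-a) (z + b)
  have h1 : ∫⁻ t in S, ‖f (t + a) - f t‖ₑ ^ 2 ≤ ENNReal.ofReal A :=
    (MeasureTheory.lintegral_mono_set (show S ⊆ Set.Ioc (-a) X from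
      fun t ht => ⟨ht.1, ht.2.le.trans hXb⟩)).trans hA
  have h2 : ∫⁻ t in S, ‖g (z - t + b) - g (z - t)‖ₑ ^ 2 ≤ ENNReal.ofReal B := by
    refine le_trans ?_ hB
    rw [← MeasureTheory.lintegral_indicator measurableSet_Ioo,
      ← MeasureTheory.lintegral_indicator measurableSet_Ioc,
      ← MeasureTheory.lintegral_sub_left_eq_self ((Set.Ioc (-b) X).indicator _) z]
    refine MeasureTheory.lintegral_mono fun t => ?_
    by_cases ht : t ∈ S
    · rw [Set.indicator_of_mem ht, Set.indicator_of_mem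
        (show z - t ∈ Set.Ioc (-b) X from ⟨by linarith [ht.2], by linarith [ht.1]⟩)]
    · rw [Set.indicator_of_notMem ht]
      exact zero_le
  have h3 := lintegral_mul_le_of_sq (F := fun t => f (t + a) - f t)
    (G := fun t => g (z - t + b) - g (z - t)) (by fun_prop) (by fun_prop) h1 h2
  have h0 : 0 ≤ √A * √B := by positivity
  rw [← ENNReal.ofReal_le_ofReal_iff h0, ← Real.norm_eq_abs, ofReal_norm]
  refine (MeasureTheory.enorm_integral_le_lintegral_enorm _).trans (le_trans ?_ h3)
  rw [← MeasureTheory.lintegral_indicator measurableSet_Ioo]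
  refine MeasureTheory.lintegral_mono fun t => ?_
  by_cases ht : t ∈ S
  · rw [Set.indicator_of_mem ht]
  · rw [Set.indicator_of_notMem ht]
    rw [Set.mem_Ioo, not_and_or, not_lt, not_lt] at ht
    rcases ht with ht | ht
    · simp [hf.eq_zero t (by linarith), hf.eq_zero (t + a) (by linarith)]
    · simp [hg.eq_zero (z - t) (by linarith), hg.eq_zero (z - t + b) (by linarith)]

lemma causalFunction_sqrt : CausalFunction Real.sqrt :=
  .of_monotone (fun _ _ h => Real.sqrt_le_sqrt h) fun _ h => Real.sqrt_eq_zero_of_nonpos h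

lemma monotone_theta_sqrt : Monotone fun t : ℝ => Chebyshev.theta √t :=
  fun _ _ h => Chebyshev.theta_mono (Real.sqrt_le_sqrt h)

lemma causalFunction_theta_sqrt : CausalFunction fun t : ℝ => Chebyshev.theta √t :=
  .of_monotone monotone_theta_sqrt fun t h => by
    simp [Real.sqrt_eq_zero_of_nonpos h]

lemma causalFunction_thetaError : CausalFunction thetaError :=
  causalFunction_theta_sqrt.sub causalFunction_sqrt

lemma integral_sqrt_mul_sqrt_sub {z : ℝ} (hz : 0 ≤ z) :
    ∫ t, √t * √(z - t) = Real.pi / 8 * z ^ 2 := by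
  have h1 : ∫ t, √t * √(z - t) = ∫ t in (0 : ℝ)..z, √t * √(z - t) := by
    rw [intervalIntegral.integral_of_le hz, ← MeasureTheory.integral_indicator measurableSet_Ioc]
    refine MeasureTheory.integral_congr_ae (Eventually.of_forall fun t => ?_)
    simp only
    by_cases ht : t ∈ Set.Ioc 0 z
    · rw [Set.indicator_of_mem ht]
    · rw [Set.indicator_of_notMem ht]
      rw [Set.mem_Ioc, not_and_or, not_lt, not_le] at ht
      rcases ht with ht | ht
      · rw [Real.sqrt_eq_zero_of_nonpos ht, zero_mul]
      · rw [Real.sqrt_eq_zero_of_nonpos (by linarith : z - t ≤ 0), mul_zero]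
  have h2 := intervalIntegral.smul_integral_comp_mul_add (a := -1) (b := 1)
    (fun t => √t * √(z - t)) (z / 2) (z / 2)
  rw [show z / 2 * -1 + z / 2 = 0 by ring, show z / 2 * 1 + z / 2 = z by ring] at h2
  rw [h1, ← h2, smul_eq_mul]
  have h3 : ∫ x in (-1 : ℝ)..1, √(z / 2 * x + z / 2) * √(z - (z / 2 * x + z / 2)) =
      ∫ x in (-1 : ℝ)..1, z / 2 * √(1 - x ^ 2) := by
    refine intervalIntegral.integral_congr fun x hx => ?_
    rw [Set.uIcc_of_le (by norm_num)] at hx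
    rw [← Real.sqrt_mul (by nlinarith [hx.1]), show (z / 2 * x + z / 2) *
      (z - (z / 2 * x + z / 2)) = (z / 2) ^ 2 * (1 - x ^ 2) by ring,
      Real.sqrt_mul (sq_nonneg _), Real.sqrt_sq (by linarith)]
  rw [h3, intervalIntegral.integral_const_mul, integral_sqrt_one_sub_sq]
  ring

lemma diffPairing_sqrt {a b z : ℝ} (ha : 0 ≤ a) (hb : 0 ≤ b) (hz : 0 ≤ z) :
    diffPairing a b z Real.sqrt Real.sqrt = Real.pi / 4 * (a * b) := by
  rw [diffPairing_eq causalFunction_sqrt causalFunction_sqrt,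
    integral_sqrt_mul_sqrt_sub (by positivity), integral_sqrt_mul_sqrt_sub (by positivity),
    integral_sqrt_mul_sqrt_sub (by positivity), integral_sqrt_mul_sqrt_sub hz]
  ring

lemma sqrt_add_sub_sqrt_sq_le {u h : ℝ} (hu : 0 ≤ u) (hh : 0 < h) :
    (√(u + h) - √u) ^ 2 ≤ h ^ 2 * (u + h)⁻¹ := by
  have h1 := Real.sq_sqrt (show 0 ≤ u + h by positivity)
  have h2 := Real.sq_sqrt hu
  have h3 := Real.sqrt_nonneg u
  have h4 : √u ≤ √(u + h) := Real.sqrt_le_sqrt (by linarith)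
  rw [← div_eq_mul_inv, le_div_iff₀ (by positivity)]
  calc (√(u + h) - √u) ^ 2 * (u + h) = ((√(u + h) - √u) * √(u + h)) ^ 2 := by
        rw [mul_pow, h1]
    _ ≤ h ^ 2 := by
        refine pow_le_pow_left₀ (mul_nonneg (by linarith) (by linarith)) ?_ 2
        nlinarith

lemma lintegral_sqrt_sub_sq_le {h X : ℝ} (hh : 1 ≤ h) (hX : 1 ≤ X) :
    ∫⁻ u in Set.Ioc (-h) X, ‖√(u + h) - √u‖ₑ ^ 2 ≤
      ENNReal.ofReal (2 * (h ^ 2 * Real.log (X + 2))) := by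
  have hh0 : 0 < h := by linarith
  have hX0 : 0 < X := by linarith
  have hlog : 1 ≤ Real.log (X + 2) := by
    rw [Real.le_log_iff_exp_le (by linarith)]
    linarith [Real.exp_one_lt_d9]
  have h1 : ∫⁻ u in Set.Ioc (-h) 0, ‖√(u + h) - √u‖ₑ ^ 2 ≤ ENNReal.ofReal (h ^ 2) := by
    calc _ ≤ ∫⁻ u in Set.Ioc (-h) 0, ENNReal.ofReal h := by
          refine MeasureTheory.setLIntegral_mono measurable_const fun u hu => ?_
          rw [enorm_sq_eq_ofReal]
          refine ENNReal.ofReal_le_ofReal ?_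
          rw [Real.sqrt_eq_zero_of_nonpos hu.2, sub_zero, Real.sq_sqrt (by linarith [hu.1])]
          linarith [hu.2]
      _ = _ := by
          rw [MeasureTheory.lintegral_const, MeasureTheory.Measure.restrict_apply_univ,
            Real.volume_Ioc, ← ENNReal.ofReal_mul hh0.le]
          congr 1
          ring
  have h2 : ∫⁻ u in Set.Ioc 0 X, ‖√(u + h) - √u‖ₑ ^ 2 ≤
      ENNReal.ofReal (h ^ 2 * Real.log (X + 2)) := by
    have hi : IntervalIntegrable (fun u : ℝ => h ^ 2 * (u + h)⁻¹) MeasureTheory.volume 0 X := by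
      refine (ContinuousOn.intervalIntegrable ?_)
      refine continuousOn_const.mul (ContinuousOn.inv₀ (by fun_prop) fun u hu => ?_)
      rw [Set.uIcc_of_le hX0.le] at hu
      linarith [hu.1]
    calc _ ≤ ∫⁻ u in Set.Ioc 0 X, ENNReal.ofReal (h ^ 2 * (u + h)⁻¹) := by
          refine MeasureTheory.setLIntegral_mono (by fun_prop) fun u hu => ?_
          rw [enorm_sq_eq_ofReal]
          exact ENNReal.ofReal_le_ofReal (sqrt_add_sub_sqrt_sq_le hu.1.le hh0)
      _ = ENNReal.ofReal (∫ u in (0 : ℝ)..X, h ^ 2 * (u + h)⁻¹) := by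
          rw [intervalIntegral.integral_of_le hX0.le,
            MeasureTheory.ofReal_integral_eq_lintegral_ofReal hi.1]
          refine (MeasureTheory.ae_restrict_iff' measurableSet_Ioc).2
            (Eventually.of_forall fun u hu => ?_)
          have := hu.1
          simp only [Pi.zero_apply]
          positivity
      _ ≤ _ := by
          refine ENNReal.ofReal_le_ofReal ?_
          rw [intervalIntegral.integral_const_mul,
            intervalIntegral.integral_comp_add_right (fun u => u⁻¹), zero_add,
            integral_inv_of_pos hh0 (by linarith)]
          gcongr
          rw [div_le_iff₀ hh0]
          nlinarith
  rw [← Set.Ioc_union_Ioc_eq_Ioc (show -h ≤ 0 by linarith) hX0.le]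
  refine (MeasureTheory.lintegral_union_le _ _ _).trans ((add_le_add h1 h2).trans ?_)
  rw [← ENNReal.ofReal_add (by positivity) (by positivity)]
  refine ENNReal.ofReal_le_ofReal ?_
  nlinarith [mul_le_mul_of_nonneg_left hlog (sq_nonneg h)]

/-- Under RH, the mixed second difference of the self-convolution of `Chebyshev.theta ∘ √` is
close to that of the self-convolution of `√`. -/
theorem exists_abs_diffPairing_theta_sub_le (hRH : RiemannHypothesis) :
    ∃ C : ℝ, 0 ≤ C ∧ ∀ a b z X : ℝ, 1 ≤ a → 1 ≤ b → 0 ≤ z → z + a ≤ X → z + b ≤ X →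
    |diffPairing a b z (fun t => Chebyshev.theta √t) (fun t => Chebyshev.theta √t) -
      Real.pi / 4 * (a * b)| ≤
      C * (b * √(a * (√X * Real.log (X + 2) ^ 3)) + √X * Real.log (X + 2) ^ 2 * √(a * b)) := by
  obtain ⟨C, hC⟩ := exists_lintegral_thetaError_sub_sq_le hRH
  refine ⟨2 * √(2 * C) + C, by positivity, fun a b z X ha hb hz hXa hXb => ?_⟩
  have hC' : ∀ h, 1 ≤ h → h ≤ X →
      ∫⁻ u in Set.Ioc (-h) X, ‖thetaError (u + h) - thetaError u‖ₑ ^ 2 ≤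
        ENNReal.ofReal (C * (h * (√X * Real.log (X + 2) ^ 2))) := fun h hh hX => by
    rw [ENNReal.ofReal_mul C.coe_nonneg, ENNReal.ofReal_coe_nnreal]
    exact hC h X hh hX
  have ha0 : 0 < a := by linarith
  have hb0 : 0 < b := by linarith
  set L := Real.log (X + 2)
  have hL : 0 ≤ L := Real.log_nonneg (by linarith)
  have hEs := abs_diffPairing_le causalFunction_thetaError causalFunction_sqrt ha0.le hb0.le hXa
    hXb (hC' a ha (by linarith)) (lintegral_sqrt_sub_sq_le hb (by linarith))
  have hEE := abs_diffPairing_le causalFunction_thetaError causalFunction_thetaError ha0.le hb0.le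
    hXa hXb (hC' a ha (by linarith)) (hC' b hb (by linarith))
  have hdiff := diffPairing_self_sub causalFunction_theta_sqrt causalFunction_sqrt a b z
  rw [diffPairing_sqrt ha0.le hb0.le hz] at hdiff
  have hEsb : √(C * (a * (√X * L ^ 2))) * √(2 * (b ^ 2 * L)) =
      √(2 * C) * (b * √(a * (√X * L ^ 3))) := by
    rw [← Real.sqrt_mul (by positivity), show C * (a * (√X * L ^ 2)) * (2 * (b ^ 2 * L)) =
      2 * C * (b ^ 2 * (a * (√X * L ^ 3))) by ring, Real.sqrt_mul (by positivity),
      Real.sqrt_mul (sq_nonneg b), Real.sqrt_sq hb0.le]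
  have hEEb : √(C * (a * (√X * L ^ 2))) * √(C * (b * (√X * L ^ 2))) =
      C * (√X * L ^ 2 * √(a * b)) := by
    rw [← Real.sqrt_mul (by positivity), show C * (a * (√X * L ^ 2)) * (C * (b * (√X * L ^ 2))) =
      (C * (√X * L ^ 2)) ^ 2 * (a * b) by ring, Real.sqrt_mul (sq_nonneg _),
      Real.sqrt_sq (by positivity)]
    ring
  rw [hEsb] at hEs
  rw [hEEb] at hEE
  rw [hdiff]
  change |2 * diffPairing a b z thetaError Real.sqrt + diffPairing a b z thetaError thetaError| ≤ _
  refine (abs_add_le _ _).trans ?_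
  rw [abs_mul, abs_two]
  have p1 : 0 ≤ b * √(a * (√X * L ^ 3)) := by positivity
  have p2 : 0 ≤ √X * L ^ 2 * √(a * b) := by positivity
  have p3 := C.coe_nonneg
  have p4 := Real.sqrt_nonneg (2 * C)
  nlinarith [mul_nonneg p4 p2, mul_nonneg p3 p1]

lemma theta_sqrt_eq_sum {K : ℕ} {t : ℝ} (ht : t ≤ K) :
    Chebyshev.theta √t =
      ∑ p ∈ range (K + 1) with p.Prime, if (p : ℝ) ^ 2 ≤ t then Real.log p else 0 := by
  rw [← Finset.sum_filter, Chebyshev.theta]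
  refine Finset.sum_congr ?_ fun _ _ => rfl
  ext p
  simp only [Finset.mem_filter, Finset.mem_Ioc, Finset.mem_range]
  constructor
  · rintro ⟨⟨hp0, hp⟩, hpp⟩
    have h1 : (p : ℝ) ^ 2 ≤ t := by
      rw [Nat.le_floor_iff (Real.sqrt_nonneg t)] at hp
      exact (Real.le_sqrt' (by exact_mod_cast hp0)).1 hp
    have h2 : p ^ 2 ≤ K := by exact_mod_cast h1.trans ht
    exact ⟨⟨by nlinarith, hpp⟩, h1⟩
  · rintro ⟨⟨_, hpp⟩, h1⟩
    refine ⟨⟨hpp.pos, ?_⟩, hpp⟩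
    rw [Nat.le_floor_iff (Real.sqrt_nonneg t)]
    exact (Real.le_sqrt' (by exact_mod_cast hpp.pos)).2 h1

lemma theta_sqrt_sub_eq_sum {K : ℕ} {t a : ℝ} (ha : 0 ≤ a) (ht : t + a ≤ K) :
    Chebyshev.theta √(t + a) - Chebyshev.theta √t =
      ∑ p ∈ range (K + 1) with p.Prime,
        if t < (p : ℝ) ^ 2 ∧ (p : ℝ) ^ 2 ≤ t + a then Real.log p else 0 := by
  rw [theta_sqrt_eq_sum ht, theta_sqrt_eq_sum (by linarith : t ≤ K), ← Finset.sum_sub_distrib]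
  refine Finset.sum_congr rfl fun p _ => ?_
  by_cases h1 : (p : ℝ) ^ 2 ≤ t
  · rw [if_pos h1, if_pos (by linarith), if_neg (by simp [h1]), sub_self]
  · simp [h1, not_le.1 h1]

lemma diffPairing_theta_eq_sum {K : ℕ} {a b z : ℝ} (ha : 0 ≤ a) (hb : 0 ≤ b)
    (hK : z + a + b ≤ K) :
    diffPairing a b z (fun t => Chebyshev.theta √t) (fun t => Chebyshev.theta √t) =
      ∑ p ∈ range (K + 1) with p.Prime, ∑ q ∈ range (K + 1) with q.Prime,
        Real.log p * Real.log q * MeasureTheory.volume.real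
          (Set.Ico ((p : ℝ) ^ 2 - a) (p ^ 2) ∩ Set.Ioc (z - (q : ℝ) ^ 2) (z - q ^ 2 + b)) := by
  set P := {p ∈ range (K + 1) | p.Prime}
  set S : ℕ → ℕ → Set ℝ := fun p q =>
    Set.Ico ((p : ℝ) ^ 2 - a) (p ^ 2) ∩ Set.Ioc (z - (q : ℝ) ^ 2) (z - q ^ 2 + b) with hS
  have hSm : ∀ p q, MeasurableSet (S p q) := fun p q => measurableSet_Ico.inter measurableSet_Ioc
  have hSf : ∀ p q, MeasureTheory.volume (S p q) ≠ ⊤ := fun p q =>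
    MeasureTheory.measure_ne_top_of_subset Set.inter_subset_left (by simp)
  have hpos : ∀ p ∈ P, 0 < (p : ℝ) ^ 2 := fun p hp => by
    have : 0 < p := (Finset.mem_filter.1 hp).2.pos
    positivity
  have hpt : ∀ t : ℝ, (Chebyshev.theta √(t + a) - Chebyshev.theta √t) *
      (Chebyshev.theta √(z - t + b) - Chebyshev.theta √(z - t)) =
      ∑ p ∈ P, ∑ q ∈ P, (S p q).indicator (fun _ => Real.log p * Real.log q) t := by
    intro t
    by_cases h1 : t ≤ -a
    · rw [Real.sqrt_eq_zero_of_nonpos (by linarith : t + a ≤ 0),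
        Real.sqrt_eq_zero_of_nonpos (by linarith : t ≤ 0), sub_self, zero_mul]
      refine (Finset.sum_eq_zero fun p hp => Finset.sum_eq_zero fun q hq => ?_).symm
      refine Set.indicator_of_notMem (fun h => ?_) _
      linarith [h.1.1, hpos p hp]
    by_cases h2 : z + b ≤ t
    · rw [Real.sqrt_eq_zero_of_nonpos (by linarith : z - t + b ≤ 0),
        Real.sqrt_eq_zero_of_nonpos (by linarith : z - t ≤ 0), sub_self, mul_zero]
      refine (Finset.sum_eq_zero fun p hp => Finset.sum_eq_zero fun q hq => ?_).symm
      refine Set.indicator_of_notMem (fun h => ?_) _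
      linarith [h.2.2, hpos q hq]
    rw [theta_sqrt_sub_eq_sum (K := K) ha (by linarith),
      theta_sqrt_sub_eq_sum (K := K) hb (by linarith), Finset.sum_mul_sum]
    refine Finset.sum_congr rfl fun p _ => Finset.sum_congr rfl fun q _ => ?_
    by_cases h3 : t ∈ S p q
    · rw [Set.indicator_of_mem h3, if_pos ⟨h3.1.2, by linarith [h3.1.1]⟩,
        if_pos ⟨by linarith [h3.2.1], by linarith [h3.2.2]⟩]
    · rw [Set.indicator_of_notMem h3, mul_eq_zero, ite_eq_right_iff, ite_eq_right_iff]
      by_contra! h4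
      exact h3 ⟨⟨by linarith [h4.1.1.2], h4.1.1.1⟩,
        ⟨by linarith [h4.2.1.1], by linarith [h4.2.1.2]⟩⟩
  have hint : ∀ p q, MeasureTheory.Integrable
      ((S p q).indicator fun _ => Real.log p * Real.log q) := fun p q =>
    (MeasureTheory.integrable_indicator_iff (hSm p q)).2
      (MeasureTheory.integrableOn_const (hSf p q))
  unfold diffPairing
  simp_rw [hpt]
  rw [MeasureTheory.integral_finsetSum _ fun p _ =>
    MeasureTheory.integrable_finsetSum _ fun q _ => hint p q]
  refine Finset.sum_congr rfl fun p _ => ?_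
  rw [MeasureTheory.integral_finsetSum _ fun q _ => hint p q]
  refine Finset.sum_congr rfl fun q _ => ?_
  rw [MeasureTheory.integral_indicator_const _ (hSm p q), smul_eq_mul, mul_comm]

lemma abs_volume_Ico_inter_Ioc_sub_le {a b : ℝ} (hb : 0 ≤ b) (hab : b ≤ a) (x y z : ℝ) :
    |MeasureTheory.volume.real (Set.Ico (x - a) x ∩ Set.Ioc (z - y) (z - y + b)) -
      if z < x + y ∧ x + y ≤ z + a then b else 0| ≤
    (if z < x + y ∧ x + y ≤ z + b then b else 0) +
      if z + a < x + y ∧ x + y ≤ z + a + b then b else 0 := by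
  set S := Set.Ico (x - a) x ∩ Set.Ioc (z - y) (z - y + b)
  have h0 : 0 ≤ MeasureTheory.volume.real S := MeasureTheory.measureReal_nonneg
  have hvol : MeasureTheory.volume.real (Set.Ioc (z - y) (z - y + b)) = b := by
    rw [Real.volume_real_Ioc_of_le (by linarith)]
    ring
  have h1 : MeasureTheory.volume.real S ≤ b :=
    (MeasureTheory.measureReal_mono Set.inter_subset_right (by simp)).trans_eq hvol
  rcases le_or_gt (x + y) z with h2 | h2
  · have : S = ∅ := Set.eq_empty_of_forall_notMem fun t ht => by linarith [ht.1.2, ht.2.1]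
    rw [this, MeasureTheory.measureReal_empty, if_neg (by simp [h2]), sub_zero, abs_zero]
    split_ifs <;> linarith
  rcases le_or_gt (x + y) (z + b) with h3 | h3
  · rw [if_pos ⟨h2, by linarith⟩, if_pos ⟨h2, h3⟩, if_neg (by simp; intro; linarith),
      abs_le]
    constructor <;> linarith
  rcases le_or_gt (x + y) (z + a) with h4 | h4
  · have : S = Set.Ioc (z - y) (z - y + b) := Set.inter_eq_right.2 fun t ht =>
      ⟨by linarith [ht.1], by linarith [ht.2]⟩
    rw [this, hvol, if_pos ⟨h2, h4⟩, sub_self, abs_zero]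
    split_ifs <;> linarith
  rcases le_or_gt (x + y) (z + a + b) with h5 | h5
  · rw [if_neg (by simp [h4]), if_neg (by simp [h3]), if_pos ⟨h4, h5⟩, sub_zero, abs_of_nonneg h0]
    linarith
  · have : S = ∅ := Set.eq_empty_of_forall_notMem fun t ht => by linarith [ht.1.1, ht.2.2]
    rw [this, MeasureTheory.measureReal_empty, if_neg (by simp [h4]), sub_zero, abs_zero]
    split_ifs <;> linarith

lemma card_le_floor_add_one {s : Finset ℕ} {D : ℝ}
    (h : ∀ x ∈ s, ∀ y ∈ s, x ≤ y → (y : ℝ) - x ≤ D) : #s ≤ ⌊D⌋₊ + 1 := by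
  rcases s.eq_empty_or_nonempty with rfl | hs
  · simp
  have hsub : s ⊆ Finset.Icc (s.min' hs) (s.min' hs + ⌊D⌋₊) := fun y hy => by
    have h1 := s.min'_le y hy
    have h2 : y - s.min' hs ≤ ⌊D⌋₊ := by
      refine Nat.le_floor ?_
      rw [Nat.cast_sub h1]
      exact h _ (s.min'_mem hs) y hy h1
    rw [Finset.mem_Icc]
    omega
  refine (Finset.card_le_card hsub).trans ?_
  rw [Nat.card_Icc]
  omega

lemma card_ordered_sq_add_sq_le {A : Finset (ℕ × ℕ)} {Z b : ℝ} (hZ : 0 < Z)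
    (hA : ∀ x ∈ A, x.1 ≤ x.2 ∧ Z < (x.1 : ℝ) ^ 2 + (x.2 : ℝ) ^ 2 ∧
      (x.1 : ℝ) ^ 2 + (x.2 : ℝ) ^ 2 ≤ Z + b) :
    #A ≤ (⌊b / √Z⌋₊ + 1) * (⌊√(Z + b)⌋₊ + 1) := by
  rw [← Finset.card_range (⌊√(Z + b)⌋₊ + 1)]
  refine Finset.card_le_mul_card_image_of_maps_to (f := Prod.fst) (fun x hx => ?_) _
    fun p _ => ?_
  · rw [Finset.mem_range, Nat.lt_succ_iff]
    refine Nat.le_floor (Real.le_sqrt_of_sq_le ?_)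
    nlinarith [(hA x hx).2.2, sq_nonneg (x.2 : ℝ)]
  · rw [← Finset.card_image_of_injOn (f := Prod.snd)]
    · refine card_le_floor_add_one fun q₁ h₁ q₂ h₂ hle => ?_
      simp only [Finset.mem_image, Finset.mem_filter, Prod.exists, exists_eq_right] at h₁ h₂
      obtain ⟨o₁, l₁, -⟩ := hA _ h₁
      obtain ⟨-, -, u₂⟩ := hA _ h₂
      simp only at o₁ l₁ u₂
      have o₁' : (p : ℝ) ≤ q₁ := Nat.cast_le.2 o₁
      have hle' : (q₁ : ℝ) ≤ q₂ := Nat.cast_le.2 hle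
      have hs : √Z ≤ q₁ + q₂ := by
        rw [Real.sqrt_le_iff]
        constructor
        · positivity
        · have := Nat.cast_nonneg (α := ℝ) q₁
          nlinarith
      rw [le_div_iff₀ (Real.sqrt_pos.2 hZ)]
      nlinarith [mul_le_mul_of_nonneg_left hs (sub_nonneg.2 hle')]
    · intro x hx y hy hxy
      have h1 := (Finset.mem_filter.1 hx).2
      have h2 := (Finset.mem_filter.1 hy).2
      exact Prod.ext (h1.trans h2.symm) hxy

lemma card_sq_add_sq_le {A : Finset (ℕ × ℕ)} {Z b : ℝ} (hZ : 0 < Z) (hb : 0 ≤ b)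
    (hA : ∀ x ∈ A, Z < (x.1 : ℝ) ^ 2 + (x.2 : ℝ) ^ 2 ∧
      (x.1 : ℝ) ^ 2 + (x.2 : ℝ) ^ 2 ≤ Z + b) :
    (#A : ℝ) ≤ 2 * ((b / √Z + 1) * (√(Z + b) + 1)) := by
  have h1 : #{x ∈ A | x.1 ≤ x.2} ≤ (⌊b / √Z⌋₊ + 1) * (⌊√(Z + b)⌋₊ + 1) := by
    refine card_ordered_sq_add_sq_le hZ fun x hx => ?_
    rw [Finset.mem_filter] at hx
    exact ⟨hx.2, hA x hx.1⟩
  have h2 : #{x ∈ A | ¬x.1 ≤ x.2} ≤ (⌊b / √Z⌋₊ + 1) * (⌊√(Z + b)⌋₊ + 1) := by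
    rw [← Finset.card_image_of_injective _ Prod.swap_injective]
    refine card_ordered_sq_add_sq_le hZ fun x hx => ?_
    obtain ⟨y, hy, rfl⟩ := Finset.mem_image.1 hx
    rw [Finset.mem_filter] at hy
    obtain ⟨h3, h4⟩ := hA y hy.1
    exact ⟨(not_le.1 hy.2).le, by simpa only [Prod.fst_swap, Prod.snd_swap, add_comm] using h3,
      by simpa only [Prod.fst_swap, Prod.snd_swap, add_comm] using h4⟩
  have h3 : #A ≤ 2 * ((⌊b / √Z⌋₊ + 1) * (⌊√(Z + b)⌋₊ + 1)) := by
    rw [← Finset.card_filter_add_card_filter_not (s := A) fun x => x.1 ≤ x.2]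
    omega
  calc (#A : ℝ) ≤ 2 * (((⌊b / √Z⌋₊ : ℝ) + 1) * ((⌊√(Z + b)⌋₊ : ℝ) + 1)) := by exact_mod_cast h3
    _ ≤ _ := by
      gcongr
      · exact Nat.floor_le (by positivity)
      · exact Nat.floor_le (Real.sqrt_nonneg _)

lemma sum_r22_eq {N H K : ℕ} (hK : N + H ≤ K) :
    ∑ n ∈ Finset.Ioc N (N + H), r22 n =
      ∑ p ∈ range (K + 1) with p.Prime, ∑ q ∈ range (K + 1) with q.Prime,
        if (N : ℝ) < (p : ℝ) ^ 2 + (q : ℝ) ^ 2 ∧ (p : ℝ) ^ 2 + (q : ℝ) ^ 2 ≤ N + H then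
          Real.log p * Real.log q else 0 := by
  have h1 : ∀ n ∈ Finset.Ioc N (N + H), r22 n =
      ∑ p ∈ range (K + 1) with p.Prime, ∑ q ∈ range (K + 1) with q.Prime,
        if p ^ 2 + q ^ 2 = n then Real.log p * Real.log q else 0 := by
    intro n hn
    have hnK : n ≤ K := (Finset.mem_Ioc.1 hn).2.trans hK
    have hsub : range (n + 1) ⊆ range (K + 1) := Finset.range_subset_range.2 (by omega)
    have hle : ∀ {p : ℕ}, p ∉ range (n + 1) → ∀ q, ¬p ^ 2 + q ^ 2 = n := fun {p} hp q h => by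
      rw [Finset.mem_range, not_lt] at hp
      nlinarith [sq_nonneg q]
    rw [r22, Finset.sum_filter]
    refine (Finset.sum_subset hsub fun p _ hp => Finset.sum_eq_zero fun q _ =>
      if_neg fun h => hle hp q h.2.2).trans (Finset.sum_congr rfl fun p _ => ?_)
    rw [Finset.sum_filter]
    refine (Finset.sum_subset hsub fun q _ hq =>
      if_neg fun h => hle hq p ((add_comm _ _).trans h.2.2)).trans ?_
    by_cases hp : p.Prime
    · rw [if_pos hp]
      refine Finset.sum_congr rfl fun q _ => ?_
      by_cases hq : q.Prime <;> simp [hp, hq]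
    · simp [hp]
  rw [Finset.sum_congr rfl h1, Finset.sum_comm]
  refine Finset.sum_congr rfl fun p _ => ?_
  rw [Finset.sum_comm]
  refine Finset.sum_congr rfl fun q _ => ?_
  rw [Finset.sum_ite_eq]
  refine if_congr ?_ rfl rfl
  rw [Finset.mem_Ioc]
  norm_cast

lemma sum_log_mul_log_le {K N : ℕ} {Z b : ℝ} (hZ : 0 < Z) (hb : 0 ≤ b) (hZb : Z + b ≤ (N : ℝ) ^ 2) :
    ∑ p ∈ range (K + 1) with p.Prime, ∑ q ∈ range (K + 1) with q.Prime,
      Real.log p * Real.log q *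
        (if Z < (p : ℝ) ^ 2 + (q : ℝ) ^ 2 ∧ (p : ℝ) ^ 2 + (q : ℝ) ^ 2 ≤ Z + b then b else 0) ≤
    2 * ((b / √Z + 1) * (√(Z + b) + 1)) * (Real.log N ^ 2 * b) := by
  set P := {p ∈ range (K + 1) | p.Prime}
  set A := {x ∈ P ×ˢ P | Z < (x.1 : ℝ) ^ 2 + (x.2 : ℝ) ^ 2 ∧
      (x.1 : ℝ) ^ 2 + (x.2 : ℝ) ^ 2 ≤ Z + b} with hA
  have hcard := card_sq_add_sq_le hZ hb (A := A) fun x hx => (Finset.mem_filter.1 hx).2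
  rw [← Finset.sum_product']
  simp_rw [mul_ite, mul_zero]
  rw [← Finset.sum_filter, ← hA]
  refine (Finset.sum_le_card_nsmul A _ (Real.log N ^ 2 * b) fun x hx => ?_).trans ?_
  · obtain ⟨hx1, -, hx2⟩ := Finset.mem_filter.1 hx
    obtain ⟨hp, hq⟩ := Finset.mem_product.1 hx1
    have hp0 := (Finset.mem_filter.1 hp).2.pos
    have hq0 := (Finset.mem_filter.1 hq).2.pos
    have hN : (0 : ℝ) ≤ N := Nat.cast_nonneg N
    have hpN : (x.1 : ℝ) ≤ N := abs_le_of_sq_le_sq' (by nlinarith [sq_nonneg (x.2 : ℝ)]) hN |>.2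
    have hqN : (x.2 : ℝ) ≤ N := abs_le_of_sq_le_sq' (by nlinarith [sq_nonneg (x.1 : ℝ)]) hN |>.2
    have h1 : Real.log x.1 ≤ Real.log N := Real.log_le_log (by exact_mod_cast hp0) hpN
    have h2 : Real.log x.2 ≤ Real.log N := Real.log_le_log (by exact_mod_cast hq0) hqN
    have h3 : 0 ≤ Real.log x.1 := Real.log_natCast_nonneg _
    have h4 : 0 ≤ Real.log x.2 := Real.log_natCast_nonneg _
    rw [sq]
    gcongr
  · rw [nsmul_eq_mul]
    gcongr

lemma abs_diffPairing_theta_sub_sum_r22_le {N H : ℕ} {b : ℝ} (hN : 3 ≤ N) (hb : 0 ≤ b)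
    (hbH : b ≤ H) (hHN : H ≤ N) :
    |diffPairing H b N (fun t => Chebyshev.theta √t) (fun t => Chebyshev.theta √t) -
      b * ∑ n ∈ Finset.Ioc N (N + H), r22 n| ≤
      4 * ((b / √N + 1) * (√(3 * N) + 1)) * (Real.log N ^ 2 * b) := by
  have hN' : (3 : ℝ) ≤ N := by exact_mod_cast hN
  have hHN' : (H : ℝ) ≤ N := by exact_mod_cast hHN
  have hH0 : (0 : ℝ) ≤ H := Nat.cast_nonneg H
  have hN0 : (0 : ℝ) < N := by linarith
  rw [diffPairing_theta_eq_sum (K := 3 * N) hH0 hb (by push_cast; linarith),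
    sum_r22_eq (K := 3 * N) (by omega), Finset.mul_sum, ← Finset.sum_sub_distrib]
  simp_rw [Finset.mul_sum, ← Finset.sum_sub_distrib]
  have h1 := sum_log_mul_log_le (K := 3 * N) (N := N) hN0 hb (by nlinarith)
  have h2 := sum_log_mul_log_le (K := 3 * N) (N := N) (Z := N + H) (by positivity) hb
    (by nlinarith)
  set P := {p ∈ range (3 * N + 1) | p.Prime}
  have h3 : 2 * ((b / √N + 1) * (√(N + b) + 1)) * (Real.log N ^ 2 * b) ≤
      2 * ((b / √N + 1) * (√(3 * N) + 1)) * (Real.log N ^ 2 * b) := by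
    gcongr
    linarith
  have h4 : 2 * ((b / √(N + H) + 1) * (√(N + H + b) + 1)) * (Real.log N ^ 2 * b) ≤
      2 * ((b / √N + 1) * (√(3 * N) + 1)) * (Real.log N ^ 2 * b) := by
    gcongr <;> linarith
  refine (Finset.abs_sum_le_sum_abs _ _).trans ?_
  refine (Finset.sum_le_sum fun p _ => Finset.abs_sum_le_sum_abs _ _).trans ?_
  refine le_trans ?_ ((add_le_add (h1.trans h3) (h2.trans h4)).trans_eq (by ring))
  rw [← Finset.sum_add_distrib]
  refine Finset.sum_le_sum fun p _ => ?_
  rw [← Finset.sum_add_distrib]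
  refine Finset.sum_le_sum fun q _ => ?_
  have hlog : 0 ≤ Real.log p * Real.log q :=
    mul_nonneg (Real.log_natCast_nonneg _) (Real.log_natCast_nonneg _)
  have key := abs_volume_Ico_inter_Ioc_sub_le hb hbH ((p : ℝ) ^ 2) ((q : ℝ) ^ 2) N
  have hif : ∀ (c : Prop) [Decidable c], b * (if c then Real.log p * Real.log q else 0) =
      Real.log p * Real.log q * (if c then b else 0) := fun c _ => by
    split_ifs <;> ring
  rw [hif, ← mul_sub, abs_mul, abs_of_nonneg hlog, ← mul_add]
  exact mul_le_mul_of_nonneg_left key hlog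

lemma exists_abs_sum_r22_sub_le (hRH : RiemannHypothesis) :
    ∃ C : ℝ, 0 ≤ C ∧ ∀ N H : ℕ, 3 ≤ N → H ≤ N → √N * Real.log N ^ 3 ≤ H →
    |(∑ n ∈ Finset.Ioc N (N + H), r22 n) - Real.pi / 4 * H| ≤
      C * √(H * (√N * Real.log N ^ 3)) := by
  obtain ⟨C, hC0, hC⟩ := exists_abs_diffPairing_theta_sub_le hRH
  refine ⟨12 * C + 24, by positivity, fun N H hN hHN hlow => ?_⟩
  have hN' : (3 : ℝ) ≤ N := by exact_mod_cast hN
  have hHN' : (H : ℝ) ≤ N := by exact_mod_cast hHN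
  have hH0 : (0 : ℝ) ≤ H := Nat.cast_nonneg H
  have hs1 : 1 ≤ √(N : ℝ) := Real.one_le_sqrt.2 (by linarith)
  have hs2 : √(N : ℝ) ^ 2 = N := Real.sq_sqrt (by linarith)
  set s := √(N : ℝ)
  have hL1 : 1 ≤ Real.log N := by
    rw [Real.le_log_iff_exp_le (by linarith)]
    linarith [Real.exp_one_lt_d9]
  have hL2 : Real.log (2 * N + 2) ≤ 2 * Real.log N := by
    rw [← Real.log_rpow (by linarith)]
    refine Real.log_le_log (by linarith) ?_
    rw [Real.rpow_two]
    nlinarith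
  have hL20 : 0 ≤ Real.log (2 * N + 2) := Real.log_nonneg (by linarith)
  set L := Real.log N
  have hL0 : 0 < L := by linarith
  have hs0 : 0 < s := by linarith
  set b := s * L with hb
  have hb0 : 0 < b := by positivity
  have hb1 : 1 ≤ b := one_le_mul_of_one_le_of_one_le hs1 hL1
  have hbH : b ≤ H := by
    refine le_trans ?_ hlow
    have : L ^ 1 ≤ L ^ 3 := pow_le_pow_right₀ hL1 (by norm_num)
    rw [pow_one] at this
    exact mul_le_mul_of_nonneg_left this hs0.le
  set R := √(H * (s * L ^ 3)) with hR
  have hR0 : 0 ≤ R := Real.sqrt_nonneg _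
  have hsR : s * L ^ 3 ≤ R := by
    refine Real.le_sqrt_of_sq_le ?_
    rw [sq]
    gcongr
  have hmain := hC H b N (2 * N) (hb1.trans hbH) hb1 (by linarith) (by linarith) (by linarith)
  have hedge := abs_diffPairing_theta_sub_sum_r22_le hN hb0.le hbH hHN
  have hX : √(2 * (N : ℝ)) ≤ 2 * s := sqrt_two_mul_le N
  have e1 : √(H * (√(2 * (N : ℝ)) * Real.log (2 * N + 2) ^ 3)) ≤ 4 * R := by
    calc _ ≤ √(H * (2 * s * (2 * L) ^ 3)) := by gcongr
      _ = √(4 ^ 2 * (H * (s * L ^ 3))) := by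
          congr 1
          ring
      _ = 4 * R := by rw [Real.sqrt_mul (by norm_num), Real.sqrt_sq (by norm_num)]
  have e2 : √(2 * (N : ℝ)) * Real.log (2 * N + 2) ^ 2 * √(H * b) ≤ 8 * (b * R) := by
    calc _ ≤ 2 * s * (2 * L) ^ 2 * √(H * b) := by gcongr
      _ = 8 * (b * (L * √(H * b))) := by
          rw [hb]
          ring
      _ = 8 * (b * R) := by
          rw [hR, show (H : ℝ) * (s * L ^ 3) = L ^ 2 * (H * b) by rw [hb]; ring,
            Real.sqrt_mul (sq_nonneg L), Real.sqrt_sq hL0.le]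
  have e3 : 4 * ((b / s + 1) * (√(3 * (N : ℝ)) + 1)) * (L ^ 2 * b) ≤ 24 * (b * R) := by
    have h1 : b / s = L := by
      rw [hb]
      field_simp
    have h2 : √(3 * (N : ℝ)) + 1 ≤ 3 * s := by
      have : √(3 * (N : ℝ)) ≤ 2 * s := by
        refine Real.sqrt_le_iff.2 ⟨by positivity, ?_⟩
        nlinarith
      linarith
    calc _ ≤ 4 * ((L + L) * (3 * s)) * (L ^ 2 * b) := by
          rw [h1]
          gcongr
      _ = 24 * (b * (s * L ^ 3)) := by ring
      _ ≤ _ := by gcongr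
  set J := diffPairing H b N (fun t => Chebyshev.theta √t) (fun t => Chebyshev.theta √t)
  set S := ∑ n ∈ Finset.Ioc N (N + H), r22 n
  have hfin : b * |S - Real.pi / 4 * H| ≤ b * ((12 * C + 24) * R) := by
    calc b * |S - Real.pi / 4 * H| = |(J - Real.pi / 4 * (H * b)) - (J - b * S)| := by
          rw [← abs_of_pos hb0, ← abs_mul, abs_of_pos hb0]
          congr 1
          ring
      _ ≤ |J - Real.pi / 4 * (H * b)| + |J - b * S| := abs_sub _ _
      _ ≤ C * (b * (4 * R) + 8 * (b * R)) + 24 * (b * R) := by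
          refine add_le_add (hmain.trans ?_) (hedge.trans e3)
          gcongr
      _ = _ := by ring
  exact le_of_mul_le_mul_left hfin hb0

/-- Assuming RH, `∑_{n=N+1}^{N+H} r''_{2,2}(n) = (π/4) H`
`+ O(H²/N + H^{1/2} N^{1/4} log^{3/2} N)` as `N → ∞`, uniformly for
`N^{1/2} (log N)³ = o(H)` and `H = o(N)`. -/
theorem two_prime_squares_short_intervals
    (hRH : RiemannHypothesis) (H : ℕ → ℕ)
    (hlow : Tendsto (fun N : ℕ => (N : ℝ) ^ ((1 : ℝ) / 2) * Real.log N ^ 3 / H N) atTop (nhds 0))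
    (hupp : Tendsto (fun N : ℕ => (H N : ℝ) / N) atTop (nhds 0)) :
    (fun N : ℕ => (∑ n ∈ Finset.Ioc N (N + H N), r22 n) - Real.pi / 4 * H N)
      =O[atTop]
    (fun N : ℕ => (H N : ℝ) ^ 2 / N +
      (H N : ℝ) ^ ((1 : ℝ) / 2) * (N : ℝ) ^ ((1 : ℝ) / 4) * Real.log N ^ ((3 : ℝ) / 2)) := by
  obtain ⟨C, hC0, hC⟩ := exists_abs_sum_r22_sub_le hRH
  refine IsBigO.of_bound C ?_
  filter_upwards [eventually_ge_atTop 3, hlow.eventually (gt_mem_nhds one_pos),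
    hupp.eventually (gt_mem_nhds one_pos)] with N hN h1 h2
  have hN0 : (0 : ℝ) < N := by exact_mod_cast (by omega : 0 < N)
  have hL0 : 0 ≤ Real.log N := Real.log_natCast_nonneg N
  have hHN : H N ≤ N := by
    rw [div_lt_one hN0] at h2
    exact_mod_cast h2.le
  have hnn : 0 ≤ (H N : ℝ) ^ 2 / N +
      (H N : ℝ) ^ ((1 : ℝ) / 2) * (N : ℝ) ^ ((1 : ℝ) / 4) * Real.log N ^ ((3 : ℝ) / 2) := by
    positivity
  rw [Real.norm_eq_abs, Real.norm_eq_abs, abs_of_nonneg hnn]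
  rcases (H N).eq_zero_or_pos with hH | hH
  · simp [hH]
  · have hH0 : (0 : ℝ) < H N := by exact_mod_cast hH
    rw [div_lt_one hH0, ← Real.sqrt_eq_rpow] at h1
    refine (hC N (H N) hN hHN h1.le).trans (mul_le_mul_of_nonneg_left ?_ hC0)
    have hroot : √(H N * (√N * Real.log N ^ 3)) =
        (H N : ℝ) ^ ((1 : ℝ) / 2) * (N : ℝ) ^ ((1 : ℝ) / 4) * Real.log N ^ ((3 : ℝ) / 2) := by
      rw [Real.sqrt_mul hH0.le, Real.sqrt_mul (Real.sqrt_nonneg _), Real.sqrt_eq_rpow,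
        Real.sqrt_eq_rpow, Real.sqrt_eq_rpow, Real.sqrt_eq_rpow, ← Real.rpow_mul hN0.le,
        ← Real.rpow_natCast, ← Real.rpow_mul hL0, mul_assoc]
      norm_num
    rw [hroot]
    have : 0 ≤ (H N : ℝ) ^ 2 / N := by positivity
    linarith
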